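/- arXiv:math/0703640 — 2 statements merged into one kernel-verified Lean document; each statement's English description precedes it below -/
import Mathlib

section
/- Let (α₁,α₂) ∈ ℝ², (ν₁,ν₂) ∈ ℝ₊², and 1 ≤ p₁,q₁,p₂,q₂ ≤ ∞ be such that for all φ ∈ S(ℝ): ‖D_x^{α₁} V(t)φ‖_{L^{p₁}_x L^{q₁}_T} ≲ T^{ν₁}‖φ‖_{L²} and ‖D_x^{α₂} V(t)φ‖_{L^{p₂}_x L^{q₂}_T} ≲ T^{ν₂}‖φ‖_{L²}. Define p̄₂ and q̄₂ by 1/p̄₂ = 1 − 1/p₂ and 1/q̄₂ = 1 − 1/q₂. Then for all f ∈ S(ℝ²): (i) ‖D_x^{α₂} ∫_0^t V(t−τ) f(τ) dτ‖_{L^∞_T L²_x} ≲ T^{ν₂} ‖f‖_{L^{p̄₂}_x L^{q̄₂}_T}; and (ii) ‖D_x^{α₁+α₂} ∫_0^t V(t−τ) f(τ) dτ‖_{L^{p₁}_x L^{q₁}_T} ≲ T^{ν₁+ν₂} ‖f‖_{L^{p̄₂}_x L^{q̄₂}_T}, provided min(p₁,q₁) > max(p̄₂,q̄₂), or q₁ =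 ∞ and p̄₂,q̄₂ < ∞. -/
open MeasureTheory Real Set Filter
open scoped FourierTransform ENNReal NNReal Topology

noncomputable section

/-- Fourier multiplier operator with symbol `m`. -/
def FMul (m : ℝ → ℂ) (f : ℝ → ℂ) : ℝ → ℂ :=
  𝓕⁻ fun ξ => m ξ * 𝓕 f ξ

/-- `D_x^α`, the Fourier multiplier with symbol `|ξ|^α`. -/
def Dop (α : ℝ) (f : ℝ → ℂ) : ℝ → ℂ :=
  FMul (fun ξ => ((|ξ| ^ α : ℝ) : ℂ)) f

/-- The free Benjamin–Ono group `V(t) = 𝓕⁻¹ e^{itξ|ξ|} 𝓕`. -/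
def BOGroup (t : ℝ) (f : ℝ → ℂ) : ℝ → ℂ :=
  FMul (fun ξ => Complex.exp (Complex.I * (t * ξ * |ξ|))) f

/-- The derivative `∂ₓ` as the Fourier multiplier with symbol `iξ`. -/
def Dx1 (f : ℝ → ℂ) : ℝ → ℂ :=
  FMul (fun ξ => Complex.I * ξ) f

/-- Projection on nonnegative frequencies. -/
def Pplus (f : ℝ → ℂ) : ℝ → ℂ :=
  FMul (fun ξ => if 0 ≤ ξ then 1 else 0) f

/-- Projection on nonpositive frequencies. -/
def Pminus (f : ℝ → ℂ) : ℝ → ℂ :=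
  FMul (fun ξ => if ξ ≤ 0 then 1 else 0) f

/-- The Sobolev `H^s` norm. -/
def HsNorm (s : ℝ) (f : ℝ → ℂ) : ℝ≥0∞ :=
  eLpNorm (fun ξ => (((1 + ξ ^ 2) ^ (s / 2) : ℝ) : ℂ) * 𝓕 f ξ) 2 volume

/-- The mixed space-time norm `L^p_x L^q_T`. -/
def LpLq (p q : ℝ≥0∞) (T : ℝ) (f : ℝ → ℝ → ℂ) : ℝ≥0∞ :=
  eLpNorm (fun x => (eLpNorm (fun t => f x t) q (volume.restrict (Ioc (0:ℝ) T))).toReal) p volume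

/-- The mixed space-time norm `L^q_T L^p_x`. -/
def LqLp (q p : ℝ≥0∞) (T : ℝ) (f : ℝ → ℝ → ℂ) : ℝ≥0∞ :=
  eLpNorm (fun t => (eLpNorm (fun x => f x t) p volume).toReal) q (volume.restrict (Ioc (0:ℝ) T))

/-- The norm `L^∞_T H^s_x`. -/
def LinfHs (s : ℝ) (T : ℝ) (f : ℝ → ℝ → ℂ) : ℝ≥0∞ :=
  eLpNorm (fun t => (HsNorm s (fun x => f x t)).toReal) ∞ (volume.restrict (Ioc (0:ℝ) T))

/-- Apply a spatial operator slice-wise in time. -/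
def sliceOp (A : (ℝ → ℂ) → (ℝ → ℂ)) (f : ℝ → ℝ → ℂ) : ℝ → ℝ → ℂ :=
  fun x t => A (fun y => f y t) x

/-- A smooth nonnegative bump `η` supported in `{1/2 ≤ |ξ| ≤ 2}` giving a dyadic
partition of unity `Σ_k η(2^{-k} ξ) = 1` for `ξ ≠ 0`. -/
structure IsLPBump (η : ℝ → ℝ) : Prop where
  smooth : ContDiff ℝ (⊤ : ℕ∞) η
  nonneg : ∀ ξ, 0 ≤ η ξ
  support : ∀ ξ, η ξ ≠ 0 → 1/2 ≤ |ξ| ∧ |ξ| ≤ 2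
  partition : ∀ ξ : ℝ, ξ ≠ 0 → ∑' k : ℤ, η ((2:ℝ) ^ (-k) * ξ) = 1

/-- The low-frequency symbol `p(ξ) = Σ_{j ≤ -3} η(2^{-j} ξ)`. -/
def lowSymbol (η : ℝ → ℝ) (ξ : ℝ) : ℝ :=
  ∑' j : ℤ, if j ≤ -3 then η ((2:ℝ) ^ (-j) * ξ) else 0

/-- The low-frequency projection `P₀`. -/
def P0 (η : ℝ → ℝ) (f : ℝ → ℂ) : ℝ → ℂ :=
  FMul (fun ξ => ((lowSymbol η ξ : ℝ) : ℂ)) f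

/-- The `X^s_T` norm. -/
def XNorm (η : ℝ → ℝ) (s T : ℝ) (u : ℝ → ℝ → ℂ) : ℝ≥0∞ :=
  LinfHs s T u + LpLq ∞ 2 T (sliceOp (Dop (s + 1/2)) u)
    + LpLq 4 ∞ T (sliceOp (Dop (s - 1/4)) u)
    + LpLq 2 ∞ T (sliceOp (P0 η) u)

/-- The Duhamel integral `∫₀ᵗ V(t-τ) f(τ) dτ`. -/
def duhamel (f : ℝ → ℝ → ℂ) : ℝ → ℝ → ℂ :=
  fun x t => ∫ τ in Ioc (0:ℝ) t, BOGroup (t - τ) (fun y => f y τ) x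

theorem two_term_holder {a b : ℝ} (ha : 0 ≤ a) (hb : 0 ≤ b) (hab : a + b = 1)
    (x₁ x₂ y₁ y₂ : ℝ≥0∞) :
    x₁ ^ a * y₁ ^ b + x₂ ^ a * y₂ ^ b ≤ (x₁ + x₂) ^ a * (y₁ + y₂) ^ b := by
  have := ENNReal.lintegral_mul_norm_pow_le (μ := (Measure.count : Measure Bool))
    (f := fun i => cond i x₁ x₂) (g := fun i => cond i y₁ y₂)
    (measurable_of_finite _).aemeasurable (measurable_of_finite _).aemeasurable ha hb hab
  simpa [lintegral_count, tsum_fintype] using this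

/-- Reverse Minkowski inequality for exponents at most one. -/
theorem eLpNorm_add_ge_of_le_one {X : Type*} [MeasurableSpace X] {μ : Measure X}
    {F G : X → ℝ≥0∞} (hF : Measurable F) (hG : Measurable G) {p : ℝ≥0∞} (hp0 : p ≠ 0)
    (hp1 : p ≤ 1) : eLpNorm F p μ + eLpNorm G p μ ≤ eLpNorm (fun x => F x + G x) p μ := by
  have hpt : p ≠ ∞ := (hp1.trans_lt ENNReal.one_lt_top).ne
  set θ := p.toReal with hθ
  have hθ0 : 0 < θ := ENNReal.toReal_pos hp0 hpt
  have hθ1 : θ ≤ 1 := by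
    rw [hθ]; exact ENNReal.toReal_le_of_le_ofReal zero_le_one (by simpa using hp1)
  simp only [eLpNorm_eq_lintegral_rpow_enorm_toReal hp0 hpt, enorm_eq_self, ← hθ]
  set P := (∫⁻ x, F x ^ θ ∂μ) ^ (1 / θ) with hP
  set Q := (∫⁻ x, G x ^ θ ∂μ) ^ (1 / θ) with hQ
  have hPθ : P ^ θ = ∫⁻ x, F x ^ θ ∂μ := by
    rw [hP, ← ENNReal.rpow_mul, one_div_mul_cancel hθ0.ne', ENNReal.rpow_one]
  have hQθ : Q ^ θ = ∫⁻ x, G x ^ θ ∂μ := by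
    rw [hQ, ← ENNReal.rpow_mul, one_div_mul_cancel hθ0.ne', ENNReal.rpow_one]
  have key : (P + Q) ^ θ ≤ ∫⁻ x, (F x + G x) ^ θ ∂μ := by
    have hPR : P ^ θ ≤ ∫⁻ x, (F x + G x) ^ θ ∂μ := by
      rw [hPθ]; gcongr; exact le_self_add
    have hQR : Q ^ θ ≤ ∫⁻ x, (F x + G x) ^ θ ∂μ := by
      rw [hQθ]; gcongr; exact le_add_self
    rcases eq_or_ne (P + Q) ∞ with h | h
    · rcases ENNReal.add_eq_top.1 h with h' | h'
      · rw [h'] at hPR; rwa [h]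
      · rw [h'] at hQR; rwa [h]
    rcases eq_or_ne (P + Q) 0 with h0 | h0
    · rw [h0, ENNReal.zero_rpow_of_pos hθ0]; exact zero_le
    have h1 : ∫⁻ x, (P ^ (1 - θ) * F x ^ θ + Q ^ (1 - θ) * G x ^ θ) ∂μ
        ≤ ∫⁻ x, (P + Q) ^ (1 - θ) * (F x + G x) ^ θ ∂μ :=
      lintegral_mono fun x => two_term_holder (by linarith) hθ0.le (by ring) _ _ _ _
    rw [lintegral_add_left (by fun_prop), lintegral_const_mul _ (by fun_prop),
      lintegral_const_mul _ (by fun_prop), lintegral_const_mul _ (by fun_prop), ← hPθ, ← hQθ] at h1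
    have h2 : ∀ z : ℝ≥0∞, z ^ (1 - θ) * z ^ θ = z := fun z => by
      rw [← ENNReal.rpow_add_of_nonneg _ _ (by linarith) hθ0.le]; simp
    rw [h2, h2] at h1
    nth_rw 1 [← h2 (P + Q)] at h1
    refine (ENNReal.mul_le_mul_iff_right ?_ ?_).1 h1
    · simp [ENNReal.rpow_eq_zero_iff, h0, h]
    · exact ENNReal.rpow_ne_top_of_nonneg (by linarith) h
  calc P + Q = ((P + Q) ^ θ) ^ (1 / θ) := by
        rw [← ENNReal.rpow_mul, mul_one_div_cancel hθ0.ne', ENNReal.rpow_one]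
    _ ≤ _ := ENNReal.rpow_le_rpow key (by positivity)

theorem eLpNorm_rpow_eq {X : Type*} [MeasurableSpace X] {μ : Measure X} (F : X → ℝ≥0∞)
    (p : ℝ≥0∞) {s : ℝ} (hs : 0 < s) :
    eLpNorm F p μ ^ s = eLpNorm (fun x => F x ^ s) (p / ENNReal.ofReal s) μ := by
  have := eLpNorm_enorm_rpow (μ := μ) (p := p / ENNReal.ofReal s) F hs
  rw [ENNReal.div_mul_cancel (by simpa using hs) (by simp)] at this
  simpa using this.symm

/-- The norm in `L^p_x(L^q(ν))` of a function with values in `[0, ∞]`. -/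
def mixedNorm (p q : ℝ≥0∞) (ν : Measure ℝ) (F : ℝ → ℝ → ℝ≥0∞) : ℝ≥0∞ :=
  eLpNorm (fun x => eLpNorm (F x) q ν) p volume

theorem measurable_eLpNorm_slice {ν : Measure ℝ} [SFinite ν] {F : ℝ → ℝ → ℝ≥0∞}
    (hF : Measurable (Function.uncurry F)) (q : ℝ≥0∞) :
    Measurable fun x => eLpNorm (F x) q ν := by
  rcases eq_or_ne q 0 with rfl | hq0
  · simp
  rcases eq_or_ne q ∞ with rfl | hq
  · refine measurable_of_Iic fun a => ?_
    have : (fun x => eLpNorm (F x) ∞ ν) ⁻¹' Iic a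
        = {x | ν (Prod.mk x ⁻¹' {z | a < Function.uncurry F z}) = 0} := by
      ext x
      simp only [eLpNorm_exponent_top, mem_preimage, mem_Iic, mem_ofPred_eq]
      constructor
      · intro h
        refine measure_mono_null (fun t ht => ?_) (enorm_ae_le_eLpNormEssSup (F x) ν)
        simp only [mem_preimage, mem_ofPred_eq, Function.uncurry] at ht
        simpa using h.trans_lt ht
      · intro h
        refine eLpNormEssSup_le_of_ae_enorm_bound ?_
        rw [ae_iff]; simpa [Function.uncurry] using h
    rw [this]
    exact measurable_measure_prodMk_left (measurableSet_lt measurable_const hF)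
      (measurableSet_singleton 0)
  · simp only [eLpNorm_eq_lintegral_rpow_enorm_toReal hq0 hq, enorm_eq_self]
    exact (Measurable.lintegral_prod_right' (f := fun z => Function.uncurry F z ^ q.toReal)
      (by fun_prop)).pow_const _

theorem mixedNorm_mono {p q : ℝ≥0∞} {ν : Measure ℝ} {F G : ℝ → ℝ → ℝ≥0∞}
    (h : ∀ x, ∀ᵐ t ∂ν, F x t ≤ G x t) : mixedNorm p q ν F ≤ mixedNorm p q ν G :=
  eLpNorm_mono_enorm fun x => by
    simpa using eLpNorm_mono_enorm_ae ((h x).mono fun t ht => by simpa using ht)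

theorem mixedNorm_add_le {p q : ℝ≥0∞} {ν : Measure ℝ} [SFinite ν] {F G : ℝ → ℝ → ℝ≥0∞}
    (hp : 1 ≤ p) (hq : 1 ≤ q)
    (hF : Measurable (Function.uncurry F)) (hG : Measurable (Function.uncurry G)) :
    mixedNorm p q ν (fun x t => F x t + G x t) ≤ mixedNorm p q ν F + mixedNorm p q ν G := by
  refine le_trans (eLpNorm_mono_enorm (g := fun x => eLpNorm (F x) q ν + eLpNorm (G x) q ν)
    fun x => ?_) (eLpNorm_add_le (measurable_eLpNorm_slice hF q).aestronglyMeasurable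
    (measurable_eLpNorm_slice hG q).aestronglyMeasurable hp)
  simp only [enorm_eq_self]
  exact eLpNorm_add_le (hF.of_uncurry_left (x := x)).aestronglyMeasurable
    (hG.of_uncurry_left (x := x)).aestronglyMeasurable hq

/-- Upper `s`-estimate for functions with disjoint time supports. -/
theorem mixedNorm_add_rpow_le {p q : ℝ≥0∞} {ν : Measure ℝ} [SFinite ν] {F G : ℝ → ℝ → ℝ≥0∞}
    {s : ℝ} (hs : 0 < s) (hp : ENNReal.ofReal s ≤ p) (hq : ENNReal.ofReal s ≤ q)
    (hF : Measurable (Function.uncurry F)) (hG : Measurable (Function.uncurry G))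
    (hFG : ∀ x t, F x t = 0 ∨ G x t = 0) :
    mixedNorm p q ν (fun x t => F x t + G x t) ^ s
      ≤ mixedNorm p q ν F ^ s + mixedNorm p q ν G ^ s := by
  have hs' : ENNReal.ofReal s ≠ 0 := by simpa using hs
  have hdiv : ∀ r : ℝ≥0∞, ENNReal.ofReal s ≤ r → 1 ≤ r / ENNReal.ofReal s := fun r hr => by
    rw [ENNReal.le_div_iff_mul_le (Or.inl hs') (Or.inl (by simp))]; simpa using hr
  have inner : ∀ x, eLpNorm (fun t => F x t + G x t) q ν ^ s
      ≤ eLpNorm (F x) q ν ^ s + eLpNorm (G x) q ν ^ s := fun x => by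
    rw [eLpNorm_rpow_eq _ _ hs, eLpNorm_rpow_eq _ _ hs, eLpNorm_rpow_eq _ _ hs]
    have : (fun t => (F x t + G x t) ^ s) = (fun t => F x t ^ s) + fun t => G x t ^ s := by
      funext t
      rcases hFG x t with h | h <;> simp [h, ENNReal.zero_rpow_of_pos hs]
    rw [this]
    exact eLpNorm_add_le ((hF.of_uncurry_left (x := x)).pow_const s).aestronglyMeasurable
      ((hG.of_uncurry_left (x := x)).pow_const s).aestronglyMeasurable (hdiv q hq)
  unfold mixedNorm
  rw [eLpNorm_rpow_eq _ _ hs, eLpNorm_rpow_eq _ _ hs, eLpNorm_rpow_eq _ _ hs]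
  refine le_trans (eLpNorm_mono_enorm (g := (fun x => eLpNorm (F x) q ν ^ s)
    + fun x => eLpNorm (G x) q ν ^ s) fun x => by simpa using inner x) ?_
  exact eLpNorm_add_le ((measurable_eLpNorm_slice hF q).pow_const s).aestronglyMeasurable
    ((measurable_eLpNorm_slice hG q).pow_const s).aestronglyMeasurable (hdiv p hp)

/-- Lower `m`-estimate for functions with disjoint time supports. -/
theorem mixedNorm_add_rpow_ge {p q : ℝ≥0∞} {ν : Measure ℝ} [SFinite ν] {F G : ℝ → ℝ → ℝ≥0∞}
    {m : ℝ} (hm : 0 < m) (hp0 : p ≠ 0) (hq0 : q ≠ 0) (hp : p ≤ ENNReal.ofReal m)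
    (hq : q ≤ ENNReal.ofReal m)
    (hF : Measurable (Function.uncurry F)) (hG : Measurable (Function.uncurry G))
    (hFG : ∀ x t, F x t = 0 ∨ G x t = 0) :
    mixedNorm p q ν F ^ m + mixedNorm p q ν G ^ m
      ≤ mixedNorm p q ν (fun x t => F x t + G x t) ^ m := by
  have hm' : ENNReal.ofReal m ≠ 0 := by simpa using hm
  have hdiv : ∀ r : ℝ≥0∞, r ≤ ENNReal.ofReal m → r / ENNReal.ofReal m ≤ 1 := fun r hr => by
    refine ENNReal.div_le_of_le_mul ?_; simpa using hr
  have hdiv0 : ∀ r : ℝ≥0∞, r ≠ 0 → r / ENNReal.ofReal m ≠ 0 := fun r hr => by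
    simp [ENNReal.div_eq_zero_iff, hr]
  have inner : ∀ x, eLpNorm (F x) q ν ^ m + eLpNorm (G x) q ν ^ m
      ≤ eLpNorm (fun t => F x t + G x t) q ν ^ m := fun x => by
    rw [eLpNorm_rpow_eq _ _ hm, eLpNorm_rpow_eq _ _ hm, eLpNorm_rpow_eq _ _ hm]
    have : (fun t => (F x t + G x t) ^ m) = (fun t => F x t ^ m + G x t ^ m) := by
      funext t
      rcases hFG x t with h | h <;> simp [h, ENNReal.zero_rpow_of_pos hm]
    rw [this]
    exact eLpNorm_add_ge_of_le_one ((hF.of_uncurry_left (x := x)).pow_const m)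
      ((hG.of_uncurry_left (x := x)).pow_const m) (hdiv0 q hq0) (hdiv q hq)
  unfold mixedNorm
  rw [eLpNorm_rpow_eq _ _ hm, eLpNorm_rpow_eq _ _ hm, eLpNorm_rpow_eq _ _ hm]
  refine le_trans (eLpNorm_add_ge_of_le_one ((measurable_eLpNorm_slice hF q).pow_const m)
    ((measurable_eLpNorm_slice hG q).pow_const m) (hdiv0 p hp0) (hdiv p hp)) ?_
  exact eLpNorm_mono_enorm fun x => by simpa using inner x

theorem eLpNorm_liminf_le {X : Type*} [MeasurableSpace X] {μ : Measure X}
    {F : ℕ → X → ℝ≥0∞} (hF : ∀ n, Measurable (F n)) (p : ℝ≥0∞) :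
    eLpNorm (fun x => liminf (fun n => F n x) atTop) p μ
      ≤ liminf (fun n => eLpNorm (F n) p μ) atTop := by
  rcases eq_or_ne p 0 with rfl | hp0
  · simp
  rcases eq_or_ne p ∞ with rfl | hp
  · simp only [eLpNorm_exponent_top, eLpNormEssSup_eq_essSup_enorm, enorm_eq_self]
    exact ENNReal.essSup_liminf_le _
  have hpos : 0 < p.toReal := ENNReal.toReal_pos hp0 hp
  simp only [eLpNorm_eq_lintegral_rpow_enorm_toReal hp0 hp, enorm_eq_self]
  have hcomm : ∀ (r : ℝ) (_ : 0 < r) (u : ℕ → ℝ≥0∞),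
      liminf u atTop ^ r = liminf (fun n => u n ^ r) atTop := fun r hr u =>
    ((ENNReal.orderIsoRpow r hr).liminf_apply (by isBoundedDefault) (by isBoundedDefault)
      (by isBoundedDefault) (by isBoundedDefault))
  rw [← hcomm _ (by positivity)]
  refine ENNReal.rpow_le_rpow ?_ (by positivity)
  simp only [hcomm _ hpos]
  exact lintegral_liminf_le fun n => (hF n).pow_const _

theorem mixedNorm_liminf_le {p q : ℝ≥0∞} {ν : Measure ℝ} [SFinite ν] {F : ℕ → ℝ → ℝ → ℝ≥0∞}
    (hF : ∀ n, Measurable (Function.uncurry (F n))) :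
    mixedNorm p q ν (fun x t => liminf (fun n => F n x t) atTop)
      ≤ liminf (fun n => mixedNorm p q ν (F n)) atTop := by
  refine le_trans ?_ (eLpNorm_liminf_le (fun n => measurable_eLpNorm_slice (hF n) q) p)
  exact eLpNorm_mono_enorm fun x => by
    simpa using eLpNorm_liminf_le (fun n => (hF n).of_uncurry_left (x := x)) q

/-- Fatou's lemma for mixed norms. -/
theorem mixedNorm_le_of_le_liminf {p q : ℝ≥0∞} {ν : Measure ℝ} [SFinite ν]
    {F : ℕ → ℝ → ℝ → ℝ≥0∞} {G : ℝ → ℝ → ℝ≥0∞} {c : ℕ → ℝ≥0∞} {C : ℝ≥0∞}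
    (hF : ∀ n, Measurable (Function.uncurry (F n)))
    (hG : ∀ x, ∀ᵐ t ∂ν, G x t ≤ liminf (fun n => F n x t) atTop)
    (hc : ∀ n, mixedNorm p q ν (F n) ≤ c n) (hC : Tendsto c atTop (𝓝 C)) :
    mixedNorm p q ν G ≤ C :=
  ((mixedNorm_mono hG).trans (mixedNorm_liminf_le hF)).trans
    ((liminf_le_liminf (Eventually.of_forall hc)).trans_eq hC.liminf_eq)

theorem lintegral_mul_le_eLpNorm {X : Type*} [MeasurableSpace X] {μ : Measure X}
    {F G : X → ℝ≥0∞} (hF : Measurable F) (hG : Measurable G) {p q : ℝ≥0∞}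
    (hpq : 1 / p = 1 - 1 / q) (hq : 1 ≤ q) :
    ∫⁻ x, F x * G x ∂μ ≤ eLpNorm F p μ * eLpNorm G q μ := by
  have top_case : ∀ {F G : X → ℝ≥0∞}, Measurable G →
      ∫⁻ x, F x * G x ∂μ ≤ eLpNorm F ∞ μ * eLpNorm G 1 μ := fun {F G} hG => by
    rw [eLpNorm_one_eq_lintegral_enorm, eLpNorm_exponent_top, ← lintegral_const_mul _ (by simpa)]
    refine lintegral_mono_ae ?_
    filter_upwards [enorm_ae_le_eLpNormEssSup F μ] with x hx
    simp only [enorm_eq_self] at hx ⊢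
    gcongr
  rcases eq_or_ne q 1 with rfl | hq1
  · obtain rfl : p = ∞ := by simpa using hpq
    exact top_case hG
  rcases eq_or_ne q ∞ with rfl | hqt
  · obtain rfl : p = 1 := by simpa using hpq
    rw [mul_comm]; simp_rw [mul_comm (F _)]; exact top_case hF
  have hq1' : 1 < q := lt_of_le_of_ne hq hq1.symm
  have hqr : 1 < q.toReal := by
    rw [← ENNReal.toReal_one]; exact (ENNReal.toReal_lt_toReal (by simp) hqt).2 hq1'
  have hinv : p.toReal⁻¹ = 1 - q.toReal⁻¹ := by
    have := congrArg ENNReal.toReal hpq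
    rwa [ENNReal.toReal_sub_of_le (by simpa using hq) (by simp), ENNReal.toReal_div,
      ENNReal.toReal_div, ENNReal.toReal_one, one_div, one_div] at this
  have hlt : q.toReal⁻¹ < 1 := inv_lt_one_of_one_lt₀ hqr
  have hpr : 0 < p.toReal := inv_pos.1 (by rw [hinv]; linarith)
  have hp := ENNReal.toReal_pos_iff.1 hpr
  have hconj : p.toReal.HolderConjugate q.toReal :=
    ⟨by rw [hinv]; simp, hpr, by linarith⟩
  have := ENNReal.lintegral_mul_le_Lp_mul_Lq μ hconj hF.aemeasurable hG.aemeasurable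
  rw [eLpNorm_eq_lintegral_rpow_enorm_toReal hp.1.ne' hp.2.ne,
    eLpNorm_eq_lintegral_rpow_enorm_toReal (by positivity) hqt]
  simpa using this

/-- Hölder's inequality for mixed norms. -/
theorem lintegral_mul_le_mixedNorm {ν : Measure ℝ} [SFinite ν] {F G : ℝ → ℝ → ℝ≥0∞}
    (hF : Measurable (Function.uncurry F)) (hG : Measurable (Function.uncurry G))
    {p q p' q' : ℝ≥0∞} (hp : 1 / p' = 1 - 1 / p) (hp1 : 1 ≤ p) (hq : 1 / q' = 1 - 1 / q)
    (hq1 : 1 ≤ q) :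
    ∫⁻ x, ∫⁻ t, F x t * G x t ∂ν ≤ mixedNorm p' q' ν F * mixedNorm p q ν G :=
  (lintegral_mono fun _ => lintegral_mul_le_eLpNorm hF.of_uncurry_left hG.of_uncurry_left hq
    hq1).trans (lintegral_mul_le_eLpNorm (measurable_eLpNorm_slice hF _)
      (measurable_eLpNorm_slice hG _) hp hp1)

/-- The oscillatory factor `e^{i(2πxξ + tξ|ξ|)}` of a linear Benjamin–Ono wave. -/
def wave (x t ξ : ℝ) : ℂ := Complex.exp (((2 * π * x * ξ + t * ξ * |ξ| : ℝ) : ℂ) * Complex.I)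

@[simp] theorem norm_wave (x t ξ : ℝ) : ‖wave x t ξ‖ = 1 := Complex.norm_exp_ofReal_mul_I _

@[simp] theorem enorm_wave (x t ξ : ℝ) : ‖wave x t ξ‖ₑ = 1 := by
  rw [← ofReal_norm, norm_wave, ENNReal.ofReal_one]

@[fun_prop] theorem continuous_wave : Continuous fun z : ℝ × ℝ × ℝ => wave z.1 z.2.1 z.2.2 := by
  unfold wave; fun_prop

theorem Continuous.wave {X : Type*} [TopologicalSpace X] {a b c : X → ℝ} (ha : Continuous a)
    (hb : Continuous b) (hc : Continuous c) : Continuous fun z => wave (a z) (b z) (c z) :=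
  continuous_wave.comp (ha.prodMk (hb.prodMk hc))

theorem wave_mul (x t y s ξ : ℝ) : wave x t ξ * wave y s ξ = wave (x + y) (t + s) ξ := by
  simp only [wave, ← Complex.exp_add]
  congr 1
  push_cast
  ring

@[simp] theorem wave_zero_zero (ξ : ℝ) : wave 0 0 ξ = 1 := by simp [wave]

theorem conj_wave (x t ξ : ℝ) : (starRingEnd ℂ) (wave x t ξ) = wave (-x) (-t) ξ := by
  simp only [wave, ← Complex.exp_conj]
  congr 1
  simp only [map_mul, Complex.conj_ofReal, Complex.conj_I]
  push_cast
  ring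

/-- The function `|ξ|^α h(ξ)`. -/
def powMul (α : ℝ) (h : ℝ → ℂ) (ξ : ℝ) : ℂ := ((|ξ| ^ α : ℝ) : ℂ) * h ξ

/-- `D_x^α V(t)` applied to the function with Fourier transform `h`. -/
def evol (α : ℝ) (h : ℝ → ℂ) (x t : ℝ) : ℂ := ∫ ξ, wave x t ξ * powMul α h ξ

theorem fourierInv_eq_integral_wave (g : ℝ → ℂ) (x : ℝ) : 𝓕⁻ g x = ∫ ξ, wave x 0 ξ * g ξ := by
  rw [Real.fourierInv_eq']
  refine integral_congr_ae (Eventually.of_forall fun ξ => ?_)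
  simp only [wave, smul_eq_mul, real_inner_comm]
  simp [mul_comm, mul_assoc, mul_left_comm]

theorem fourier_eq_integral_wave (g : ℝ → ℂ) (ξ : ℝ) :
    𝓕 g ξ = ∫ x, wave (-x) 0 ξ * g x := by
  rw [Real.fourier_eq']
  refine integral_congr_ae (Eventually.of_forall fun x => ?_)
  simp only [wave, smul_eq_mul]
  simp [mul_comm, mul_assoc, mul_left_comm]

theorem boSymbol_eq_wave (t ξ : ℝ) :
    Complex.exp (Complex.I * (t * ξ * |ξ|)) = wave 0 t ξ := by
  simp [wave, mul_comm]

theorem evol_eq_fourierInv (α : ℝ) (h : ℝ → ℂ) (x t : ℝ) :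
    evol α h x t = 𝓕⁻ (fun ξ => powMul α (fun ξ => wave 0 t ξ * h ξ) ξ) x := by
  rw [fourierInv_eq_integral_wave, evol]
  refine integral_congr_ae (Eventually.of_forall fun ξ => ?_)
  have : wave x t ξ = wave x 0 ξ * wave 0 t ξ := by rw [wave_mul]; simp
  simp only [powMul, this]
  ring

theorem evol_translate (α : ℝ) (h : ℝ → ℂ) (s x t : ℝ) :
    evol α (fun ξ => wave 0 s ξ * h ξ) x t = evol α h x (t + s) := by
  refine integral_congr_ae (Eventually.of_forall fun ξ => ?_)
  have : wave x (t + s) ξ = wave x t ξ * wave 0 s ξ := by rw [wave_mul]; simp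
  simp only [powMul, this]
  ring

/-- The frequencies between `ε` and `1/ε`. -/
def band (ε : ℝ) : Set ℝ := {ξ | ε ≤ |ξ| ∧ |ξ| ≤ ε⁻¹}

theorem isClosed_band (ε : ℝ) : _root_.IsClosed (band ε) :=
  (isClosed_le continuous_const continuous_abs).inter
    (isClosed_le continuous_abs continuous_const)

theorem measurableSet_band (ε : ℝ) : MeasurableSet (band ε) := (isClosed_band ε).measurableSet

theorem band_subset_Icc (ε : ℝ) : band ε ⊆ Icc (-ε⁻¹) ε⁻¹ := fun _ h => abs_le.1 h.2

theorem isCompact_band (ε : ℝ) : IsCompact (band ε) :=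
  isCompact_Icc.of_isClosed_subset (isClosed_band ε) (band_subset_Icc ε)

theorem volume_band_lt_top (ε : ℝ) : volume (band ε) < ∞ := (isCompact_band ε).measure_lt_top

theorem continuousOn_abs_rpow (α : ℝ) {ε : ℝ} (hε : 0 < ε) :
    ContinuousOn (fun ξ : ℝ => |ξ| ^ α) (band ε) :=
  continuous_abs.continuousOn.rpow_const fun _ hξ => Or.inl (hε.trans_le hξ.1).ne'

theorem exists_rpow_le_on_band (α : ℝ) {ε : ℝ} (hε : 0 < ε) :
    ∃ A : ℝ≥0, ∀ ξ ∈ band ε, |ξ| ^ α ≤ A := by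
  obtain ⟨A, hA⟩ := (isCompact_band ε).exists_bound_of_continuousOn (continuousOn_abs_rpow α hε)
  exact ⟨A.toNNReal, fun ξ hξ => ((le_abs_self _).trans (hA ξ hξ)).trans (Real.le_coe_toNNReal A)⟩

theorem powMul_of_notMem {α : ℝ} {h : ℝ → ℂ} {S : Set ℝ} (hS : ∀ ξ ∉ S, h ξ = 0) {ξ : ℝ}
    (hξ : ξ ∉ S) : powMul α h ξ = 0 := by simp [powMul, hS ξ hξ]

/-- On a frequency band the weight `|ξ|^α` is harmless in `L¹`, with control by the `L²` norm. -/
theorem exists_lintegral_powMul_le (α : ℝ) {ε : ℝ} (hε : 0 < ε) :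
    ∃ A : ℝ≥0, ∀ h : ℝ → ℂ, Measurable h → (∀ ξ ∉ band ε, h ξ = 0) →
      ∫⁻ ξ, ‖powMul α h ξ‖ₑ ≤ A * eLpNorm h 2 volume := by
  obtain ⟨A, hA⟩ := exists_rpow_le_on_band α hε
  have hfin : eLpNorm ((band ε).indicator fun _ => (1 : ℝ≥0∞)) 2 volume ≠ ∞ := by
    rw [eLpNorm_indicator_const (measurableSet_band ε) (by simp) (by simp)]
    exact ENNReal.mul_ne_top (by simp) (ENNReal.rpow_ne_top_of_nonneg (by simp)
      (volume_band_lt_top ε).ne)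
  refine ⟨A * (eLpNorm ((band ε).indicator fun _ => (1 : ℝ≥0∞)) 2 volume).toNNReal,
    fun h hm h0 => ?_⟩
  rw [ENNReal.coe_mul, ENNReal.coe_toNNReal hfin, mul_assoc]
  have key := lintegral_mul_le_eLpNorm (μ := volume) (p := 2) (q := 2)
    (measurable_const.indicator (measurableSet_band ε) : Measurable
      ((band ε).indicator fun _ => (1 : ℝ≥0∞))) hm.enorm (by simp) (by simp)
  rw [eLpNorm_enorm] at key
  refine le_trans ?_ (mul_le_mul_right key _)
  rw [← lintegral_const_mul _ (by
    exact (measurable_const.indicator (measurableSet_band ε)).mul hm.enorm)]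
  refine lintegral_mono fun ξ => ?_
  by_cases hξ : ξ ∈ band ε
  · simp only [powMul, enorm_mul, indicator_of_mem hξ, one_mul]
    gcongr
    rw [← ofReal_norm, ENNReal.ofReal_le_iff_le_toReal (by simp)]
    simpa [abs_of_nonneg (Real.rpow_nonneg (abs_nonneg ξ) α)] using hA ξ hξ
  · simp [powMul_of_notMem h0 hξ]

theorem Measurable.powMul {h : ℝ → ℂ} (hm : Measurable h) (α : ℝ) : Measurable (powMul α h) := by
  unfold _root_.powMul; fun_prop

theorem enorm_evol_le (α : ℝ) (h : ℝ → ℂ) (x t : ℝ) :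
    ‖evol α h x t‖ₑ ≤ ∫⁻ ξ, ‖powMul α h ξ‖ₑ := by
  refine (enorm_integral_le_lintegral_enorm _).trans (lintegral_mono fun ξ => ?_)
  simp [enorm_mul]

theorem integrable_powMul (α : ℝ) {ε : ℝ} (hε : 0 < ε) {h : ℝ → ℂ} (hm : Measurable h)
    (h2 : MemLp h 2 volume) (h0 : ∀ ξ ∉ band ε, h ξ = 0) : Integrable (powMul α h) := by
  obtain ⟨A, hA⟩ := exists_lintegral_powMul_le α hε
  exact ⟨(hm.powMul α).aestronglyMeasurable,
    (hA h hm h0).trans_lt (ENNReal.mul_lt_top (by simp) h2.2)⟩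

theorem integrable_wave_mul {g : ℝ → ℂ} (hg : Integrable g) (x t : ℝ) :
    Integrable fun ξ => wave x t ξ * g ξ :=
  hg.bdd_mul (c := 1) ((continuous_const.wave continuous_const
    continuous_id).aestronglyMeasurable) (by simp)

theorem continuous_evol {α : ℝ} {h : ℝ → ℂ} (hi : Integrable (powMul α h)) :
    Continuous fun z : ℝ × ℝ => evol α h z.1 z.2 := by
  refine continuous_of_dominated (bound := fun ξ => ‖powMul α h ξ‖)
    (fun z => (integrable_wave_mul hi _ _).1) (fun z => Eventually.of_forall fun ξ => by simp)
    hi.norm (Eventually.of_forall fun ξ => ?_)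
  exact (continuous_fst.wave continuous_snd continuous_const).mul continuous_const

theorem evol_sub {α : ℝ} {h k : ℝ → ℂ} (hh : Integrable (powMul α h))
    (hk : Integrable (powMul α k)) (x t : ℝ) :
    evol α (fun ξ => h ξ - k ξ) x t = evol α h x t - evol α k x t := by
  rw [evol, evol, evol, ← integral_sub (integrable_wave_mul hh x t) (integrable_wave_mul hk x t)]
  refine integral_congr_ae (Eventually.of_forall fun ξ => ?_)
  simp only [powMul]
  ring

theorem exists_smooth_cutoff {ε : ℝ} (hε : 0 < ε) :
    ∃ χ : ℝ → ℝ, ContDiff ℝ (⊤ : ℕ∞) χ ∧ (∀ ξ, 0 ≤ χ ξ ∧ χ ξ ≤ 1) ∧ (∀ ξ ∈ band ε, χ ξ = 1) ∧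
      ∀ ξ ∉ band (ε / 2), χ ξ = 0 := by
  have hcl : _root_.IsClosed {ξ : ℝ | |ξ| ≤ ε / 2 ∨ (ε / 2)⁻¹ ≤ |ξ|} :=
    (isClosed_le continuous_abs continuous_const).union
      (isClosed_le continuous_const continuous_abs)
  have hd : Disjoint {ξ : ℝ | |ξ| ≤ ε / 2 ∨ (ε / 2)⁻¹ ≤ |ξ|} (band ε) := by
    rw [Set.disjoint_left]
    rintro ξ (h | h) ⟨h1, h2⟩
    · linarith
    · have := inv_strictAnti₀ (half_pos hε) (half_lt_self hε)
      linarith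
  obtain ⟨f, hf0, hf1, hf⟩ := exists_contMDiffMap_zero_one_of_isClosed (n := ⊤)
    (modelWithCornersSelf ℝ ℝ) hcl (isClosed_band ε) hd
  refine ⟨f, f.contMDiff.contDiff, fun ξ => hf ξ, fun ξ hξ => hf1 hξ, fun ξ hξ => hf0 ?_⟩
  by_contra hcon
  simp only [mem_ofPred_eq, not_or, not_le] at hcon
  exact hξ ⟨hcon.1.le, hcon.2.le⟩

theorem band_subset_half {ε : ℝ} (hε : 0 < ε) : band ε ⊆ band (ε / 2) := fun _ hξ =>
  ⟨(half_le_self hε.le).trans hξ.1,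
    hξ.2.trans (inv_anti₀ (half_pos hε) (half_le_self hε.le))⟩

theorem hasCompactSupport_of_band {ε : ℝ} {h : ℝ → ℂ} (h0 : ∀ ξ ∉ band ε, h ξ = 0) :
    HasCompactSupport h := HasCompactSupport.intro (isCompact_band ε) h0

/-- Smooth functions localized in frequency are dense among `L²` functions on a band. -/
theorem exists_smooth_approx {ε : ℝ} (hε : 0 < ε) {h : ℝ → ℂ}
    (h2 : MemLp h 2 volume) (h0 : ∀ ξ ∉ band ε, h ξ = 0) {η : ℝ} (hη : 0 < η) :
    ∃ ψ : ℝ → ℂ, ContDiff ℝ (⊤ : ℕ∞) ψ ∧ (∀ ξ ∉ band (ε / 2), ψ ξ = 0) ∧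
      eLpNorm (fun ξ => h ξ - ψ ξ) 2 volume ≤ ENNReal.ofReal η := by
  obtain ⟨χ, hχ, hχ01, hχ1, hχ0⟩ := exists_smooth_cutoff hε
  obtain ⟨g, -, hg, hgn⟩ := h2.exist_eLpNorm_sub_le (by simp) (by simp) hη
  refine ⟨fun ξ => (χ ξ : ℂ) * g ξ, (Complex.ofRealCLM.contDiff.comp hχ).mul hg,
    fun ξ hξ => by simp [hχ0 ξ hξ], le_trans (eLpNorm_mono fun ξ => ?_) hgn⟩
  have : h ξ - χ ξ * g ξ = χ ξ * (h ξ - g ξ) := by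
    by_cases hξ : ξ ∈ band ε
    · simp [hχ1 ξ hξ]
    · simp [h0 ξ hξ]
  rw [this, norm_mul, Complex.norm_real, Real.norm_of_nonneg (hχ01 ξ).1]
  exact mul_le_of_le_one_left (norm_nonneg _) (hχ01 ξ).2

theorem contDiff_wave_mul {δ : ℝ} (hδ : 0 < δ) {ψ : ℝ → ℂ} (hψ : ContDiff ℝ (⊤ : ℕ∞) ψ)
    (h0 : ∀ ξ ∉ band δ, ψ ξ = 0) (t : ℝ) :
    ContDiff ℝ (⊤ : ℕ∞) fun ξ => wave 0 t ξ * ψ ξ := by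
  rw [contDiff_iff_contDiffAt]
  intro ξ
  rcases eq_or_ne ξ 0 with rfl | hξ
  · have : (fun ξ => wave 0 t ξ * ψ ξ) =ᶠ[𝓝 0] fun _ => 0 := by
      filter_upwards [Metric.ball_mem_nhds (0 : ℝ) hδ] with ξ hξ
      rw [h0 ξ (fun hb => absurd hb.1 (by simpa using hξ)), mul_zero]
    exact contDiffAt_const.congr_of_eventuallyEq this
  · refine ContDiffAt.mul ?_ hψ.contDiffAt
    unfold wave
    refine ContDiffAt.cexp (ContDiffAt.mul ?_ contDiffAt_const)
    refine Complex.ofRealCLM.contDiff.contDiffAt.comp ξ ?_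
    exact (contDiffAt_const.mul contDiffAt_id).add
      ((contDiffAt_const.mul contDiffAt_id).mul (contDiffAt_abs hξ))

/-- A smooth frequency-localized function is the Fourier transform of Schwartz initial data. -/
theorem exists_schwartz_data {δ : ℝ} (hδ : 0 < δ) {ψ : ℝ → ℂ} (hψ : ContDiff ℝ (⊤ : ℕ∞) ψ)
    (h0 : ∀ ξ ∉ band δ, ψ ξ = 0) :
    ∃ φ : SchwartzMap ℝ ℂ, (∀ α x t, Dop α (BOGroup t ⇑φ) x = evol α ψ x t) ∧
      eLpNorm ⇑φ 2 volume = eLpNorm ψ 2 volume ∧ ⇑φ = 𝓕⁻ ψ := by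
  have key : ∀ g : SchwartzMap ℝ ℂ, 𝓕 (𝓕⁻ (g : ℝ → ℂ)) = g := fun g => by
    rw [← SchwartzMap.fourierInv_coe, ← SchwartzMap.fourier_coe, FourierTransform.fourier_fourierInv_eq]
  set Ψ : SchwartzMap ℝ ℂ := (hasCompactSupport_of_band h0).toSchwartzMap hψ with hΨ
  have hΨψ : (Ψ : ℝ → ℂ) = ψ := rfl
  have hφ : ((𝓕⁻ Ψ : SchwartzMap ℝ ℂ) : ℝ → ℂ) = 𝓕⁻ ψ := by rw [SchwartzMap.fourierInv_coe, hΨψ]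
  refine ⟨𝓕⁻ Ψ, fun α x t => ?_, ?_, hφ⟩
  · have hsup : ∀ ξ ∉ band δ, wave 0 t ξ * ψ ξ = 0 := fun ξ hξ => by simp [h0 ξ hξ]
    have h1 := key ((hasCompactSupport_of_band hsup).toSchwartzMap (contDiff_wave_mul hδ hψ h0 t))
    have h2 := key Ψ
    change 𝓕 (𝓕⁻ (fun ξ => wave 0 t ξ * ψ ξ)) = fun ξ => wave 0 t ξ * ψ ξ at h1
    rw [hΨψ] at h2
    rw [evol_eq_fourierInv, hφ]
    unfold Dop FMul
    refine congrArg (fun g : ℝ → ℂ => 𝓕⁻ g x) (funext fun ξ => ?_)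
    unfold powMul BOGroup FMul
    simp only [h2, boSymbol_eq_wave, h1]
  · have h := SchwartzMap.norm_fourier_toL2_eq (𝓕⁻ Ψ)
    rw [FourierTransform.fourier_fourierInv_eq] at h
    simp only [SchwartzMap.norm_toLp] at h
    rw [ENNReal.toReal_eq_toReal_iff' (Ψ.memLp 2 _).2.ne ((𝓕⁻ Ψ).memLp 2 _).2.ne] at h
    rw [← h, hΨψ]

theorem memLp_of_smooth_band {δ : ℝ} {ψ : ℝ → ℂ} (hψ : Continuous ψ)
    (h0 : ∀ ξ ∉ band δ, ψ ξ = 0) (p : ℝ≥0∞) : MemLp ψ p volume :=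
  hψ.memLp_of_hasCompactSupport (hasCompactSupport_of_band h0)

/-- Estimates for Schwartz data extend to all frequency-localized `L²` data. -/
theorem mixedNorm_evol_le_of_smooth {α : ℝ} {p q : ℝ≥0∞} {ν : Measure ℝ} [SFinite ν] {B : ℝ≥0}
    (H : ∀ δ > 0, ∀ ψ : ℝ → ℂ, ContDiff ℝ (⊤ : ℕ∞) ψ → (∀ ξ ∉ band δ, ψ ξ = 0) →
      mixedNorm p q ν (fun x t => ‖evol α ψ x t‖ₑ) ≤ B * eLpNorm ψ 2 volume)
    {ε : ℝ} (hε : 0 < ε) {h : ℝ → ℂ} (hm : Measurable h)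
    (h2 : MemLp h 2 volume) (h0 : ∀ ξ ∉ band ε, h ξ = 0) :
    mixedNorm p q ν (fun x t => ‖evol α h x t‖ₑ) ≤ B * eLpNorm h 2 volume := by
  have hε2 := half_pos hε
  choose ψ hψ hψ0 hψn using fun n : ℕ =>
    exists_smooth_approx hε h2 h0 (η := 1 / ((n : ℝ) + 1)) (by positivity)
  have h0' : ∀ ξ ∉ band (ε / 2), h ξ = 0 := fun ξ hξ => h0 ξ fun hb => hξ (band_subset_half hε hb)
  have hψ2 : ∀ n, MemLp (ψ n) 2 volume := fun n =>
    memLp_of_smooth_band (hψ n).continuous (hψ0 n) 2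
  have hi := integrable_powMul α hε2 hm h2 h0'
  have hiψ := fun n => integrable_powMul α hε2 (hψ n).continuous.measurable (hψ2 n) (hψ0 n)
  have hlim : Tendsto (fun n : ℕ => ENNReal.ofReal (1 / ((n : ℝ) + 1))) atTop (𝓝 0) := by
    have := ENNReal.tendsto_ofReal (tendsto_one_div_add_atTop_nhds_zero_nat (𝕜 := ℝ))
    rwa [ENNReal.ofReal_zero] at this
  obtain ⟨A, hA⟩ := exists_lintegral_powMul_le α hε2
  have hpt : ∀ x t, Tendsto (fun n => evol α (ψ n) x t) atTop (𝓝 (evol α h x t)) := by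
    intro x t
    rw [tendsto_iff_edist_tendsto_0]
    have hlim' : Tendsto (fun n : ℕ => (A : ℝ≥0∞) * ENNReal.ofReal (1 / ((n : ℝ) + 1))) atTop
        (𝓝 0) := by simpa using ENNReal.Tendsto.const_mul hlim (Or.inr (by simp))
    refine tendsto_of_tendsto_of_tendsto_of_le_of_le tendsto_const_nhds hlim' (fun _ => zero_le)
      fun n => ?_
    simp only
    rw [edist_comm, edist_eq_enorm_sub, ← evol_sub hi (hiψ n)]
    refine (enorm_evol_le _ _ _ _).trans ((hA _ (hm.sub (hψ n).continuous.measurable)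
      fun ξ hξ => by simp [h0' ξ hξ, hψ0 n ξ hξ]).trans ?_)
    gcongr
    exact hψn n
  refine mixedNorm_le_of_le_liminf (F := fun n x t => ‖evol α (ψ n) x t‖ₑ)
    (c := fun n => B * (eLpNorm h 2 volume + ENNReal.ofReal (1 / ((n : ℝ) + 1))))
    (fun n => (continuous_evol (hiψ n)).enorm.measurable)
    (fun x => Eventually.of_forall fun t => ((hpt x t).enorm.liminf_eq).ge) (fun n => ?_) ?_
  · refine (H _ hε2 _ (hψ n) (hψ0 n)).trans (mul_le_mul_right ?_ _)
    have : ψ n = h - fun ξ => h ξ - ψ n ξ := by ext; simp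
    rw [this]
    exact (eLpNorm_sub_le h2.1 (h2.1.sub (hψ2 n).1) (by simp)).trans
      (add_le_add le_rfl (hψn n))
  · have := ENNReal.Tendsto.const_mul (a := (B : ℝ≥0∞)) ((tendsto_const_nhds (x := eLpNorm h 2 volume)).add hlim) (Or.inr (by simp))
    simpa using this

/-- The truncation of a homogeneous estimate to Schwartz data controls all localized data. -/
theorem mixedNorm_evol_le {α : ℝ} {p q : ℝ≥0∞} {T : ℝ} {B : ℝ≥0}
    (H : ∀ φ : SchwartzMap ℝ ℂ,
      LpLq p q T (fun x t => Dop α (BOGroup t ⇑φ) x) ≤ B * eLpNorm ⇑φ 2 volume)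
    {ε : ℝ} (hε : 0 < ε) {h : ℝ → ℂ} (hm : Measurable h)
    (h2 : MemLp h 2 volume) (h0 : ∀ ξ ∉ band ε, h ξ = 0) :
    mixedNorm p q (volume.restrict (Ioc 0 T)) (fun x t => ‖evol α h x t‖ₑ)
      ≤ B * eLpNorm h 2 volume := by
  refine mixedNorm_evol_le_of_smooth (fun δ hδ ψ hψ hψ0 => ?_) hε hm h2 h0
  obtain ⟨φ, hφ, hφ2, -⟩ := exists_schwartz_data hδ hψ hψ0
  rw [← hφ2]
  refine le_trans (le_of_eq ?_) (H φ)
  simp only [LpLq, hφ, mixedNorm]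
  have hi := integrable_powMul α hδ hψ.continuous.measurable
    (memLp_of_smooth_band hψ.continuous hψ0 2) hψ0
  rw [← eLpNorm_enorm (fun x => (eLpNorm (fun t => evol α ψ x t) q _).toReal)]
  congr 1
  ext x
  have hfin : eLpNorm (fun t => evol α ψ x t) q (volume.restrict (Ioc 0 T)) ≠ ∞ := by
    refine (MemLp.of_bound (p := q) (C := ∫ ξ, ‖powMul α ψ ξ‖) ?_ ?_).2.ne
    · exact ((continuous_evol hi).comp (by fun_prop :
        Continuous fun t : ℝ => (x, t))).aestronglyMeasurable
    · exact Eventually.of_forall fun t => (norm_integral_le_integral_norm _).trans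
        (by simp)
  rw [eLpNorm_enorm, ← ofReal_norm, Real.norm_of_nonneg ENNReal.toReal_nonneg,
    ENNReal.ofReal_toReal hfin]

/-- The inverse Fourier transform is an `L²` contraction on localized functions. -/
theorem eLpNorm_fourierInv_le {ε : ℝ} (hε : 0 < ε) {h : ℝ → ℂ} (hm : Measurable h)
    (h2 : MemLp h 2 volume) (h0 : ∀ ξ ∉ band ε, h ξ = 0) :
    eLpNorm (𝓕⁻ h) 2 volume ≤ eLpNorm h 2 volume := by
  have hev : ∀ g : ℝ → ℂ, (fun x => ‖evol 0 g x 0‖ₑ) = fun x => ‖𝓕⁻ g x‖ₑ := fun g => by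
    ext x
    rw [evol_eq_fourierInv]
    simp [powMul]
  have hmix : ∀ g : ℝ → ℂ, mixedNorm 2 1 (Measure.dirac 0) (fun x t => ‖evol 0 g x t‖ₑ)
      = eLpNorm (𝓕⁻ g) 2 volume := fun g => by
    simp only [mixedNorm, eLpNorm_one_eq_lintegral_enorm, enorm_enorm, lintegral_dirac]
    rw [hev, eLpNorm_enorm]
  have := mixedNorm_evol_le_of_smooth (α := 0) (p := 2) (q := 1) (ν := Measure.dirac 0) (B := 1)
    (fun δ hδ ψ hψ hψ0 => ?_) hε hm h2 h0
  · rwa [hmix, ENNReal.coe_one, one_mul] at this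
  · obtain ⟨φ, -, hφ, hφψ⟩ := exists_schwartz_data hδ hψ hψ0
    rw [hmix, ← hφψ, hφ, ENNReal.coe_one, one_mul]

theorem exists_slice_decay (f : SchwartzMap (ℝ × ℝ) ℂ) :
    ∃ B : ℝ, 0 ≤ B ∧ ∀ y τ, ‖f (y, τ)‖ ≤ B * (1 + y ^ 2)⁻¹ := by
  obtain ⟨C₀, h₀, hC₀⟩ := f.decay 0 0
  obtain ⟨C₂, h₂, hC₂⟩ := f.decay 2 0
  refine ⟨C₀ + C₂, by positivity, fun y τ => ?_⟩
  rw [← div_eq_mul_inv, le_div_iff₀ (by positivity)]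
  have a := hC₀ (y, τ)
  have b := hC₂ (y, τ)
  simp only [norm_iteratedFDeriv_zero, pow_zero, one_mul] at a b
  have c : y ^ 2 ≤ ‖(y, τ)‖ ^ 2 := by
    rw [← sq_abs y]
    exact pow_le_pow_left₀ (abs_nonneg y) (le_max_left |y| |τ|) 2
  nlinarith [norm_nonneg (f (y, τ)), mul_le_mul_of_nonneg_right c (norm_nonneg (f (y, τ)))]

theorem integrable_slice (f : SchwartzMap (ℝ × ℝ) ℂ) (τ : ℝ) :
    Integrable fun y => f (y, τ) := by
  obtain ⟨B, -, hB⟩ := exists_slice_decay f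
  exact (integrable_inv_one_add_sq.const_mul B).mono'
    (f.continuous.comp (by fun_prop)).aestronglyMeasurable (Eventually.of_forall fun y => hB y τ)

theorem hasDerivAt_slice (f : SchwartzMap (ℝ × ℝ) ℂ) (τ y : ℝ) :
    HasDerivAt (fun y => f (y, τ)) (LineDeriv.lineDerivOp ((1, 0) : ℝ × ℝ) f (y, τ)) y := by
  rw [SchwartzMap.lineDerivOp_apply_eq_fderiv]
  have h1 : HasFDerivAt f (fderiv ℝ f (y, τ)) (y, τ) :=
    (f.differentiable (y, τ)).hasFDerivAt
  exact h1.comp_hasDerivAt y ((hasDerivAt_id y).prodMk (hasDerivAt_const y τ))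

theorem fourier_slice_lineDeriv (f : SchwartzMap (ℝ × ℝ) ℂ) (τ ξ : ℝ) :
    𝓕 (fun y => LineDeriv.lineDerivOp ((1, 0) : ℝ × ℝ) f (y, τ)) ξ
      = (2 * π * Complex.I * ξ) * 𝓕 (fun y => f (y, τ)) ξ := by
  have hd : deriv (fun y => f (y, τ)) = fun y => LineDeriv.lineDerivOp ((1, 0) : ℝ × ℝ) f (y, τ) :=
    funext fun y => (hasDerivAt_slice f τ y).deriv
  have := Real.fourier_deriv (integrable_slice f τ)
    (fun y => (hasDerivAt_slice f τ y).differentiableAt) (by rw [hd]; exact integrable_slice _ τ)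
  rw [hd] at this
  simpa using congrFun this ξ

theorem exists_norm_fourier_slice_le (f : SchwartzMap (ℝ × ℝ) ℂ) :
    ∃ B : ℝ, 0 ≤ B ∧ ∀ τ ξ, ‖𝓕 (fun y => f (y, τ)) ξ‖ ≤ B := by
  obtain ⟨B, hB0, hB⟩ := exists_slice_decay f
  refine ⟨B * π, by positivity, fun τ ξ => ?_⟩
  rw [fourier_eq_integral_wave]
  refine (norm_integral_le_integral_norm _).trans ?_
  simp only [norm_mul, norm_wave, one_mul]
  rw [← integral_univ_inv_one_add_sq, ← integral_const_mul]
  exact integral_mono (integrable_slice f τ).norm (integrable_inv_one_add_sq.const_mul B)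
    fun y => hB y τ

/-- The spatial Fourier transform of a space-time Schwartz function decays uniformly in time. -/
theorem exists_fourier_slice_decay (f : SchwartzMap (ℝ × ℝ) ℂ) :
    ∃ B : ℝ, 0 ≤ B ∧ ∀ τ ξ, ‖𝓕 (fun y => f (y, τ)) ξ‖ ≤ B * (1 + ξ ^ 2)⁻¹ := by
  obtain ⟨B₀, h₀, hB₀⟩ := exists_norm_fourier_slice_le f
  obtain ⟨B₂, h₂, hB₂⟩ := exists_norm_fourier_slice_le
    (LineDeriv.lineDerivOp ((1, 0) : ℝ × ℝ) (LineDeriv.lineDerivOp ((1, 0) : ℝ × ℝ) f))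
  refine ⟨B₀ + B₂, by positivity, fun τ ξ => ?_⟩
  rw [← div_eq_mul_inv, le_div_iff₀ (by positivity)]
  have a := hB₀ τ ξ
  have b := hB₂ τ ξ
  rw [fourier_slice_lineDeriv, fourier_slice_lineDeriv, ← mul_assoc, norm_mul] at b
  have c : ‖(2 * π * Complex.I * ξ : ℂ) * (2 * π * Complex.I * ξ)‖ = (2 * π) ^ 2 * ξ ^ 2 := by
    simp only [norm_mul, Complex.norm_I, Complex.norm_real, Complex.norm_ofNat,
      Real.norm_of_nonneg pi_pos.le]
    rw [← sq_abs ξ, Real.norm_eq_abs]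
    ring
  rw [c] at b
  set n := ‖𝓕 (fun y => f (y, τ)) ξ‖
  have hn : 0 ≤ n := norm_nonneg _
  have d : ξ ^ 2 ≤ (2 * π) ^ 2 * ξ ^ 2 :=
    le_mul_of_one_le_left (sq_nonneg ξ) (by nlinarith [pi_gt_three])
  nlinarith [mul_le_mul_of_nonneg_right d hn]

/-- Lebesgue measure on the strip `ℝ × (s, t]`. -/
def strip (s t : ℝ) : Measure (ℝ × ℝ) := (volume : Measure ℝ).prod (volume.restrict (Ioc s t))

instance (s t : ℝ) : SFinite (strip s t) := by unfold strip; infer_instance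

theorem strip_eq_restrict (s t : ℝ) : strip s t = volume.restrict (univ ×ˢ Ioc s t) := by
  rw [strip, Measure.volume_eq_prod, ← Measure.prod_restrict, Measure.restrict_univ]

theorem integrable_strip (f : SchwartzMap (ℝ × ℝ) ℂ) (s t : ℝ) : Integrable f (strip s t) := by
  rw [strip_eq_restrict]; exact f.integrable.restrict

/-- The symbol `∫_s^t e^{-iτξ|ξ|} f̂(ξ, τ) dτ` driving the Duhamel term. -/
def duhSymbol (f : ℝ × ℝ → ℂ) (s t ξ : ℝ) : ℂ := ∫ z, wave (-z.1) (-z.2) ξ * f z ∂(strip s t)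

theorem integrable_wave_mul_strip (f : SchwartzMap (ℝ × ℝ) ℂ) (s t ξ : ℝ) :
    Integrable (fun z : ℝ × ℝ => wave (-z.1) (-z.2) ξ * f z) (strip s t) :=
  (integrable_strip f s t).bdd_mul (c := 1) ((continuous_fst.neg.wave continuous_snd.neg
    continuous_const).aestronglyMeasurable) (by simp)

theorem continuous_duhSymbol (f : SchwartzMap (ℝ × ℝ) ℂ) (s t : ℝ) :
    Continuous (duhSymbol f s t) := by
  refine continuous_of_dominated (bound := fun z => ‖f z‖)
    (fun ξ => (integrable_wave_mul_strip f s t ξ).1) (fun ξ => Eventually.of_forall fun z => by simp)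
    (integrable_strip f s t).norm (Eventually.of_forall fun z => ?_)
  exact (continuous_const.wave continuous_const continuous_id).mul continuous_const

theorem duhSymbol_add (f : SchwartzMap (ℝ × ℝ) ℂ) {a b c : ℝ} (hab : a ≤ b) (hbc : b ≤ c)
    (ξ : ℝ) : duhSymbol f a b ξ + duhSymbol f b c ξ = duhSymbol f a c ξ := by
  have h1 := integrable_wave_mul_strip f a b ξ
  have h2 := integrable_wave_mul_strip f b c ξ
  simp only [duhSymbol, strip_eq_restrict] at *
  rw [← Ioc_union_Ioc_eq_Ioc hab hbc, prod_union]
  refine (setIntegral_union ?_ (MeasurableSet.univ.prod measurableSet_Ioc) h1 h2).symm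
  rw [Set.disjoint_left]
  rintro z ⟨-, hz⟩ ⟨-, hz'⟩
  exact absurd hz'.1 (not_lt.2 hz.2)

theorem duhSymbol_eq_integral_fourier (f : SchwartzMap (ℝ × ℝ) ℂ) (s t ξ : ℝ) :
    duhSymbol f s t ξ = ∫ τ in Ioc s t, wave 0 (-τ) ξ * 𝓕 (fun y => f (y, τ)) ξ := by
  have h := integrable_wave_mul_strip f s t ξ
  rw [duhSymbol]
  rw [strip] at *
  rw [integral_prod_symm _ h]
  refine integral_congr_ae (Eventually.of_forall fun τ => ?_)
  simp only
  rw [fourier_eq_integral_wave, ← integral_const_mul]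
  refine integral_congr_ae (Eventually.of_forall fun y => ?_)
  simp only
  rw [← mul_assoc, wave_mul]
  simp

theorem exists_duhSymbol_decay (f : SchwartzMap (ℝ × ℝ) ℂ) :
    ∃ B : ℝ, 0 ≤ B ∧ ∀ s t ξ, s ≤ t → ‖duhSymbol f s t ξ‖ ≤ B * (t - s) * (1 + ξ ^ 2)⁻¹ := by
  obtain ⟨B, h0, hB⟩ := exists_fourier_slice_decay f
  refine ⟨B, h0, fun s t ξ hst => ?_⟩
  rw [duhSymbol_eq_integral_fourier]
  refine (norm_setIntegral_le_of_norm_le_const (C := B * (1 + ξ ^ 2)⁻¹) (by simp)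
    fun τ _ => ?_).trans (le_of_eq ?_)
  · simpa using hB τ ξ
  · rw [measureReal_def, Real.volume_Ioc, ENNReal.toReal_ofReal (by linarith)]
    ring

theorem integrable_duhSymbol (f : SchwartzMap (ℝ × ℝ) ℂ) {s t : ℝ} (hst : s ≤ t) :
    Integrable (duhSymbol f s t) := by
  obtain ⟨B, -, hB⟩ := exists_duhSymbol_decay f
  exact (integrable_inv_one_add_sq.const_mul (B * (t - s))).mono'
    (continuous_duhSymbol f s t).aestronglyMeasurable
    (Eventually.of_forall fun ξ => hB s t ξ hst)

theorem continuous_fourier_slice (f : SchwartzMap (ℝ × ℝ) ℂ) :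
    Continuous fun z : ℝ × ℝ => 𝓕 (fun y => f (y, z.1)) z.2 := by
  obtain ⟨B, -, hB⟩ := exists_slice_decay f
  simp only [fourier_eq_integral_wave]
  have hc : Continuous fun w : (ℝ × ℝ) × ℝ => wave (-w.2) 0 w.1.2 * f (w.2, w.1.1) :=
    (continuous_snd.neg.wave continuous_const (continuous_snd.comp continuous_fst)).mul
      (f.continuous.comp (by fun_prop))
  refine continuous_of_dominated (bound := fun y => B * (1 + y ^ 2)⁻¹)
    (fun z => (hc.comp (by fun_prop : Continuous fun y : ℝ => (z, y))).aestronglyMeasurable)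
    (fun z => Eventually.of_forall fun y => by simpa using hB y z.1)
    (integrable_inv_one_add_sq.const_mul B)
    (Eventually.of_forall fun y => hc.comp (by fun_prop : Continuous fun z : ℝ × ℝ => (z, y)))

/-- The Duhamel integral is a Fourier integral. -/
theorem duhamel_eq_fourierInv (f : SchwartzMap (ℝ × ℝ) ℂ) (x t : ℝ) :
    duhamel (fun x t => f (x, t)) x t = 𝓕⁻ (fun ξ => wave 0 t ξ * duhSymbol f 0 t ξ) x := by
  obtain ⟨B, -, hB⟩ := exists_fourier_slice_decay f
  have hc : Continuous fun w : ℝ × ℝ =>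
      wave x (t - w.1) w.2 * 𝓕 (fun y => f (y, w.1)) w.2 :=
    (continuous_const.wave (continuous_const.sub continuous_fst) continuous_snd).mul
      (continuous_fourier_slice f)
  have hintegrable : Integrable (Function.uncurry fun τ ξ => wave x (t - τ) ξ * 𝓕 (fun y => f (y, τ)) ξ)
      ((volume.restrict (Ioc 0 t)).prod volume) := by
    refine Integrable.mono' (g := fun w : ℝ × ℝ => B * (1 + w.2 ^ 2)⁻¹) ?_
      hc.aestronglyMeasurable (Eventually.of_forall fun w => by simpa [Function.uncurry] using hB w.1 w.2)
    have : Integrable (fun _ : ℝ => (1 : ℝ)) (volume.restrict (Ioc 0 t)) := by simp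
    simpa using this.mul_prod (integrable_inv_one_add_sq.const_mul B)
  have lhs : duhamel (fun x t => f (x, t)) x t
      = ∫ τ in Ioc 0 t, ∫ ξ, wave x (t - τ) ξ * 𝓕 (fun y => f (y, τ)) ξ := by
    unfold duhamel BOGroup FMul
    refine integral_congr_ae (Eventually.of_forall fun τ => ?_)
    simp only
    rw [fourierInv_eq_integral_wave]
    refine integral_congr_ae (Eventually.of_forall fun ξ => ?_)
    simp only
    rw [boSymbol_eq_wave, ← mul_assoc, wave_mul]
    simp
  rw [lhs, integral_integral_swap hintegrable, fourierInv_eq_integral_wave]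
  refine integral_congr_ae (Eventually.of_forall fun ξ => ?_)
  simp only
  rw [duhSymbol_eq_integral_fourier, ← integral_const_mul, ← integral_const_mul]
  refine integral_congr_ae (Eventually.of_forall fun τ => ?_)
  simp only
  rw [← mul_assoc, ← mul_assoc, wave_mul, wave_mul]
  simp [sub_eq_add_neg]

/-- Frequency truncations of the multiplied Duhamel term. -/
def truncSymbol (f : ℝ × ℝ → ℂ) (α ε s t : ℝ) : ℝ → ℂ :=
  (band ε).indicator (powMul α (duhSymbol f s t))

theorem powMul_indicator (α : ℝ) (S : Set ℝ) (h : ℝ → ℂ) :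
    powMul α (S.indicator h) = S.indicator (powMul α h) := by
  ext ξ
  by_cases hξ : ξ ∈ S <;> simp [powMul, hξ]

theorem powMul_truncSymbol {ε : ℝ} (hε : 0 < ε) (f : ℝ × ℝ → ℂ) (α β s t : ℝ) :
    powMul α (truncSymbol f β ε s t)
      = (band ε).indicator (powMul (α + β) (duhSymbol f s t)) := by
  rw [truncSymbol, powMul_indicator]
  refine Set.indicator_congr fun ξ hξ => ?_
  simp only [powMul]
  rw [Real.rpow_add (hε.trans_le hξ.1)]
  push_cast
  ring

/-- `D_x^{α+β}` of the Duhamel term is controlled by its frequency truncations. -/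
theorem enorm_slice_le_liminf (f : SchwartzMap (ℝ × ℝ) ℂ) (α β x : ℝ) {t : ℝ} (ht : 0 ≤ t) :
    ‖sliceOp (Dop (α + β)) (duhamel (fun x t => f (x, t))) x t‖ₑ
      ≤ liminf (fun n : ℕ => ‖evol α (truncSymbol f β (1 / ((n : ℝ) + 1)) 0 t) x t‖ₑ) atTop := by
  set G : ℝ → ℂ := fun ξ => wave 0 t ξ * duhSymbol f 0 t ξ with hG
  have hGc : Continuous G := (continuous_const.wave continuous_const continuous_id).mul
    (continuous_duhSymbol f 0 t)
  have hGi : Integrable G := integrable_wave_mul (integrable_duhSymbol f ht) 0 t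
  have hs : sliceOp (Dop (α + β)) (duhamel (fun x t => f (x, t))) x t
      = 𝓕⁻ (fun ξ => ((|ξ| ^ (α + β) : ℝ) : ℂ) * 𝓕 (𝓕⁻ G) ξ) x := by
    unfold sliceOp Dop FMul
    simp only [duhamel_eq_fourierInv f _ t]
    rfl
  rw [hs]
  by_cases hi : Integrable (𝓕 G)
  swap
  · have hi' : ¬ Integrable (𝓕⁻ G) := by
      intro h
      refine hi ?_
      have := h.comp_neg
      simpa only [Real.fourierInv_eq_fourier_neg, neg_neg] using this
    have hz : 𝓕 (𝓕⁻ G) = 0 := by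
      ext ξ
      rw [fourier_eq_integral_wave]
      refine integral_undef fun h => hi' ?_
      have h' := integrable_wave_mul h ξ 0
      refine h'.congr (Eventually.of_forall fun y => ?_)
      have e : wave ξ 0 y * wave (-y) 0 ξ = 1 := by
        simp only [wave, ← Complex.exp_add]
        rw [← Complex.exp_zero]
        congr 1
        push_cast
        ring
      simp only
      rw [← mul_assoc, e, one_mul]
    simp [hz, fourierInv_eq_integral_wave]
  rw [hGc.fourier_fourierInv_eq hGi hi]
  have hev : 𝓕⁻ (fun ξ => ((|ξ| ^ (α + β) : ℝ) : ℂ) * G ξ) x = evol (α + β) (duhSymbol f 0 t) x t := by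
    rw [evol_eq_fourierInv]; rfl
  rw [hev]
  by_cases hp : Integrable (powMul (α + β) (duhSymbol f 0 t))
  swap
  · have : evol (α + β) (duhSymbol f 0 t) x t = 0 := by
      refine integral_undef fun h => hp ?_
      have h' := h.bdd_mul (c := 1) (f := wave (-x) (-t)) ((continuous_const.wave continuous_const
        continuous_id).aestronglyMeasurable) (by simp)
      refine h'.congr (Eventually.of_forall fun y => ?_)
      simp only
      rw [← mul_assoc, wave_mul]
      simp
    simp [this]
  refine (Tendsto.liminf_eq (Tendsto.enorm ?_)).ge
  unfold evol
  refine tendsto_integral_of_dominated_convergence (fun ξ => ‖powMul (α + β) (duhSymbol f 0 t) ξ‖)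
    (fun n => ?_) hp.norm (fun n => Eventually.of_forall fun ξ => ?_) ?_
  · rw [powMul_truncSymbol (by positivity)]
    exact (integrable_wave_mul (hp.indicator (measurableSet_band _)) x t).1
  · rw [powMul_truncSymbol (by positivity), norm_mul, norm_wave, one_mul]
    exact norm_indicator_le_norm_self _ _
  · have h0 : ∀ᵐ ξ : ℝ, ξ ≠ 0 := by simp [ae_iff]
    filter_upwards [h0] with ξ hξ
    refine tendsto_const_nhds.congr' ?_
    have e1 : ∀ᶠ n : ℕ in atTop, 1 / ((n : ℝ) + 1) ≤ |ξ| :=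
      (tendsto_one_div_add_atTop_nhds_zero_nat (𝕜 := ℝ)).eventually_le_const (abs_pos.2 hξ)
    have e2 : ∀ᶠ n : ℕ in atTop, |ξ| ≤ n := tendsto_natCast_atTop_atTop.eventually_ge_atTop _
    filter_upwards [e1, e2] with n h1 h2
    rw [powMul_truncSymbol (by positivity), indicator_of_mem]
    refine ⟨h1, ?_⟩
    rw [one_div, inv_inv]
    linarith

theorem truncSymbol_of_notMem {f : ℝ × ℝ → ℂ} {β ε s t ξ : ℝ} (hξ : ξ ∉ band ε) :
    truncSymbol f β ε s t ξ = 0 := indicator_of_notMem hξ _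

theorem measurable_truncSymbol (f : SchwartzMap (ℝ × ℝ) ℂ) (β ε s t : ℝ) :
    Measurable (truncSymbol f β ε s t) :=
  ((continuous_duhSymbol f s t).measurable.powMul β).indicator (measurableSet_band ε)

/-- Lipschitz dependence of truncated symbols on the time interval, uniformly in frequency. -/
theorem exists_truncSymbol_bound (f : SchwartzMap (ℝ × ℝ) ℂ) (β : ℝ) {ε : ℝ} (hε : 0 < ε) :
    ∃ B : ℝ, 0 ≤ B ∧ ∀ s t ξ, s ≤ t → ‖truncSymbol f β ε s t ξ‖ ≤ B * (t - s) := by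
  obtain ⟨A, hA⟩ := exists_rpow_le_on_band β hε
  obtain ⟨B, hB0, hB⟩ := exists_duhSymbol_decay f
  refine ⟨A * B, by positivity, fun s t ξ hst => ?_⟩
  have hst' : 0 ≤ t - s := sub_nonneg.2 hst
  by_cases hξ : ξ ∈ band ε
  · rw [truncSymbol, indicator_of_mem hξ, powMul, norm_mul, Complex.norm_real,
      Real.norm_of_nonneg (Real.rpow_nonneg (abs_nonneg ξ) β), mul_assoc]
    refine mul_le_mul (hA ξ hξ) ((hB s t ξ hst).trans ?_) (norm_nonneg _) A.2
    exact mul_le_of_le_one_right (by positivity) (inv_le_one_of_one_le₀ (by nlinarith [sq_nonneg ξ]))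
  · rw [truncSymbol_of_notMem hξ]
    simp only [norm_zero]
    positivity

theorem memLp_truncSymbol (f : SchwartzMap (ℝ × ℝ) ℂ) (β : ℝ) {ε : ℝ} (hε : 0 < ε) {s t : ℝ}
    (hst : s ≤ t) : MemLp (truncSymbol f β ε s t) 2 volume := by
  obtain ⟨B, -, hB⟩ := exists_truncSymbol_bound f β hε
  have : truncSymbol f β ε s t = (band ε).indicator (truncSymbol f β ε s t) :=
    (indicator_eq_self.2 fun ξ hξ => by_contra fun h => hξ (truncSymbol_of_notMem h)).symm
  rw [this, memLp_indicator_iff_restrict (measurableSet_band ε)]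
  have : IsFiniteMeasure (volume.restrict (band ε)) :=
    ⟨by simpa using volume_band_lt_top ε⟩
  exact MemLp.of_bound (measurable_truncSymbol f β ε s t).aestronglyMeasurable _
    (Eventually.of_forall fun ξ => hB s t ξ hst)

theorem truncSymbol_add (f : SchwartzMap (ℝ × ℝ) ℂ) (β ε : ℝ) {a b c : ℝ} (hab : a ≤ b)
    (hbc : b ≤ c) (ξ : ℝ) :
    truncSymbol f β ε a b ξ + truncSymbol f β ε b c ξ = truncSymbol f β ε a c ξ := by
  by_cases hξ : ξ ∈ band ε
  · simp only [truncSymbol, indicator_of_mem hξ, powMul, ← mul_add, duhSymbol_add f hab hbc]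
  · simp only [truncSymbol_of_notMem hξ, add_zero]

theorem measurePreserving_sub_Ioc (s t : ℝ) :
    MeasurePreserving (fun τ : ℝ => τ - s) (volume.restrict (Ioc s t))
      (volume.restrict (Ioc 0 (t - s))) := by
  have h := (measurePreserving_sub_right (volume : Measure ℝ) s).restrict_preimage
    (measurableSet_Ioc (a := 0) (b := t - s))
  have e : (fun x => x - s) ⁻¹' Ioc 0 (t - s) = Ioc s t := by
    ext τ; simp
  rwa [e] at h

theorem mixedNorm_evol_shift {α : ℝ} {h : ℝ → ℂ} (hi : Integrable (powMul α h)) (p q : ℝ≥0∞)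
    (s t : ℝ) :
    mixedNorm p q (volume.restrict (Ioc s t)) (fun x τ => ‖evol α h x τ‖ₑ)
      = mixedNorm p q (volume.restrict (Ioc 0 (t - s)))
        (fun x τ => ‖evol α (fun ξ => wave 0 s ξ * h ξ) x τ‖ₑ) := by
  unfold mixedNorm
  congr 1
  ext x
  rw [← eLpNorm_comp_measurePreserving _ (measurePreserving_sub_Ioc s t)]
  · congr 1
    ext τ
    simp [evol_translate]
  · simp only [evol_translate]
    exact ((continuous_evol hi).comp (by fun_prop :
      Continuous fun τ : ℝ => (x, τ + s))).enorm.measurable.aestronglyMeasurable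

/-- The dual form of a homogeneous estimate. -/
theorem eLpNorm_truncSymbol_le (f : SchwartzMap (ℝ × ℝ) ℂ) {β ε s t : ℝ} (hε : 0 < ε)
    (hst : s ≤ t) {p q p' q' B : ℝ≥0∞} (hp : 1 / p' = 1 - 1 / p) (hp1 : 1 ≤ p)
    (hq : 1 / q' = 1 - 1 / q) (hq1 : 1 ≤ q)
    (H : ∀ h : ℝ → ℂ, Measurable h → MemLp h 2 volume → (∀ ξ ∉ band ε, h ξ = 0) →
      mixedNorm p q (volume.restrict (Ioc 0 (t - s))) (fun x t => ‖evol β h x t‖ₑ)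
        ≤ B * eLpNorm h 2 volume) :
    eLpNorm (truncSymbol f β ε s t) 2 volume
      ≤ B * mixedNorm p' q' (volume.restrict (Ioc s t)) (fun x t => ‖f (x, t)‖ₑ) := by
  set h := truncSymbol f β ε s t with hh
  have hm : Measurable h := measurable_truncSymbol f β ε s t
  have h2 : MemLp h 2 volume := memLp_truncSymbol f β hε hst
  have h0 : ∀ ξ ∉ band ε, h ξ = 0 := fun ξ hξ => truncSymbol_of_notMem hξ
  have hi : Integrable (powMul β h) := integrable_powMul β hε hm h2 h0
  set N := eLpNorm h 2 volume with hN
  set M := mixedNorm p' q' (volume.restrict (Ioc s t)) (fun x t => ‖f (x, t)‖ₑ) with hM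
  have hev : mixedNorm p q (volume.restrict (Ioc s t)) (fun x τ => ‖evol β h x τ‖ₑ) ≤ B * N := by
    rw [mixedNorm_evol_shift hi]
    have hw : ∀ ξ, ‖wave 0 s ξ * h ξ‖ = ‖h ξ‖ := fun ξ => by simp
    have hwm : Measurable fun ξ => wave 0 s ξ * h ξ :=
      (continuous_const.wave continuous_const continuous_id).measurable.mul hm
    have hwN : eLpNorm (fun ξ => wave 0 s ξ * h ξ) 2 volume = N :=
      eLpNorm_congr_norm_ae (Eventually.of_forall hw)
    rw [← hwN]
    refine H _ hwm ⟨hwm.aestronglyMeasurable, ?_⟩ fun ξ hξ => by simp [h0 ξ hξ]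
    rw [hwN]; exact h2.2
  have hfub : ∫ ξ, (starRingEnd ℂ) (powMul β h ξ) * duhSymbol f s t ξ
      = ∫ z, f z * (starRingEnd ℂ) (evol β h z.1 z.2) ∂(strip s t) := by
    have hintegrable : Integrable (Function.uncurry fun (ξ : ℝ) (z : ℝ × ℝ) =>
        (starRingEnd ℂ) (powMul β h ξ) * (wave (-z.1) (-z.2) ξ * f z))
        (volume.prod (strip s t)) := by
      have hconj : Integrable fun ξ => (starRingEnd ℂ) (powMul β h ξ) :=
        hi.mono (Complex.continuous_conj.comp_aestronglyMeasurable hi.1)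
          (Eventually.of_forall fun ξ => by simp)
      have hprod := hconj.mul_prod (integrable_strip f s t)
      have hc : Continuous fun w : ℝ × ℝ × ℝ => wave (-w.2.1) (-w.2.2) w.1 :=
        Continuous.wave (by fun_prop) (by fun_prop) (by fun_prop)
      have := hprod.bdd_mul (c := 1) hc.aestronglyMeasurable (by simp)
      refine this.congr (Eventually.of_forall fun w => ?_)
      simp only [Function.uncurry]
      ring
    simp only [duhSymbol, ← integral_const_mul]
    rw [integral_integral_swap hintegrable]
    refine integral_congr_ae (Eventually.of_forall fun z => ?_)
    simp only
    rw [evol, ← integral_conj, ← integral_const_mul]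
    refine integral_congr_ae (Eventually.of_forall fun ξ => ?_)
    simp only [map_mul, conj_wave]
    ring
  have hpt : ∀ ξ, ((‖h ξ‖ ^ 2 : ℝ) : ℂ) = (starRingEnd ℂ) (powMul β h ξ) * duhSymbol f s t ξ := by
    intro ξ
    by_cases hξ : ξ ∈ band ε
    · have e : h ξ = ((|ξ| ^ β : ℝ) : ℂ) * duhSymbol f s t ξ := by
        rw [hh, truncSymbol, indicator_of_mem hξ, powMul]
      have e2 : ((‖h ξ‖ ^ 2 : ℝ) : ℂ) = (starRingEnd ℂ) (h ξ) * h ξ := by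
        rw [Complex.conj_mul']; push_cast; rfl
      rw [e2, powMul, map_mul, Complex.conj_ofReal]
      nth_rewrite 2 [e]
      ring
    · simp [h0 ξ hξ, powMul]
  have hsq : N ^ 2 = ‖∫ ξ, (starRingEnd ℂ) (powMul β h ξ) * duhSymbol f s t ξ‖ₑ := by
    have hsqi : Integrable fun ξ => ‖h ξ‖ ^ 2 := h2.integrable_norm_pow (by simp)
    simp only [← hpt]
    rw [integral_complex_ofReal, ← ofReal_norm, Complex.norm_real,
      Real.norm_of_nonneg (integral_nonneg fun ξ => sq_nonneg _),
      ofReal_integral_eq_lintegral_ofReal hsqi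
        (Eventually.of_forall fun ξ => sq_nonneg _)]
    have e := eLpNorm_nnreal_pow_eq_lintegral (μ := (volume : Measure ℝ)) (f := h) (p := 2)
      (by simp)
    simp only [NNReal.coe_ofNat, ENNReal.rpow_ofNat, ENNReal.coe_ofNat] at e
    rw [hN, e]
    refine lintegral_congr fun ξ => ?_
    rw [ENNReal.ofReal_pow (norm_nonneg _), ofReal_norm]
  have hle : N ^ 2 ≤ M * (B * N) := by
    rw [hsq, hfub]
    refine (enorm_integral_le_lintegral_enorm _).trans ?_
    have hc : Measurable fun z : ℝ × ℝ => ‖f z‖ₑ * ‖evol β h z.1 z.2‖ₑ :=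
      f.continuous.enorm.measurable.mul (continuous_evol hi).enorm.measurable
    calc ∫⁻ z, ‖f z * (starRingEnd ℂ) (evol β h z.1 z.2)‖ₑ ∂(strip s t)
        = ∫⁻ z, ‖f z‖ₑ * ‖evol β h z.1 z.2‖ₑ ∂(strip s t) := by
          simp only [enorm_mul, RCLike.enorm_conj]
      _ = ∫⁻ x, ∫⁻ τ in Ioc s t, ‖f (x, τ)‖ₑ * ‖evol β h x τ‖ₑ := by
          rw [strip, lintegral_prod _ hc.aemeasurable]
      _ ≤ M * mixedNorm p q (volume.restrict (Ioc s t)) (fun x τ => ‖evol β h x τ‖ₑ) :=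
          lintegral_mul_le_mixedNorm (F := fun x τ => ‖f (x, τ)‖ₑ)
            (G := fun x τ => ‖evol β h x τ‖ₑ) f.continuous.enorm.measurable
            (continuous_evol hi).enorm.measurable hp hp1 hq hq1
      _ ≤ M * (B * N) := by gcongr
  rcases eq_or_ne N 0 with h00 | h00
  · rw [h00]; exact zero_le
  · have : N * N ≤ (B * M) * N := by
      calc N * N = N ^ 2 := (sq N).symm
        _ ≤ _ := hle
        _ = _ := by ring
    exact (ENNReal.mul_le_mul_iff_left h00 h2.2.ne).1 this

theorem LpLq_le_mixedNorm (p q : ℝ≥0∞) (T : ℝ) (f : ℝ → ℝ → ℂ) :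
    LpLq p q T f ≤ mixedNorm p q (volume.restrict (Ioc 0 T)) fun x t => ‖f x t‖ₑ := by
  refine eLpNorm_mono_enorm fun x => ?_
  rw [← ofReal_norm, Real.norm_of_nonneg ENNReal.toReal_nonneg, eLpNorm_enorm, enorm_eq_self]
  exact ENNReal.ofReal_toReal_le

theorem LpLq_schwartz (p q : ℝ≥0∞) (T : ℝ) (f : SchwartzMap (ℝ × ℝ) ℂ) :
    LpLq p q T (fun x t => f (x, t))
      = mixedNorm p q (volume.restrict (Ioc 0 T)) fun x t => ‖f (x, t)‖ₑ := by
  unfold LpLq mixedNorm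
  rw [← eLpNorm_enorm]
  congr 1
  ext x
  obtain ⟨B, -, hB⟩ := exists_slice_decay f
  have hfin : eLpNorm (fun t => f (x, t)) q (volume.restrict (Ioc 0 T)) ≠ ∞ :=
    (MemLp.of_bound (p := q) (f.continuous.comp (by fun_prop :
      Continuous fun t : ℝ => (x, t))).aestronglyMeasurable _
      (Eventually.of_forall fun t => hB x t)).2.ne
  rw [eLpNorm_enorm, ← ofReal_norm, Real.norm_of_nonneg ENNReal.toReal_nonneg,
    ENNReal.ofReal_toReal hfin]

theorem mixedNorm_mono_measure {p q : ℝ≥0∞} {μ ν : Measure ℝ} (h : μ ≤ ν)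
    (F : ℝ → ℝ → ℝ≥0∞) : mixedNorm p q μ F ≤ mixedNorm p q ν F :=
  eLpNorm_mono_enorm fun x => by simpa using eLpNorm_mono_measure (F x) h

/-- The homogeneous estimate with constant `C`, for all frequency-localized data. -/
def HomEst (α ν : ℝ) (p q : ℝ≥0∞) (C : ℝ≥0) : Prop :=
  ∀ ε > 0, ∀ T > 0, ∀ h : ℝ → ℂ, Measurable h → MemLp h 2 volume → (∀ ξ ∉ band ε, h ξ = 0) →
    mixedNorm p q (volume.restrict (Ioc 0 T)) (fun x t => ‖evol α h x t‖ₑ)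
      ≤ C * ENNReal.ofReal (T ^ ν) * eLpNorm h 2 volume

theorem homEst_of_schwartz {α ν : ℝ} {p q : ℝ≥0∞} {C : ℝ≥0}
    (H : ∀ (φ : SchwartzMap ℝ ℂ) (T : ℝ), 0 < T →
      LpLq p q T (fun x t => Dop α (BOGroup t ⇑φ) x)
        ≤ C * ENNReal.ofReal (T ^ ν) * eLpNorm ⇑φ 2 volume) : HomEst α ν p q C := by
  intro ε hε T hT h hm h2 h0
  have := mixedNorm_evol_le (α := α) (p := p) (q := q) (T := T)
    (B := C * (T ^ ν).toNNReal) (fun φ => by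
      rw [ENNReal.coe_mul]; exact H φ T hT) hε hm h2 h0
  rwa [ENNReal.coe_mul] at this

theorem HomEst.eLpNorm_truncSymbol_le {β ν : ℝ} {p q p' q' : ℝ≥0∞} {C : ℝ≥0}
    (H : HomEst β ν p q C) (hp : 1 / p' = 1 - 1 / p) (hp1 : 1 ≤ p) (hq : 1 / q' = 1 - 1 / q)
    (hq1 : 1 ≤ q) (f : SchwartzMap (ℝ × ℝ) ℂ) {ε s t : ℝ} (hε : 0 < ε) (hst : s ≤ t) :
    eLpNorm (truncSymbol f β ε s t) 2 volume ≤ C * ENNReal.ofReal ((t - s) ^ ν)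
      * mixedNorm p' q' (volume.restrict (Ioc s t)) (fun x t => ‖f (x, t)‖ₑ) := by
  rcases hst.eq_or_lt with rfl | hlt
  · obtain ⟨B, -, hB⟩ := exists_truncSymbol_bound f β hε
    have : truncSymbol f β ε s s = fun _ => 0 := by
      ext ξ
      simpa using hB s s ξ le_rfl
    simp [this]
  · exact _root_.eLpNorm_truncSymbol_le f hε hst hp hp1 hq hq1 (H ε hε _ (sub_pos.2 hlt))

/-- The `L^∞_T L²_x` estimate for the Duhamel term. -/
theorem HomEst.LqLp_duhamel_le {β ν : ℝ} (hν : 0 ≤ ν) {p q p' q' : ℝ≥0∞} {C : ℝ≥0}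
    (H : HomEst β ν p q C) (hp : 1 / p' = 1 - 1 / p) (hp1 : 1 ≤ p) (hq : 1 / q' = 1 - 1 / q)
    (hq1 : 1 ≤ q) (f : SchwartzMap (ℝ × ℝ) ℂ) {T : ℝ} :
    LqLp ∞ 2 T (sliceOp (Dop β) (duhamel (fun x t => f (x, t))))
      ≤ C * ENNReal.ofReal (T ^ ν) * LpLq p' q' T (fun x t => f (x, t)) := by
  rw [LpLq_schwartz, LqLp, eLpNorm_exponent_top]
  refine eLpNormEssSup_le_of_ae_enorm_bound ?_
  filter_upwards [ae_restrict_mem measurableSet_Ioc] with t ht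
  rw [← ofReal_norm, Real.norm_of_nonneg ENNReal.toReal_nonneg]
  refine ENNReal.ofReal_toReal_le.trans ?_
  set h : ℕ → ℝ → ℂ := fun n => truncSymbol f β (1 / ((n : ℝ) + 1)) 0 t with hh
  have hpos : ∀ n : ℕ, (0 : ℝ) < 1 / ((n : ℝ) + 1) := fun n => by positivity
  have hi : ∀ n, Integrable (powMul 0 (h n)) := fun n =>
    integrable_powMul 0 (hpos n) (measurable_truncSymbol f β _ 0 t)
      (memLp_truncSymbol f β (hpos n) ht.1.le) fun ξ hξ => truncSymbol_of_notMem hξ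
  have hle : ∀ x, ‖sliceOp (Dop β) (duhamel fun x t => f (x, t)) x t‖ₑ
      ≤ ‖liminf (fun n => ‖evol 0 (h n) x t‖ₑ) atTop‖ₑ := fun x => by
    have := enorm_slice_le_liminf f 0 β x ht.1.le
    rw [zero_add] at this
    rwa [enorm_eq_self]
  refine (eLpNorm_mono_enorm hle).trans ((eLpNorm_liminf_le
    (F := fun n x => ‖evol 0 (h n) x t‖ₑ) (fun n => ((continuous_evol (hi n)).comp (by fun_prop :
      Continuous fun x : ℝ => (x, t))).enorm.measurable) 2).trans ?_)
  refine (liminf_le_liminf (v := fun _ => _) (Eventually.of_forall fun n => ?_)).trans_eq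
    (tendsto_const_nhds.liminf_eq)
  rw [eLpNorm_enorm]
  have hF : (fun x => evol 0 (h n) x t) = 𝓕⁻ fun ξ => wave 0 t ξ * h n ξ := by
    ext x
    rw [evol_eq_fourierInv]
    simp [powMul]
  have hw : eLpNorm (fun ξ => wave 0 t ξ * h n ξ) 2 volume = eLpNorm (h n) 2 volume :=
    eLpNorm_congr_norm_ae (Eventually.of_forall fun ξ => by simp)
  have hwm : Measurable fun ξ => wave 0 t ξ * h n ξ :=
    (continuous_const.wave continuous_const continuous_id).measurable.mul
      (measurable_truncSymbol f β _ 0 t)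
  rw [hF]
  refine (eLpNorm_fourierInv_le (hpos n) hwm ⟨hwm.aestronglyMeasurable, ?_⟩ fun ξ hξ => ?_).trans ?_
  · rw [hw]; exact (memLp_truncSymbol f β (hpos n) ht.1.le).2
  · simp only [hh, truncSymbol_of_notMem hξ, mul_zero]
  rw [hw]
  refine (H.eLpNorm_truncSymbol_le hp hp1 hq hq1 f (hpos n) ht.1.le).trans ?_
  rw [sub_zero]
  gcongr
  · exact ht.1.le
  · exact ht.2
  · exact mixedNorm_mono_measure (Measure.restrict_mono (Ioc_subset_Ioc_right ht.2) le_rfl) _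

/-- The norm of the piecewise-in-time increments `U k - U a`, `a ≤ k < b`, over a partition. -/
def stepSum (τ : ℕ → ℝ) (U : ℕ → ℝ → ℝ → ℂ) (a b : ℕ) (x t : ℝ) : ℝ≥0∞ :=
  ∑ k ∈ Finset.Ico a b, (Ioc (τ k) (τ (k + 1))).indicator (fun t => ‖U k x t - U a x t‖ₑ) t

theorem stepSum_eq_zero {τ : ℕ → ℝ} (hτ : Monotone τ) (U : ℕ → ℝ → ℝ → ℂ) {a b : ℕ} (x : ℝ)
    {t : ℝ} (ht : t ∉ Ioc (τ a) (τ b)) : stepSum τ U a b x t = 0 := by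
  refine Finset.sum_eq_zero fun k hk => indicator_of_notMem (fun h => ht ?_) _
  rw [Finset.mem_Ico] at hk
  exact ⟨(hτ hk.1).trans_lt h.1, h.2.trans (hτ hk.2)⟩

theorem measurable_stepSum {τ : ℕ → ℝ} {U : ℕ → ℝ → ℝ → ℂ}
    (hU : ∀ k, Measurable (Function.uncurry (U k))) (a b : ℕ) :
    Measurable (Function.uncurry (stepSum τ U a b)) := by
  have : Function.uncurry (stepSum τ U a b) = fun z : ℝ × ℝ => ∑ k ∈ Finset.Ico a b,
      (Prod.snd ⁻¹' Ioc (τ k) (τ (k + 1))).indicator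
        (fun z : ℝ × ℝ => ‖Function.uncurry (U k) z - Function.uncurry (U a) z‖ₑ) z := by
    ext ⟨x, t⟩
    rfl
  rw [this]
  exact Finset.measurable_sum _ fun k _ =>
    ((hU k).sub (hU a)).enorm.indicator (measurable_snd measurableSet_Ioc)

theorem sum_indicator_Ioc_le {τ : ℕ → ℝ} (hτ : Monotone τ) (a b : ℕ) (t : ℝ) (c : ℝ≥0∞) :
    ∑ k ∈ Finset.Ico a b, (Ioc (τ k) (τ (k + 1))).indicator (fun _ => c) t ≤ c := by
  by_cases h : ∃ k, t ∈ Ioc (τ k) (τ (k + 1))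
  · obtain ⟨k, hk⟩ := h
    have huniq : ∀ j, j ≠ k → t ∉ Ioc (τ j) (τ (j + 1)) := fun j hj hjt => by
      rcases lt_or_gt_of_ne hj with h | h
      · exact absurd (hjt.2.trans (hτ h)) (not_le.2 hk.1)
      · exact absurd (hk.2.trans (hτ h)) (not_le.2 hjt.1)
    by_cases hkm : k ∈ Finset.Ico a b
    · rw [Finset.sum_eq_single_of_mem k hkm fun j _ hj => indicator_of_notMem (huniq j hj) _]
      exact indicator_le_self' (fun _ _ => zero_le) t
    · rw [Finset.sum_eq_zero fun j hj => indicator_of_notMem (huniq j ?_) _]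
      · exact zero_le
      · rintro rfl; exact hkm hj
  · rw [Finset.sum_eq_zero fun j _ => indicator_of_notMem (fun hj => h ⟨j, hj⟩) _]
    exact zero_le

theorem stepSum_split_le {τ : ℕ → ℝ} (hτ : Monotone τ) (U : ℕ → ℝ → ℝ → ℂ) {a b k : ℕ}
    (hak : a ≤ k) (hkb : k < b) (x t : ℝ) :
    stepSum τ U a b x t ≤ (stepSum τ U a k x t + stepSum τ U (k + 1) b x t)
      + (‖U k x t - U a x t‖ₑ + ‖U (k + 1) x t - U a x t‖ₑ) := by
  have e : stepSum τ U a b x t = stepSum τ U a k x t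
      + (Ioc (τ k) (τ (k + 1))).indicator (fun t => ‖U k x t - U a x t‖ₑ) t
      + ∑ j ∈ Finset.Ico (k + 1) b,
        (Ioc (τ j) (τ (j + 1))).indicator (fun t => ‖U j x t - U a x t‖ₑ) t := by
    unfold stepSum
    rw [← Finset.sum_Ico_succ_top hak, Finset.sum_Ico_consecutive _ (by omega) (by omega)]
  have h3 : ∑ j ∈ Finset.Ico (k + 1) b,
        (Ioc (τ j) (τ (j + 1))).indicator (fun t => ‖U j x t - U a x t‖ₑ) t
      ≤ stepSum τ U (k + 1) b x t + ‖U (k + 1) x t - U a x t‖ₑ := by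
    refine le_trans ?_ (add_le_add le_rfl (sum_indicator_Ioc_le hτ (k + 1) b t _))
    rw [stepSum, ← Finset.sum_add_distrib]
    refine Finset.sum_le_sum fun j _ => ?_
    by_cases hj : t ∈ Ioc (τ j) (τ (j + 1))
    · simp only [indicator_of_mem hj]
      refine le_trans (le_of_eq ?_) (enorm_add_le _ _)
      congr 1
      ring
    · simp [indicator_of_notMem hj]
  have h2 : (Ioc (τ k) (τ (k + 1))).indicator (fun t => ‖U k x t - U a x t‖ₑ) t
      ≤ ‖U k x t - U a x t‖ₑ := indicator_le_self' (fun _ _ => zero_le) t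
  rw [e]
  refine (add_le_add (add_le_add le_rfl h2) h3).trans (le_of_eq ?_)
  ring

theorem exists_balanced_split {ω : ℕ → ℕ → ℝ≥0∞}
    (hω : ∀ a b c, a ≤ b → b ≤ c → ω a b + ω b c ≤ ω a c) {a b : ℕ} (hab : a < b)
    (hfin : ω a b ≠ ∞) :
    ∃ k, a ≤ k ∧ k < b ∧ ω a k ≤ ω a b / 2 ∧ ω (k + 1) b ≤ ω a b / 2 := by
  classical
  have h0 : ω a a = 0 := by
    have := hω a a b le_rfl hab.le
    rw [add_comm] at this
    by_contra hne
    exact absurd this (not_le.2 (ENNReal.lt_add_right hfin hne))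
  have hb : ω b b = 0 := by
    have := hω a b b hab.le le_rfl
    by_contra hne
    exact absurd this (not_le.2 (ENNReal.lt_add_right hfin hne))
  set P : ℕ → Prop := fun k => a ≤ k ∧ ω a k ≤ ω a b / 2
  have hPa : P a := ⟨le_rfl, by simp [h0]⟩
  set k := Nat.findGreatest P (b - 1)
  have hk : P k := Nat.findGreatest_spec (P := P) (show a ≤ b - 1 by omega) hPa
  have hkb : k ≤ b - 1 := Nat.findGreatest_le _
  refine ⟨k, hk.1, by omega, hk.2, ?_⟩
  rcases (show k + 1 ≤ b - 1 ∨ k + 1 = b by omega) with h | h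
  · have hn : ¬ P (k + 1) := Nat.findGreatest_is_greatest (Nat.lt_succ_self k) h
    have hn' : ω a b / 2 < ω a (k + 1) := by
      by_contra hcon
      exact hn ⟨hk.1.trans (Nat.le_succ k), not_lt.1 hcon⟩
    have hs := hω a (k + 1) b (hk.1.trans (Nat.le_succ k)) (by omega)
    by_contra hcon
    have := ENNReal.add_lt_add hn' (not_le.1 hcon)
    rw [ENNReal.add_halves] at this
    exact absurd hs (not_le.2 this)
  · rw [h, hb]; exact zero_le

/-- Discrete Christ–Kiselev lemma in mixed-norm spaces. -/
theorem mixedNorm_stepSum_le {p q : ℝ≥0∞} {ν : Measure ℝ} [SFinite ν] (hp : 1 ≤ p) (hq : 1 ≤ q)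
    {r s : ℝ} (hr : 0 < r) (hrs : r < s) (hsp : ENNReal.ofReal s ≤ p)
    (hsq : ENNReal.ofReal s ≤ q) {τ : ℕ → ℝ} (hτ : Monotone τ) {U : ℕ → ℝ → ℝ → ℂ}
    (hU : ∀ k, Measurable (Function.uncurry (U k))) {ω : ℕ → ℕ → ℝ≥0∞}
    (hω : ∀ a b c, a ≤ b → b ≤ c → ω a b + ω b c ≤ ω a c) {N : ℕ}
    (H : ∀ a b, a ≤ b → b ≤ N →
      mixedNorm p q ν (fun x t => ‖U b x t - U a x t‖ₑ) ≤ ω a b ^ (1 / r)) :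
    ∀ a b, a ≤ b → b ≤ N → mixedNorm p q ν (stepSum τ U a b)
      ≤ ENNReal.ofReal (2 / (1 - 2 ^ (1 / s - 1 / r))) * ω a b ^ (1 / r) := by
  have hs : 0 < s := hr.trans hrs
  set θ : ℝ := 2 ^ (1 / s - 1 / r) with hθ
  have hθ0 : 0 < θ := by positivity
  have hθ1 : θ < 1 := Real.rpow_lt_one_of_one_lt_of_neg (by norm_num)
    (sub_neg.2 (one_div_lt_one_div_of_lt hr hrs))
  have h1θ : 0 < 1 - θ := sub_pos.2 hθ1
  set K : ℝ := 2 / (1 - θ) with hK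
  have hK0 : 0 < K := by positivity
  suffices h : ∀ n a b, a ≤ b → b ≤ N → b - a = n →
      mixedNorm p q ν (stepSum τ U a b) ≤ ENNReal.ofReal K * ω a b ^ (1 / r) from
    fun a b hab hb => h _ a b hab hb rfl
  intro n
  induction n using Nat.strong_induction_on with
  | _ n ih =>
    intro a b hab hbN hn
    rcases hab.eq_or_lt with rfl | hlt
    · have : mixedNorm p q ν (stepSum τ U a a) = 0 := by
        have e : stepSum τ U a a = fun _ _ => 0 := by ext; simp [stepSum]
        simp [e, mixedNorm]
      rw [this]; exact zero_le
    by_cases hfin : ω a b = ∞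
    · rw [hfin, ENNReal.top_rpow_of_pos (by positivity),
        ENNReal.mul_top (by simpa using hK0)]
      exact le_top
    obtain ⟨k, hak, hkb, hk1, hk2⟩ := exists_balanced_split hω hlt hfin
    set W := ω a b ^ (1 / r) with hW
    have n1 := ih (k - a) (by omega) a k hak (by omega) rfl
    have n2 := ih (b - (k + 1)) (by omega) (k + 1) b (by omega) hbN rfl
    have m1 : Measurable (Function.uncurry (stepSum τ U a k)) := measurable_stepSum hU a k
    have m2 : Measurable (Function.uncurry (stepSum τ U (k + 1) b)) :=
      measurable_stepSum hU (k + 1) b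
    have d : ∀ j, Measurable (Function.uncurry fun x t => ‖U j x t - U a x t‖ₑ) :=
      fun j => ((hU j).sub (hU a)).enorm
    have half : ∀ {w : ℝ≥0∞}, w ≤ ω a b / 2 → ENNReal.ofReal K * w ^ (1 / r)
        ≤ ENNReal.ofReal (K * 2 ^ (-(1 / r))) * W := fun {w} hw => by
      rw [ENNReal.ofReal_mul hK0.le, mul_assoc]
      gcongr
      refine (ENNReal.rpow_le_rpow hw (by positivity)).trans (le_of_eq ?_)
      rw [div_eq_mul_inv, ENNReal.mul_rpow_of_nonneg _ _ (by positivity), mul_comm, hW,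
        ENNReal.inv_rpow, ← ENNReal.rpow_neg, ← ENNReal.ofReal_rpow_of_pos (by norm_num)]
      simp
    have disj : ∀ x t, stepSum τ U a k x t = 0 ∨ stepSum τ U (k + 1) b x t = 0 := fun x t => by
      rcases le_or_gt t (τ k) with h | h
      · exact Or.inr (stepSum_eq_zero hτ U x fun h' =>
          absurd (h'.1.trans_le h) (not_lt.2 (hτ (Nat.le_succ k))))
      · exact Or.inl (stepSum_eq_zero hτ U x fun h' => absurd h'.2 (not_le.2 h))
    have main : mixedNorm p q ν (fun x t => stepSum τ U a k x t + stepSum τ U (k + 1) b x t)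
        ≤ ENNReal.ofReal (K * θ) * W := by
      have h := mixedNorm_add_rpow_le (p := p) (q := q) (ν := ν) (F := stepSum τ U a k) (G := stepSum τ U (k+1) b) hs hsp hsq m1 m2 disj
      have h' := h.trans (add_le_add (ENNReal.rpow_le_rpow (n1.trans (half hk1)) hs.le)
        (ENNReal.rpow_le_rpow (n2.trans (half hk2)) hs.le))
      rw [← two_mul] at h'
      have h'' := ENNReal.rpow_le_rpow h' (show 0 ≤ 1 / s by positivity)
      rw [← ENNReal.rpow_mul, mul_one_div_cancel hs.ne', ENNReal.rpow_one,
        ENNReal.mul_rpow_of_nonneg _ _ (by positivity), ← ENNReal.rpow_mul,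
        mul_one_div_cancel hs.ne', ENNReal.rpow_one] at h''
      refine h''.trans (le_of_eq ?_)
      have e2 : (2 : ℝ≥0∞) ^ (1 / s) = ENNReal.ofReal (2 ^ (1 / s)) := by
        rw [← ENNReal.ofReal_rpow_of_pos (by norm_num)]; simp
      rw [e2, ← mul_assoc, ← ENNReal.ofReal_mul (by positivity)]
      congr 2
      rw [hθ, sub_eq_add_neg, Real.rpow_add (by norm_num)]
      ring
    have inc : ∀ j, a ≤ j → j ≤ b → mixedNorm p q ν (fun x t => ‖U j x t - U a x t‖ₑ) ≤ W :=
      fun j h1 h2 => (H a j h1 (h2.trans hbN)).trans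
        (ENNReal.rpow_le_rpow (le_self_add.trans (hω a j b h1 h2)) (by positivity))
    calc mixedNorm p q ν (stepSum τ U a b)
        ≤ mixedNorm p q ν (fun x t => (stepSum τ U a k x t + stepSum τ U (k + 1) b x t)
            + (‖U k x t - U a x t‖ₑ + ‖U (k + 1) x t - U a x t‖ₑ)) :=
          mixedNorm_mono fun x => Eventually.of_forall fun t => stepSum_split_le hτ U hak hkb x t
      _ ≤ mixedNorm p q ν (fun x t => stepSum τ U a k x t + stepSum τ U (k + 1) b x t)
            + mixedNorm p q ν (fun x t => ‖U k x t - U a x t‖ₑ + ‖U (k + 1) x t - U a x t‖ₑ) :=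
          mixedNorm_add_le (F := fun x t => stepSum τ U a k x t + stepSum τ U (k + 1) b x t)
            (G := fun x t => ‖U k x t - U a x t‖ₑ + ‖U (k + 1) x t - U a x t‖ₑ) hp hq
            (m1.add m2) ((d k).add (d (k + 1)))
      _ ≤ ENNReal.ofReal (K * θ) * W + (W + W) := by
          refine add_le_add main ((mixedNorm_add_le hp hq (d k) (d (k + 1))).trans ?_)
          exact add_le_add (inc k hak hkb.le) (inc (k + 1) (by omega) hkb)
      _ = ENNReal.ofReal K * W := by
          have : K = K * θ + 2 := by rw [hK]; field_simp; ring
          nth_rewrite 2 [this]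
          rw [ENNReal.ofReal_add (by positivity) (by norm_num), add_mul, ENNReal.ofReal_ofNat,
            two_mul]

theorem mixedNorm_restrict {p q : ℝ≥0∞} {S : Set ℝ} (hS : MeasurableSet S)
    (F : ℝ → ℝ → ℝ≥0∞) :
    mixedNorm p q (volume.restrict S) F
      = mixedNorm p q volume fun x => S.indicator (F x) := by
  unfold mixedNorm
  congr 1
  ext x
  rw [eLpNorm_indicator_eq_eLpNorm_restrict hS]

theorem mixedNorm_restrict_superadd {p q : ℝ≥0∞} {F : ℝ → ℝ → ℝ≥0∞} {m : ℝ} (hm : 0 < m)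
    (hp0 : p ≠ 0) (hq0 : q ≠ 0) (hp : p ≤ ENNReal.ofReal m) (hq : q ≤ ENNReal.ofReal m)
    (hF : Measurable (Function.uncurry F)) {a b c : ℝ} (hab : a ≤ b) (hbc : b ≤ c) :
    mixedNorm p q (volume.restrict (Ioc a b)) F ^ m
        + mixedNorm p q (volume.restrict (Ioc b c)) F ^ m
      ≤ mixedNorm p q (volume.restrict (Ioc a c)) F ^ m := by
  simp only [mixedNorm_restrict measurableSet_Ioc]
  have hmeas : ∀ a b : ℝ, Measurable (Function.uncurry fun x => (Ioc a b).indicator (F x)) :=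
    fun a b => by
      have : (Function.uncurry fun x => (Ioc a b).indicator (F x))
          = (Prod.snd ⁻¹' Ioc a b).indicator (Function.uncurry F) := by
        ext ⟨x, t⟩; rfl
      rw [this]
      exact hF.indicator (measurable_snd measurableSet_Ioc)
  have hdisj : Disjoint (Ioc a b) (Ioc b c) := Set.Ioc_disjoint_Ioc_of_le le_rfl
  refine (mixedNorm_add_rpow_ge hm hp0 hq0 hp hq (hmeas a b) (hmeas b c) fun x t => ?_).trans_eq ?_
  · by_cases h : t ∈ Ioc a b
    · exact Or.inr (indicator_of_notMem (Set.disjoint_left.1 hdisj h) _)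
    · exact Or.inl (indicator_of_notMem h _)
  · congr 2
    ext x t
    rw [← Ioc_union_Ioc_eq_Ioc hab hbc, indicator_union_of_disjoint hdisj]

theorem exists_evol_truncSymbol_bound (f : SchwartzMap (ℝ × ℝ) ℂ) (α β : ℝ) {ε : ℝ} (hε : 0 < ε) :
    ∃ B : ℝ≥0∞, B ≠ ∞ ∧ ∀ a b x t, a ≤ b →
      ‖evol α (truncSymbol f β ε a b) x t‖ₑ ≤ ENNReal.ofReal (b - a) * B := by
  obtain ⟨A, hA⟩ := exists_rpow_le_on_band α hε
  obtain ⟨B, hB0, hB⟩ := exists_truncSymbol_bound f β hε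
  refine ⟨ENNReal.ofReal (A * B) * volume (band ε),
    ENNReal.mul_ne_top ENNReal.ofReal_ne_top (volume_band_lt_top ε).ne, fun a b x t hab => ?_⟩
  refine (enorm_evol_le _ _ _ _).trans ?_
  calc ∫⁻ ξ, ‖powMul α (truncSymbol f β ε a b) ξ‖ₑ
      ≤ ∫⁻ ξ, (band ε).indicator (fun _ => ENNReal.ofReal (A * (B * (b - a)))) ξ := by
        refine lintegral_mono fun ξ => ?_
        by_cases hξ : ξ ∈ band ε
        · rw [indicator_of_mem hξ, ← ofReal_norm, powMul, norm_mul, Complex.norm_real,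
            Real.norm_of_nonneg (by positivity)]
          exact ENNReal.ofReal_le_ofReal (mul_le_mul (hA ξ hξ) (hB a b ξ hab) (norm_nonneg _)
            A.2)
        · simp [powMul, truncSymbol_of_notMem hξ]
    _ = ENNReal.ofReal (b - a) * (ENNReal.ofReal (A * B) * volume (band ε)) := by
        rw [lintegral_indicator_const (measurableSet_band ε), ← mul_assoc (ENNReal.ofReal (b - a)),
          ← ENNReal.ofReal_mul (sub_nonneg.2 hab)]
        congr 2
        ring

theorem evol_truncSymbol_sub (f : SchwartzMap (ℝ × ℝ) ℂ) (α β : ℝ) {ε : ℝ} (hε : 0 < ε)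
    {a b c : ℝ} (hab : a ≤ b) (hbc : b ≤ c) (x t : ℝ) :
    evol α (truncSymbol f β ε a c) x t - evol α (truncSymbol f β ε a b) x t
      = evol α (truncSymbol f β ε b c) x t := by
  have hi : ∀ {a b : ℝ}, a ≤ b → Integrable (powMul α (truncSymbol f β ε a b)) := fun h =>
    integrable_powMul α hε (measurable_truncSymbol f β ε _ _) (memLp_truncSymbol f β hε h)
      fun ξ hξ => truncSymbol_of_notMem hξ
  rw [← evol_sub (hi (hab.trans hbc)) (hi hab)]
  congr 1
  ext ξ
  rw [← truncSymbol_add f β ε hab hbc ξ]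
  ring

theorem truncSymbol_self (f : SchwartzMap (ℝ × ℝ) ℂ) (β : ℝ) {ε : ℝ} (hε : 0 < ε) (s : ℝ) :
    truncSymbol f β ε s s = fun _ => 0 := by
  obtain ⟨B, -, hB⟩ := exists_truncSymbol_bound f β hε
  ext ξ
  simpa using hB s s ξ le_rfl

/-- The Duhamel term is approximated by its piecewise versions over uniform partitions. -/
theorem enorm_evol_le_liminf_stepSum (f : SchwartzMap (ℝ × ℝ) ℂ) (α β : ℝ) {ε : ℝ} (hε : 0 < ε)
    {T t : ℝ} (ht : t ∈ Ioc 0 T) (x : ℝ) :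
    ‖evol α (truncSymbol f β ε 0 t) x t‖ₑ ≤ liminf (fun n : ℕ =>
      stepSum (fun k => k * (T / (n + 1)))
        (fun k => evol α (truncSymbol f β ε 0 (k * (T / (n + 1))))) 0 (n + 1) x t) atTop := by
  have hT : 0 < T := ht.1.trans_le ht.2
  obtain ⟨B, hBtop, hB⟩ := exists_evol_truncSymbol_bound f α β hε
  have hlim : Tendsto (fun n : ℕ => ENNReal.ofReal (T / (n + 1)) * B) atTop (𝓝 0) := by
    have h1 : Tendsto (fun n : ℕ => T / ((n : ℝ) + 1)) atTop (𝓝 0) :=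
      tendsto_const_nhds.div_atTop
        (tendsto_atTop_add_const_right _ _ tendsto_natCast_atTop_atTop)
    have h2 := ENNReal.Tendsto.mul_const (ENNReal.tendsto_ofReal h1) (Or.inr hBtop)
    simpa using h2
  rw [← ENNReal.liminf_add_of_right_tendsto_zero hlim]
  refine le_liminf_of_le (by isBoundedDefault) (Eventually.of_forall fun n => ?_)
  set δ : ℝ := T / (n + 1) with hδ
  have hδ0 : 0 < δ := by positivity
  have hδT : (n + 1) * δ = T := by rw [hδ]; field_simp
  obtain ⟨k, hk1, hk2⟩ : ∃ k : ℕ, k * δ < t ∧ t ≤ (k + 1) * δ := by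
    have hc : 0 < ⌈t / δ⌉₊ := Nat.ceil_pos.2 (div_pos ht.1 hδ0)
    refine ⟨⌈t / δ⌉₊ - 1, ?_, ?_⟩
    · have : ((⌈t / δ⌉₊ - 1 : ℕ) : ℝ) < t / δ := Nat.lt_ceil.1 (by omega)
      rwa [lt_div_iff₀ hδ0] at this
    · have := Nat.le_ceil (t / δ)
      rw [div_le_iff₀ hδ0] at this
      rwa [Nat.cast_sub hc, Nat.cast_one, sub_add_cancel]
  have hkn : k < n + 1 := by
    by_contra hcon
    have : ((n + 1 : ℕ) : ℝ) ≤ k := Nat.cast_le.2 (not_lt.1 hcon)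
    push_cast at this
    have := mul_le_mul_of_nonneg_right this hδ0.le
    linarith [ht.2]
  have hmem : t ∈ Ioc ((k : ℝ) * δ) (((k + 1 : ℕ) : ℝ) * δ) := ⟨hk1, by push_cast; exact hk2⟩
  have hk0 : 0 ≤ (k : ℝ) * δ := by positivity
  have hz : evol α (truncSymbol f β ε 0 (((0 : ℕ) : ℝ) * δ)) x t = 0 := by
    rw [Nat.cast_zero, zero_mul, truncSymbol_self f β hε]
    simp [evol, powMul]
  have hstep : ‖evol α (truncSymbol f β ε 0 (k * δ)) x t‖ₑ ≤ stepSum (fun k => k * δ)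
      (fun k => evol α (truncSymbol f β ε 0 (k * δ))) 0 (n + 1) x t := by
    refine le_trans (le_of_eq ?_) (Finset.single_le_sum (fun _ _ => zero_le)
      (Finset.mem_Ico.2 ⟨Nat.zero_le k, hkn⟩))
    simp only [indicator_of_mem hmem, hz, sub_zero]
  have hsub := evol_truncSymbol_sub f α β hε hk0 hk1.le x t
  rw [sub_eq_iff_eq_add'] at hsub
  rw [hsub]
  refine (enorm_add_le _ _).trans (add_le_add hstep ((hB _ _ x t hk1.le).trans ?_))
  exact mul_le_mul' (ENNReal.ofReal_le_ofReal (by linarith)) le_rfl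


theorem HomEst.mixedNorm_evol_truncSymbol_le {α β ν₁ ν₂ : ℝ} {p₁ q₁ p q p' q' : ℝ≥0∞}
    {C₁ C₂ : ℝ≥0} (H₁ : HomEst α ν₁ p₁ q₁ C₁) (H₂ : HomEst β ν₂ p q C₂)
    (hp : 1 / p' = 1 - 1 / p) (hp1 : 1 ≤ p) (hq : 1 / q' = 1 - 1 / q) (hq1 : 1 ≤ q)
    {ν' : ℝ} (hν' : 0 ≤ ν') (hν'₂ : ν' ≤ ν₂) (f : SchwartzMap (ℝ × ℝ) ℂ) {ε T a b : ℝ}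
    (hε : 0 < ε) (ha : 0 ≤ a) (hab : a ≤ b) (hbT : b ≤ T) (hT : 0 < T) :
    mixedNorm p₁ q₁ (volume.restrict (Ioc 0 T))
        (fun x t => ‖evol α (truncSymbol f β ε a b) x t‖ₑ)
      ≤ C₁ * C₂ * ENNReal.ofReal (T ^ (ν₁ + ν₂ - ν')) * (ENNReal.ofReal (b - a) ^ ν'
        * mixedNorm p' q' (volume.restrict (Ioc a b)) (fun x t => ‖f (x, t)‖ₑ)) := by
  have hL : 0 ≤ b - a := sub_nonneg.2 hab
  refine (H₁ ε hε T hT _ (measurable_truncSymbol f β ε a b) (memLp_truncSymbol f β hε hab)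
    fun ξ hξ => truncSymbol_of_notMem hξ).trans ?_
  refine (mul_le_mul_right (H₂.eLpNorm_truncSymbol_le hp hp1 hq hq1 f hε hab) _).trans ?_
  have h1 : (b - a) ^ ν₂ ≤ T ^ (ν₂ - ν') * (b - a) ^ ν' := by
    have e : ν₂ = (ν₂ - ν') + ν' := by ring
    calc (b - a) ^ ν₂ = (b - a) ^ (ν₂ - ν') * (b - a) ^ ν' := by
          nth_rewrite 1 [e]
          exact Real.rpow_add_of_nonneg hL (sub_nonneg.2 hν'₂) hν'
      _ ≤ T ^ (ν₂ - ν') * (b - a) ^ ν' := mul_le_mul_of_nonneg_right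
          (Real.rpow_le_rpow hL (by linarith) (sub_nonneg.2 hν'₂)) (Real.rpow_nonneg hL _)
  have h2 : ENNReal.ofReal ((b - a) ^ ν₂)
      ≤ ENNReal.ofReal (T ^ (ν₂ - ν')) * ENNReal.ofReal (b - a) ^ ν' := by
    rw [ENNReal.ofReal_rpow_of_nonneg hL hν', ← ENNReal.ofReal_mul (by positivity)]
    exact ENNReal.ofReal_le_ofReal h1
  have h3 : ENNReal.ofReal (T ^ (ν₁ + ν₂ - ν'))
      = ENNReal.ofReal (T ^ ν₁) * ENNReal.ofReal (T ^ (ν₂ - ν')) := by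
    rw [← ENNReal.ofReal_mul (by positivity), ← Real.rpow_add hT]
    congr 2
    ring
  set M := mixedNorm p' q' (volume.restrict (Ioc a b)) (fun x t => ‖f (x, t)‖ₑ)
  calc C₁ * ENNReal.ofReal (T ^ ν₁) * (C₂ * ENNReal.ofReal ((b - a) ^ ν₂) * M)
      ≤ C₁ * ENNReal.ofReal (T ^ ν₁)
          * (C₂ * (ENNReal.ofReal (T ^ (ν₂ - ν')) * ENNReal.ofReal (b - a) ^ ν') * M) := by gcongr
    _ = _ := by rw [h3]; ring

theorem ne_zero_of_conj {p p' : ℝ≥0∞} (hp : 1 / p' = 1 - 1 / p) : p' ≠ 0 := by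
  rintro rfl
  rw [ENNReal.div_zero one_ne_zero] at hp
  exact absurd (hp.symm ▸ (tsub_le_self : (1 : ℝ≥0∞) - 1 / p ≤ 1)) (by simp)

/-- Duhamel estimate in `L^p_x L^q_T` by the Christ–Kiselev argument. -/
theorem HomEst.LpLq_duhamel_le {α β ν₁ ν₂ : ℝ} {p₁ q₁ p q p' q' : ℝ≥0∞}
    {C₁ C₂ : ℝ≥0} (H₁ : HomEst α ν₁ p₁ q₁ C₁) (H₂ : HomEst β ν₂ p q C₂)
    (hp₁ : 1 ≤ p₁) (hq₁ : 1 ≤ q₁)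
    (hp : 1 / p' = 1 - 1 / p) (hp1 : 1 ≤ p) (hq : 1 / q' = 1 - 1 / q) (hq1 : 1 ≤ q)
    {ν' m s : ℝ} (hν' : 0 ≤ ν') (hν'₂ : ν' ≤ ν₂) (hm : 0 < m) (hpm : p' ≤ ENNReal.ofReal m)
    (hqm : q' ≤ ENNReal.ofReal m) (hs : 0 < s) (hsm : 1 / s < ν' + 1 / m)
    (hsp : ENNReal.ofReal s ≤ p₁) (hsq : ENNReal.ofReal s ≤ q₁) :
    ∃ C : ℝ≥0, ∀ (f : SchwartzMap (ℝ × ℝ) ℂ) (T : ℝ), 0 < T →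
      LpLq p₁ q₁ T (sliceOp (Dop (α + β)) (duhamel (fun x t => f (x, t))))
        ≤ C * ENNReal.ofReal (T ^ (ν₁ + ν₂)) * LpLq p' q' T (fun x t => f (x, t)) := by
  set r : ℝ := (ν' + 1 / m)⁻¹ with hr
  have hd : 0 < ν' + 1 / m := by positivity
  have hr0 : 0 < r := inv_pos.2 hd
  have hr1 : 1 / r = ν' + 1 / m := by rw [hr, one_div, inv_inv]
  have hrs : r < s := (one_div_lt_one_div hs hr0).1 (by rwa [hr1])
  have hsum : ν' * r + r / m = 1 := by
    have : ν' * r + r / m = r * (ν' + 1 / m) := by ring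
    rw [this, hr, inv_mul_cancel₀ hd.ne']
  refine ⟨Real.toNNReal (2 / (1 - 2 ^ (1 / s - 1 / r))) * (C₁ * C₂), fun f T hT => ?_⟩
  set K := ENNReal.ofReal (2 / (1 - 2 ^ (1 / s - 1 / r))) with hK
  set M : ℝ → ℝ → ℝ≥0∞ := fun a b =>
    mixedNorm p' q' (volume.restrict (Ioc a b)) fun x t => ‖f (x, t)‖ₑ with hM
  obtain ⟨D, hD⟩ : ∃ D : ℝ≥0∞, D = C₁ * C₂ * ENNReal.ofReal (T ^ (ν₁ + ν₂ - ν')) := ⟨_, rfl⟩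
  have hfm : Measurable (Function.uncurry fun x t => ‖f (x, t)‖ₑ) :=
    (f.continuous.enorm.measurable : Measurable fun z : ℝ × ℝ => ‖f z‖ₑ)
  have hMs : ∀ {a b c : ℝ}, a ≤ b → b ≤ c → M a b ^ m + M b c ^ m ≤ M a c ^ m := fun h1 h2 =>
    mixedNorm_restrict_superadd hm (ne_zero_of_conj hp) (ne_zero_of_conj hq) hpm hqm hfm h1 h2
  set w : ℝ → ℝ → ℝ≥0∞ := fun a b =>
    D ^ r * (ENNReal.ofReal (b - a) ^ (ν' * r) * (M a b ^ m) ^ (r / m)) with hw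
  have hws : ∀ {a b c : ℝ}, a ≤ b → b ≤ c → w a b + w b c ≤ w a c := fun {a b c} h1 h2 => by
    simp only [hw]
    rw [← mul_add]
    refine mul_le_mul_right ((two_term_holder (by positivity) (by positivity) hsum
      _ _ _ _).trans ?_) _
    rw [← ENNReal.ofReal_add (sub_nonneg.2 h1) (sub_nonneg.2 h2)]
    refine mul_le_mul' (le_of_eq ?_) (ENNReal.rpow_le_rpow (hMs h1 h2) (by positivity))
    congr 2
    ring
  have hwr : ∀ a b, w a b ^ (1 / r) = D * (ENNReal.ofReal (b - a) ^ ν' * M a b) := fun a b => by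
    simp only [hw]
    rw [ENNReal.mul_rpow_of_nonneg _ _ (by positivity),
      ENNReal.mul_rpow_of_nonneg _ _ (by positivity), ← ENNReal.rpow_mul, ← ENNReal.rpow_mul,
      ← ENNReal.rpow_mul, ← ENNReal.rpow_mul, mul_one_div_cancel hr0.ne', ENNReal.rpow_one]
    have e1 : ν' * r * (1 / r) = ν' := by field_simp
    have e2 : m * (r / m * (1 / r)) = 1 := by field_simp
    rw [e1, e2, ENNReal.rpow_one]
  have hi : ∀ {ε b : ℝ}, 0 < ε → 0 ≤ b → Integrable (powMul α (truncSymbol f β ε 0 b)) :=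
    fun hε h => integrable_powMul α hε (measurable_truncSymbol f β _ _ _)
      (memLp_truncSymbol f β hε h) fun ξ hξ => truncSymbol_of_notMem hξ
  have hmeas : ∀ {ε b : ℝ}, 0 < ε → 0 ≤ b →
      Measurable (Function.uncurry (evol α (truncSymbol f β ε 0 b))) :=
    fun hε h => (continuous_evol (hi hε h)).measurable
  set F : ℝ → ℕ → ℝ → ℝ → ℝ≥0∞ := fun ε n => stepSum (fun k => k * (T / (n + 1)))
    (fun k => evol α (truncSymbol f β ε 0 (k * (T / (n + 1))))) 0 (n + 1) with hF
  have hFm : ∀ ε n, 0 < ε → Measurable (Function.uncurry (F ε n)) := fun ε n hε =>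
    measurable_stepSum (fun k => hmeas hε (by positivity)) _ _
  have hband : ∀ ε, 0 < ε → mixedNorm p₁ q₁ (volume.restrict (Ioc 0 T))
      (fun x t => liminf (fun n => F ε n x t) atTop) ≤ K * w 0 T ^ (1 / r) := by
    intro ε hε
    refine mixedNorm_le_of_le_liminf (c := fun _ => K * w 0 T ^ (1 / r)) (fun n => hFm ε n hε)
      (fun x => Eventually.of_forall fun t => le_rfl) (fun n => ?_) tendsto_const_nhds
    have hδ : 0 ≤ T / ((n : ℝ) + 1) := by positivity
    have hmono : Monotone fun k : ℕ => (k : ℝ) * (T / ((n : ℝ) + 1)) := fun i j hij =>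
      mul_le_mul_of_nonneg_right (Nat.cast_le.2 hij) hδ
    have hend : (((n + 1 : ℕ) : ℝ)) * (T / ((n : ℝ) + 1)) = T := by
      push_cast; field_simp
    have := mixedNorm_stepSum_le (ν := volume.restrict (Ioc 0 T)) hp₁ hq₁ hr0 hrs hsp hsq hmono
      (U := fun k => evol α (truncSymbol f β ε 0 (k * (T / (n + 1)))))
      (fun k => hmeas hε (by positivity))
      (ω := fun a b => w (a * (T / (n + 1))) (b * (T / (n + 1))))
      (fun a b c h1 h2 => hws (hmono h1) (hmono h2)) (N := n + 1)
      (fun a b h1 h2 => ?_) 0 (n + 1) (Nat.zero_le _) le_rfl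
    · simpa only [hend, Nat.cast_zero, zero_mul] using this
    · rw [hwr, hD]
      have ha : (0 : ℝ) ≤ a * (T / (n + 1)) := by positivity
      simp only [evol_truncSymbol_sub f α β hε ha (hmono h1)]
      exact H₁.mixedNorm_evol_truncSymbol_le H₂ hp hp1 hq hq1 hν' hν'₂ f hε ha (hmono h1)
        ((hmono h2).trans_eq hend) hT
  have hmain : mixedNorm p₁ q₁ (volume.restrict (Ioc 0 T)) (fun x t =>
      ‖sliceOp (Dop (α + β)) (duhamel fun x t => f (x, t)) x t‖ₑ) ≤ K * w 0 T ^ (1 / r) := by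
    have hpos : ∀ n : ℕ, (0 : ℝ) < 1 / ((n : ℝ) + 1) := fun n => by positivity
    refine mixedNorm_le_of_le_liminf (c := fun _ => K * w 0 T ^ (1 / r)) (fun n => ?_)
      (fun x => ?_) (fun n => hband _ (hpos n)) tendsto_const_nhds
    · exact Measurable.liminf (f := fun j (z : ℝ × ℝ) => F (1 / ((n : ℝ) + 1)) j z.1 z.2)
        fun j => hFm _ j (hpos n)
    · filter_upwards [ae_restrict_mem measurableSet_Ioc] with t ht
      exact (enorm_slice_le_liminf f α β x ht.1.le).trans (liminf_le_liminf
        (Eventually.of_forall fun n => enorm_evol_le_liminf_stepSum f α β (hpos n) ht x))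
  refine (LpLq_le_mixedNorm _ _ _ _).trans (hmain.trans (le_of_eq ?_))
  rw [hwr, LpLq_schwartz, sub_zero, ENNReal.coe_mul, ENNReal.coe_mul, hD]
  have e1 : ENNReal.ofReal (T ^ (ν₁ + ν₂))
      = ENNReal.ofReal (T ^ (ν₁ + ν₂ - ν')) * ENNReal.ofReal T ^ ν' := by
    rw [ENNReal.ofReal_rpow_of_nonneg hT.le hν', ← ENNReal.ofReal_mul (by positivity),
      ← Real.rpow_add hT, sub_add_cancel]
  rw [e1]
  change K * _ = K * _ * _ * M 0 T
  ring

/-- Fourier-side wave packet at unit frequency with bandwidth `δ`. -/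
def packet (δ : ℝ) : ℝ → ℂ := (Icc 1 (1 + δ)).indicator fun _ => 1

theorem measurable_packet (δ : ℝ) : Measurable (packet δ) :=
  measurable_const.indicator measurableSet_Icc

theorem eLpNorm_packet (δ : ℝ) :
    eLpNorm (packet δ) 2 volume = ENNReal.ofReal δ ^ (1 / 2 : ℝ) := by
  rw [packet, eLpNorm_indicator_const measurableSet_Icc (by simp) (by simp)]
  simp

theorem memLp_packet (δ : ℝ) : MemLp (packet δ) 2 volume :=
  ⟨(measurable_packet δ).aestronglyMeasurable, by
    rw [eLpNorm_packet]; exact ENNReal.rpow_lt_top_of_nonneg (by norm_num) ENNReal.ofReal_ne_top⟩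

theorem packet_of_notMem_band {δ : ℝ} (hδ : δ ≤ 1) {ξ : ℝ} (hξ : ξ ∉ band (1 / 2)) :
    packet δ ξ = 0 := by
  refine indicator_of_notMem (fun h => hξ ?_) _
  rw [band, mem_ofPred_eq, abs_of_nonneg (by linarith [h.1])]
  constructor
  · linarith [h.1]
  · norm_num; linarith [h.2]

theorem exists_le_enorm_evol_packet (α : ℝ) : ∃ c : ℝ, 0 < c ∧ ∀ δ x t : ℝ, 0 < δ → δ ≤ 1 → 0 ≤ t →
    δ * |2 * π * x + 2 * t| + t * δ ^ 2 ≤ 1 →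
      ENNReal.ofReal (c * δ) ≤ ‖evol α (packet δ) x t‖ₑ := by
  refine ⟨Real.cos 1 * min 1 (2 ^ α), mul_pos Real.cos_one_pos (by positivity),
    fun δ x t hδ hδ1 ht hphase => ?_⟩
  rw [← ofReal_norm]
  refine ENNReal.ofReal_le_ofReal ?_
  have hintegrable : IntegrableOn (fun ξ => wave x t ξ * ((|ξ| ^ α : ℝ) : ℂ)) (Icc 1 (1 + δ)) := by
    refine ContinuousOn.integrableOn_Icc (ContinuousOn.mul ?_ ?_)
    · exact (continuous_const.wave continuous_const continuous_id).continuousOn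
    · exact Complex.continuous_ofReal.comp_continuousOn
        (continuous_abs.continuousOn.rpow_const fun ξ hξ => Or.inl (by
          rw [abs_ne_zero]; linarith [hξ.1]))
  have he : evol α (packet δ) x t
      = ∫ ξ in Icc 1 (1 + δ), wave x t ξ * ((|ξ| ^ α : ℝ) : ℂ) := by
    rw [evol, ← integral_indicator measurableSet_Icc]
    congr 1
    ext ξ
    by_cases h : ξ ∈ Icc 1 (1 + δ) <;> simp [packet, powMul, h]
  have hre : (wave (-x) (-t) 1 * evol α (packet δ) x t).re
      = ∫ ξ in Icc 1 (1 + δ), (wave (-x) (-t) 1 * (wave x t ξ * ((|ξ| ^ α : ℝ) : ℂ))).re := by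
    rw [he, ← integral_const_mul]
    exact (integral_re (hintegrable.const_mul _)).symm
  have hpt : ∀ ξ ∈ Icc 1 (1 + δ), Real.cos 1 * min 1 (2 ^ α)
      ≤ (wave (-x) (-t) 1 * (wave x t ξ * ((|ξ| ^ α : ℝ) : ℂ))).re := by
    intro ξ hξ
    have hξ0 : 0 ≤ ξ := by linarith [hξ.1]
    have e : wave (-x) (-t) 1 * (wave x t ξ * ((|ξ| ^ α : ℝ) : ℂ))
        = Complex.exp ((((ξ - 1) * (2 * π * x + 2 * t) + t * (ξ - 1) ^ 2 : ℝ) : ℂ) * Complex.I)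
          * ((|ξ| ^ α : ℝ) : ℂ) := by
      rw [← mul_assoc, wave, wave, ← Complex.exp_add, abs_of_nonneg hξ0, abs_one]
      congr 2
      push_cast
      ring
    rw [e, Complex.re_mul_ofReal, Complex.exp_ofReal_mul_I_re]
    have h0 : 0 ≤ ξ - 1 := by linarith [hξ.1]
    have h1 : ξ - 1 ≤ δ := by linarith [hξ.2]
    have hθ : |(ξ - 1) * (2 * π * x + 2 * t) + t * (ξ - 1) ^ 2| ≤ 1 := by
      refine (abs_add_le _ _).trans (le_trans (add_le_add ?_ ?_) hphase)
      · rw [abs_mul, abs_of_nonneg h0]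
        exact mul_le_mul_of_nonneg_right h1 (abs_nonneg _)
      · rw [abs_of_nonneg (by positivity)]
        gcongr
    have hcos : Real.cos 1 ≤ Real.cos ((ξ - 1) * (2 * π * x + 2 * t) + t * (ξ - 1) ^ 2) := by
      rw [← Real.cos_abs ((ξ - 1) * (2 * π * x + 2 * t) + t * (ξ - 1) ^ 2)]
      exact Real.cos_le_cos_of_nonneg_of_le_pi (abs_nonneg _) (by linarith [pi_gt_three]) hθ
    have hw : min 1 (2 ^ α) ≤ |ξ| ^ α := by
      rw [abs_of_nonneg hξ0]
      rcases le_total 0 α with hα | hα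
      · exact (min_le_left _ _).trans (Real.one_le_rpow hξ.1 hα)
      · exact (min_le_right _ _).trans
          (Real.rpow_le_rpow_of_nonpos (by linarith) (by linarith) hα)
    exact mul_le_mul hcos hw (by positivity) (Real.cos_one_pos.le.trans hcos)
  have hlow : Real.cos 1 * min 1 (2 ^ α) * δ ≤ (wave (-x) (-t) 1 * evol α (packet δ) x t).re := by
    rw [hre]
    have := setIntegral_mono_on (μ := volume) (s := Icc 1 (1 + δ))
      (f := fun _ => Real.cos 1 * min 1 (2 ^ α)) (integrableOn_const (by simp))
      (hintegrable.const_mul (wave (-x) (-t) 1)).re measurableSet_Icc hpt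
    simpa [hδ.le, mul_comm] using this
  refine hlow.trans ((Complex.re_le_norm _).trans (le_of_eq ?_))
  rw [norm_mul, norm_wave, one_mul]

theorem le_mixedNorm_of_le {p q : ℝ≥0∞} (hp : p ≠ 0) (hq : q ≠ 0) {ν : Measure ℝ}
    {F : ℝ → ℝ → ℝ≥0∞} {A τ : ℝ≥0∞} {S : Set ℝ} {I : ℝ → Set ℝ} (hS : MeasurableSet S)
    (hS0 : volume S ≠ 0) (hI : ∀ x, MeasurableSet (I x)) (hτ : τ ≠ 0)
    (hIτ : ∀ x ∈ S, τ ≤ ν (I x)) (hF : ∀ x ∈ S, ∀ t ∈ I x, A ≤ F x t) :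
    A * τ ^ (1 / q.toReal) * volume S ^ (1 / p.toReal) ≤ mixedNorm p q ν F := by
  have h1 : ∀ x ∈ S, A * τ ^ (1 / q.toReal) ≤ eLpNorm (F x) q ν := fun x hx => by
    have hne : ν (I x) ≠ 0 := (pos_iff_ne_zero.2 hτ |>.trans_le (hIτ x hx)).ne'
    calc A * τ ^ (1 / q.toReal) ≤ A * ν (I x) ^ (1 / q.toReal) := by
          gcongr; exact hIτ x hx
      _ = eLpNorm ((I x).indicator fun _ => A) q ν := by
          rw [eLpNorm_indicator_const' (hI x) hne hq, enorm_eq_self]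
      _ ≤ eLpNorm (F x) q ν := eLpNorm_mono_enorm fun t => by
          by_cases ht : t ∈ I x
          · simpa [ht] using hF x hx t ht
          · simp [ht]
  calc A * τ ^ (1 / q.toReal) * volume S ^ (1 / p.toReal)
      = eLpNorm (S.indicator fun _ => A * τ ^ (1 / q.toReal)) p volume := by
        rw [eLpNorm_indicator_const' hS hS0 hp, enorm_eq_self]
    _ ≤ mixedNorm p q ν F := eLpNorm_mono_enorm fun x => by
        by_cases hx : x ∈ S
        · simpa [hx] using h1 x hx
        · simp [hx]

theorem exponent_nonneg {e C : ℝ} (h : ∀ δ : ℝ, 0 < δ → δ ≤ 1 / 8 → δ ^ e ≤ C) : 0 ≤ e := by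
  by_contra! he
  have h1 : Tendsto (fun n : ℕ => (1 / ((n : ℝ) + 8)) ^ e) atTop atTop := by
    have : (fun n : ℕ => (1 / ((n : ℝ) + 8)) ^ e) = fun n : ℕ => ((n : ℝ) + 8) ^ (-e) := by
      ext n
      rw [one_div, Real.inv_rpow (by positivity), Real.rpow_neg (by positivity)]
    rw [this]
    exact (tendsto_rpow_atTop (neg_pos.2 he)).comp
      (tendsto_atTop_add_const_right _ _ tendsto_natCast_atTop_atTop)
  obtain ⟨n, hn⟩ := (h1.eventually_gt_atTop C).exists
  refine absurd (h (1 / ((n : ℝ) + 8)) (by positivity) ?_) (not_le.2 hn)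
  exact one_div_le_one_div_of_le (by norm_num) (by linarith [n.cast_nonneg (α := ℝ)])

/-- Testing a homogeneous estimate on wave packets. -/
theorem HomEst.packet_le {α ν : ℝ} {p q : ℝ≥0∞} {C : ℝ≥0} (H : HomEst α ν p q C)
    (hp : 1 ≤ p) (hq : 1 ≤ q) :
    ∃ C' : ℝ, 0 ≤ C' ∧ ∀ δ T x₀ x₁ τ : ℝ, ∀ I : ℝ → Set ℝ, 0 < δ → δ ≤ 1 → 0 < T → x₀ < x₁ → 0 < τ →
      (∀ x, MeasurableSet (I x)) → (∀ x ∈ Ioo x₀ x₁, I x ⊆ Ioc 0 T) →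
      (∀ x ∈ Ioo x₀ x₁, ENNReal.ofReal τ ≤ volume (I x)) →
      (∀ x ∈ Ioo x₀ x₁, ∀ t ∈ I x, δ * |2 * π * x + 2 * t| + t * δ ^ 2 ≤ 1) →
      δ * τ ^ (1 / q.toReal) * (x₁ - x₀) ^ (1 / p.toReal) ≤ C' * T ^ ν * δ ^ (1 / 2 : ℝ) := by
  obtain ⟨c, hc, hlow⟩ := exists_le_enorm_evol_packet α
  refine ⟨C / c, by positivity, fun δ T x₀ x₁ τ I hδ hδ1 hT hx hτ hI hIT hIτ hph => ?_⟩
  have hx' : 0 < x₁ - x₀ := sub_pos.2 hx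
  have h1 := H (1 / 2) (by norm_num) T hT (packet δ) (measurable_packet δ) (memLp_packet δ)
    fun ξ hξ => packet_of_notMem_band hδ1 hξ
  have h2 := le_mixedNorm_of_le (p := p) (q := q) (by positivity) (by positivity)
    (ν := volume.restrict (Ioc 0 T)) (F := fun x t => ‖evol α (packet δ) x t‖ₑ)
    (A := ENNReal.ofReal (c * δ)) (τ := ENNReal.ofReal τ) (measurableSet_Ioo (a := x₀) (b := x₁))
    (by simpa using hx) hI (by simpa using hτ)
    (fun x hx => by rw [Measure.restrict_eq_self _ (hIT x hx)]; exact hIτ x hx)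
    (fun x hx t ht => hlow δ x t hδ hδ1 (hIT x hx ht).1.le (hph x hx t ht))
  have h3 := h2.trans h1
  rw [Real.volume_Ioo, eLpNorm_packet, ENNReal.ofReal_rpow_of_pos hτ,
    ENNReal.ofReal_rpow_of_pos hx', ENNReal.ofReal_rpow_of_pos hδ,
    ← ENNReal.ofReal_mul (by positivity), ← ENNReal.ofReal_mul (by positivity),
    ← ENNReal.ofReal_coe_nnreal, ← ENNReal.ofReal_mul (by positivity),
    ← ENNReal.ofReal_mul (by positivity), ENNReal.ofReal_le_ofReal_iff (by positivity)] at h3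
  rw [div_mul_eq_mul_div, div_mul_eq_mul_div, le_div_iff₀ hc]
  linarith

/-- Wave packets before they move: the bound over the box `|x| ≲ δ⁻¹`, `t ≤ T ≲ δ⁻¹`. -/
theorem HomEst.standing_packet_le {α ν : ℝ} {p q : ℝ≥0∞} {C : ℝ≥0} (H : HomEst α ν p q C)
    (hp : 1 ≤ p) (hq : 1 ≤ q) :
    ∃ C' : ℝ, 0 ≤ C' ∧ ∀ δ T : ℝ, 0 < δ → δ ≤ 1 → 0 < T → T ≤ 1 / (8 * δ) →
      δ * T ^ (1 / q.toReal) * (1 / (16 * δ)) ^ (1 / p.toReal)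
        ≤ C' * T ^ ν * δ ^ (1 / 2 : ℝ) := by
  obtain ⟨C', hC', h⟩ := H.packet_le hp hq
  refine ⟨C', hC', fun δ T hδ hδ1 hT hTδ => ?_⟩
  have hTδ' : T * δ ≤ 1 / 8 := by
    rw [le_div_iff₀ (by positivity)] at hTδ
    linarith
  have hpos : 0 < 1 / (32 * δ) := by positivity
  have := h δ T (-(1 / (32 * δ))) (1 / (32 * δ)) T (fun _ => Ioc 0 T) hδ hδ1 hT (by linarith) hT
    (fun _ => measurableSet_Ioc) (fun _ _ => Subset.rfl) (fun _ _ => by simp)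
    fun x hx t ht => ?_
  · convert this using 3
    field_simp
    norm_num
  · have hxδ : |x| * δ ≤ 1 / 32 := by
      have := abs_lt.2 hx
      rw [lt_div_iff₀ (by positivity)] at this
      linarith
    have htδ : t * δ ≤ 1 / 8 := (mul_le_mul_of_nonneg_right ht.2 hδ.le).trans hTδ'
    have h1 : |2 * π * x + 2 * t| ≤ 2 * π * |x| + 2 * t := by
      refine (abs_add_le _ _).trans (le_of_eq ?_)
      rw [abs_mul (2 * π), abs_of_nonneg (show 0 ≤ 2 * π by positivity),
        abs_of_nonneg (show 0 ≤ 2 * t by linarith [ht.1])]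
    have h2 : t * δ ^ 2 ≤ 1 / 8 := by nlinarith [mul_pos ht.1 hδ]
    have h3 : π * (|x| * δ) ≤ 4 * (1 / 32) :=
      mul_le_mul Real.pi_le_four hxδ (by positivity) (by norm_num)
    nlinarith [mul_le_mul_of_nonneg_left h1 hδ.le]

theorem HomEst.le_time_exponent {α ν : ℝ} {p q : ℝ≥0∞} {C : ℝ≥0} (H : HomEst α ν p q C)
    (hp : 1 ≤ p) (hq : 1 ≤ q) : ν ≤ 1 / q.toReal := by
  obtain ⟨C', hC', h⟩ := H.standing_packet_le hp hq
  set k : ℝ := (1 / 16) ^ (1 / p.toReal) with hk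
  have hk0 : 0 < k := by positivity
  suffices 0 ≤ 1 / q.toReal - ν by linarith
  refine exponent_nonneg (C := C' / k) fun T hT hT8 => ?_
  have := h 1 T one_pos le_rfl hT (by linarith)
  rw [one_mul, mul_one, Real.one_rpow, mul_one, ← hk] at this
  rw [le_div_iff₀ hk0, Real.rpow_sub hT, div_mul_eq_mul_div, div_le_iff₀ (by positivity)]
  exact this

theorem HomEst.scaling_exponent {α ν : ℝ} {p q : ℝ≥0∞} {C : ℝ≥0} (H : HomEst α ν p q C)
    (hp : 1 ≤ p) (hq : 1 ≤ q) : 1 / p.toReal + 1 / q.toReal - 1 / 2 ≤ ν := by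
  obtain ⟨C', hC', h⟩ := H.standing_packet_le hp hq
  set a := 1 / p.toReal
  set b := 1 / q.toReal
  suffices 0 ≤ 1 / 2 - a - b + ν by linarith
  refine exponent_nonneg (C := C' * 8 ^ (b - ν) * 16 ^ a) fun δ hδ hδ8 => ?_
  have := h δ (1 / (8 * δ)) hδ (by linarith) (by positivity) le_rfl
  have e : ∀ c e : ℝ, 0 < c → (1 / (c * δ)) ^ e = c ^ (-e) * δ ^ (-e) := fun c e hc => by
    rw [one_div, ← Real.rpow_neg_eq_inv_rpow, Real.mul_rpow hc.le hδ.le]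
  rw [e 8 b (by norm_num), e 16 a (by norm_num), e 8 ν (by norm_num)] at this
  have h2 := mul_le_mul_of_nonneg_right this
    (show 0 ≤ 8 ^ b * 16 ^ a * δ ^ (ν - 1 / 2) by positivity)
  have l : δ * (8 ^ (-b) * δ ^ (-b)) * (16 ^ (-a) * δ ^ (-a)) * (8 ^ b * 16 ^ a * δ ^ (ν - 1 / 2))
      = δ ^ (1 / 2 - a - b + ν) := by
    have e1 : δ ^ (1 / 2 - a - b + ν) = δ * δ ^ (-b) * δ ^ (-a) * δ ^ (ν - 1 / 2) := by
      nth_rewrite 2 [← Real.rpow_one δ]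
      rw [← Real.rpow_add hδ, ← Real.rpow_add hδ, ← Real.rpow_add hδ]
      congr 1; ring
    rw [e1, Real.rpow_neg (show (0 : ℝ) ≤ 8 by norm_num) b,
      Real.rpow_neg (show (0 : ℝ) ≤ 16 by norm_num) a]
    field_simp
  have r : C' * (8 ^ (-ν) * δ ^ (-ν)) * δ ^ (1 / 2 : ℝ) * (8 ^ b * 16 ^ a * δ ^ (ν - 1 / 2))
      = C' * 8 ^ (b - ν) * 16 ^ a := by
    have e1 : (8 : ℝ) ^ (b - ν) = 8 ^ (-ν) * 8 ^ b := by
      rw [← Real.rpow_add (by norm_num)]; congr 1; ring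
    have e2 : δ ^ (-ν) * δ ^ (1 / 2 : ℝ) * δ ^ (ν - 1 / 2) = 1 := by
      rw [← Real.rpow_add hδ, ← Real.rpow_add hδ, ← Real.rpow_zero δ]; congr 1; ring
    rw [e1]
    linear_combination (C' * 8 ^ (-ν) * 8 ^ b * 16 ^ a) * e2
  rwa [l, r] at h2

/-- Travelling wave packets: the maximal function estimate needs `p ≥ 4`. -/
theorem HomEst.maximal_exponent {α : ℝ} {p : ℝ≥0∞} {C : ℝ≥0} (H : HomEst α 0 p ∞ C)
    (hp : 1 ≤ p) : 1 / p.toReal ≤ 1 / 4 := by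
  obtain ⟨C', hC', h⟩ := H.packet_le hp le_top
  set a := 1 / p.toReal
  suffices 0 ≤ 1 / 2 - 2 * a by linarith
  refine exponent_nonneg (C := C' * 16 ^ a) fun δ hδ hδ8 => ?_
  have hδ2 : 1 / (4 * δ) ≤ 1 / (4 * δ ^ 2) :=
    one_div_le_one_div_of_le (by positivity) (by nlinarith)
  have e4 : 1 / (4 * δ ^ 2) = 4 * (1 / (16 * δ ^ 2)) := by field_simp; norm_num
  have hpos : 0 < 1 / (16 * δ ^ 2) := by positivity
  have := h δ (8 * (1 / (16 * δ ^ 2))) (-(1 / (16 * δ ^ 2))) 0 (1 / (4 * δ))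
    (fun x => Ioo (-(π * x)) (-(π * x) + 1 / (4 * δ))) hδ (by linarith) (by positivity)
    (by linarith) (by positivity) (fun _ => measurableSet_Ioo) (fun x hx t ht => ?_)
    (fun _ _ => by simp [Real.volume_Ioo]) fun x hx t ht => ?_
  · rw [ENNReal.toReal_top, div_zero, Real.rpow_zero, Real.rpow_zero, mul_one, mul_one, zero_sub,
      neg_neg] at this
    have e : (1 / (16 * δ ^ 2)) ^ a = 16 ^ (-a) * δ ^ (-(2 * a)) := by
      rw [one_div, ← Real.rpow_neg_eq_inv_rpow, Real.mul_rpow (by norm_num) (by positivity),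
        ← Real.rpow_natCast, ← Real.rpow_mul hδ.le]
      congr 2
      push_cast; ring
    rw [e] at this
    have h2 := mul_le_mul_of_nonneg_right this
      (show 0 ≤ 16 ^ a * δ ^ (-(1 / 2 : ℝ)) by positivity)
    have l : δ * (16 ^ (-a) * δ ^ (-(2 * a))) * (16 ^ a * δ ^ (-(1 / 2 : ℝ)))
        = δ ^ (1 / 2 - 2 * a) := by
      have e1 : δ ^ (1 / 2 - 2 * a) = δ * δ ^ (-(2 * a)) * δ ^ (-(1 / 2 : ℝ)) := by
        nth_rewrite 2 [← Real.rpow_one δ]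
        rw [← Real.rpow_add hδ, ← Real.rpow_add hδ]
        congr 1; ring
      rw [e1, Real.rpow_neg (by norm_num)]
      field_simp
    have r : C' * δ ^ (1 / 2 : ℝ) * (16 ^ a * δ ^ (-(1 / 2 : ℝ))) = C' * 16 ^ a := by
      rw [Real.rpow_neg hδ.le]
      field_simp
    rwa [l, r] at h2
  · have hx1 := hx.1
    have hx2 := hx.2
    have h1 : -(π * x) ≤ 4 * (1 / (16 * δ ^ 2)) := by nlinarith [Real.pi_le_four, Real.pi_pos]
    have h0 : 0 ≤ -(π * x) := by nlinarith [Real.pi_pos]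
    exact ⟨h0.trans_lt ht.1, by linarith [ht.2]⟩
  · have hx1 := hx.1
    have hx2 := hx.2
    have h1 : -(π * x) ≤ 4 * (1 / (16 * δ ^ 2)) := by nlinarith [Real.pi_le_four, Real.pi_pos]
    have hu0 : 0 ≤ 2 * π * x + 2 * t := by linarith [ht.1]
    have hu1 : 2 * π * x + 2 * t ≤ 2 * (1 / (4 * δ)) := by linarith [ht.2]
    have ht8 : t ≤ 8 * (1 / (16 * δ ^ 2)) := by linarith [ht.2]
    rw [abs_of_nonneg hu0]
    have g1 := mul_le_mul_of_nonneg_left hu1 hδ.le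
    have g2 := mul_le_mul_of_nonneg_right ht8 (sq_nonneg δ)
    have k1 : δ * (2 * (1 / (4 * δ))) = 1 / 2 := by field_simp; norm_num
    have k2 : 8 * (1 / (16 * δ ^ 2)) * δ ^ 2 = 1 / 2 := by field_simp; norm_num
    linarith

theorem one_div_toReal_conj {p p' : ℝ≥0∞} (hp1 : 1 ≤ p) (hp : 1 / p' = 1 - 1 / p) :
    1 / p'.toReal = 1 - 1 / p.toReal := by
  have := congrArg ENNReal.toReal hp
  rw [ENNReal.toReal_sub_of_le (by simpa using hp1) (by simp)] at this
  simpa using this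

/-- Non-homogeneous linear estimates deduced from two homogeneous estimates for
the group `V(t)` (Lemma 2.5 of the paper): if
`‖D_x^{α₁} V(t)φ‖_{L^{p₁}_x L^{q₁}_T} ≲ T^{ν₁}‖φ‖_{L²}` and
`‖D_x^{α₂} V(t)φ‖_{L^{p₂}_x L^{q₂}_T} ≲ T^{ν₂}‖φ‖_{L²}`, and `p̄₂, q̄₂` are the
conjugate exponents of `p₂, q₂`, then for all `f ∈ 𝒮(ℝ²)` one has
`‖D_x^{α₂} ∫₀ᵗ V(t-τ)f(τ)dτ‖_{L^∞_T L²_x} ≲ T^{ν₂}‖f‖_{L^{p̄₂}_x L^{q̄₂}_T}`,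
and, provided `min(p₁,q₁) > max(p̄₂,q̄₂)` or (`q₁ = ∞` and `p̄₂,q̄₂ < ∞`),
`‖D_x^{α₁+α₂} ∫₀ᵗ V(t-τ)f(τ)dτ‖_{L^{p₁}_x L^{q₁}_T} ≲ T^{ν₁+ν₂}‖f‖_{L^{p̄₂}_x L^{q̄₂}_T}`. -/
theorem nonhomogeneous_estimates
    (α₁ α₂ : ℝ) (ν₁ ν₂ : ℝ) (hν₁ : 0 ≤ ν₁) (hν₂ : 0 ≤ ν₂)
    (p₁ q₁ p₂ q₂ pb₂ qb₂ : ℝ≥0∞)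
    (hp₁ : 1 ≤ p₁) (hq₁ : 1 ≤ q₁) (hp₂ : 1 ≤ p₂) (hq₂ : 1 ≤ q₂)
    (hpb₂ : 1/pb₂ = 1 - 1/p₂) (hqb₂ : 1/qb₂ = 1 - 1/q₂)
    (h₁ : ∃ C : ℝ≥0, ∀ (φ : SchwartzMap ℝ ℂ) (T : ℝ), 0 < T →
      LpLq p₁ q₁ T (fun x t => Dop α₁ (BOGroup t ⇑φ) x)
        ≤ C * ENNReal.ofReal (T ^ ν₁) * eLpNorm ⇑φ 2 volume)
    (h₂ : ∃ C : ℝ≥0, ∀ (φ : SchwartzMap ℝ ℂ) (T : ℝ), 0 < T →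
      LpLq p₂ q₂ T (fun x t => Dop α₂ (BOGroup t ⇑φ) x)
        ≤ C * ENNReal.ofReal (T ^ ν₂) * eLpNorm ⇑φ 2 volume) :
    (∃ C : ℝ≥0, ∀ (f : SchwartzMap (ℝ × ℝ) ℂ) (T : ℝ), 0 < T →
      LqLp ∞ 2 T (sliceOp (Dop α₂) (duhamel (fun x t => f (x, t))))
        ≤ C * ENNReal.ofReal (T ^ ν₂) * LpLq pb₂ qb₂ T (fun x t => f (x, t)))
    ∧ ((min p₁ q₁ > max pb₂ qb₂ ∨ (q₁ = ∞ ∧ pb₂ ≠ ∞ ∧ qb₂ ≠ ∞)) →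
      ∃ C : ℝ≥0, ∀ (f : SchwartzMap (ℝ × ℝ) ℂ) (T : ℝ), 0 < T →
        LpLq p₁ q₁ T (sliceOp (Dop (α₁ + α₂)) (duhamel (fun x t => f (x, t))))
          ≤ C * ENNReal.ofReal (T ^ (ν₁ + ν₂)) * LpLq pb₂ qb₂ T (fun x t => f (x, t))) := by
  obtain ⟨C₁, hC₁⟩ := h₁
  obtain ⟨C₂, hC₂⟩ := h₂
  have H₁ := homEst_of_schwartz hC₁
  have H₂ := homEst_of_schwartz hC₂
  refine ⟨⟨C₂, fun f T _ => H₂.LqLp_duhamel_le hν₂ hpb₂ hp₂ hqb₂ hq₂ f⟩, fun h => ?_⟩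
  have hfin : max pb₂ qb₂ ≠ ∞ := by
    rcases h with h | ⟨-, h1, h2⟩
    · exact (lt_top_of_lt h).ne
    · exact (max_lt h1.lt_top h2.lt_top).ne
  have hm : 0 < (max pb₂ qb₂).toReal :=
    ENNReal.toReal_pos (lt_max_of_lt_left (pos_iff_ne_zero.2 (ne_zero_of_conj hpb₂))).ne' hfin
  have hpm : pb₂ ≤ ENNReal.ofReal (max pb₂ qb₂).toReal := by
    rw [ENNReal.ofReal_toReal hfin]; exact le_max_left _ _
  have hqm : qb₂ ≤ ENNReal.ofReal (max pb₂ qb₂).toReal := by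
    rw [ENNReal.ofReal_toReal hfin]; exact le_max_right _ _
  rcases h with h | ⟨rfl, -, -⟩
  · obtain ⟨s, hs1, hs2⟩ := ENNReal.lt_iff_exists_nnreal_btwn.1 h
    have hsm : (max pb₂ qb₂).toReal < s := by
      rwa [← ENNReal.toReal_lt_toReal hfin ENNReal.coe_ne_top] at hs1
    have hs' : ENNReal.ofReal s ≤ min p₁ q₁ := by
      rw [ENNReal.ofReal_coe_nnreal]; exact hs2.le
    exact H₁.LpLq_duhamel_le H₂ hp₁ hq₁ hpb₂ hp₂ hqb₂ hq₂ le_rfl hν₂ hm hpm hqm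
      (hm.trans hsm) (by rw [zero_add]; exact one_div_lt_one_div_of_lt hm hsm)
      (hs'.trans (min_le_left _ _)) (hs'.trans (min_le_right _ _))
  · obtain rfl : ν₁ = 0 :=
      le_antisymm (by simpa using H₁.le_time_exponent hp₁ hq₁) hν₁
    have h4 : ENNReal.ofReal 4 ≤ p₁ := by
      by_cases hp : p₁ = ∞
      · simp [hp]
      · have := H₁.maximal_exponent hp₁
        have h0 : 0 < p₁.toReal := ENNReal.toReal_pos (by positivity) hp
        exact ENNReal.ofReal_le_of_le_toReal ((one_div_le_one_div h0 (by norm_num)).1 this)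
    have hsc := H₂.scaling_exponent hp₂ hq₂
    have ha : 0 ≤ 1 / p₂.toReal := by positivity
    have hb : 0 ≤ 1 / q₂.toReal := by positivity
    have hν' : 1 / 2 - 1 / (max pb₂ qb₂).toReal ≤ ν₂ := by
      rcases max_choice pb₂ qb₂ with hmax | hmax <;> rw [hmax]
      · rw [one_div_toReal_conj hp₂ hpb₂]; linarith
      · rw [one_div_toReal_conj hq₂ hqb₂]; linarith
    exact H₁.LpLq_duhamel_le H₂ hp₁ hq₁ hpb₂ hp₂ hqb₂ hq₂ (le_max_left 0 _) (max_le hν₂ hν')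
      hm hpm hqm four_pos
      (by linarith [le_max_right 0 (1 / 2 - 1 / (max pb₂ qb₂).toReal)]) h4 le_top

end
end

section
/- Let 0 < s < 1/2 and T > 0. For all f ∈ S(ℝ²), ‖D_x^{s+1/2} ∫_0^t V(t−τ) f(τ) dτ‖_{L^∞_x L^2_T} ≲ ‖D_x^s f‖_{L^1_T L^2_x}, with implicit constant independent of f and T. -/
open MeasureTheory Real Set Filter
open scoped FourierTransform ENNReal NNReal Topology

noncomputable section

/-- The Fourier integral of a function in `L¹ ∩ L²` agrees almost everywhere with its `L²` Fourier
transform. -/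
lemma fourier_ae_eq_Lp_fourier {k : ℝ → ℂ} (h1 : Integrable k) (h2 : MemLp k 2) :
    𝓕 k =ᵐ[volume] (𝓕 (h2.toLp k) : Lp (α := ℝ) ℂ 2) := by
  have hcont : Continuous (𝓕 k) :=
    VectorFourier.fourierIntegral_continuous Real.continuous_fourierChar
      (by exact (innerSL ℝ).continuous₂) h1
  refine ae_eq_of_integral_contDiff_smul_eq hcont.locallyIntegrable
    ((Lp.memLp _).locallyIntegrable (by norm_num)) fun g hg hgs => ?_
  have hgs' : HasCompactSupport (fun x => (g x : ℂ)) := hgs.comp_left (g := fun x : ℝ => (x : ℂ)) rfl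
  have hg' : ContDiff ℝ (⊤ : ℕ∞) (fun x => (g x : ℂ)) := Complex.ofRealCLM.contDiff.comp hg
  let G : SchwartzMap ℝ ℂ := hgs'.toSchwartzMap hg'
  have hG : ∀ x, G x = (g x : ℂ) := fun x => rfl
  have e := congrArg (fun u => u G) (Lp.fourier_toTemperedDistribution_eq (h2.toLp k))
  simp only [TemperedDistribution.fourier_apply, Lp.toTemperedDistribution_apply] at e
  have e1 : ∫ x, (𝓕 G) x • (h2.toLp k) x = ∫ x, (𝓕 G) x • k x := by
    refine integral_congr_ae ?_
    filter_upwards [h2.coeFn_toLp] with x hx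
    rw [hx]
  have e2 : ∫ x, (𝓕 (G : ℝ → ℂ)) x • k x = ∫ x, G x • 𝓕 k x :=
    VectorFourier.integral_fourierIntegral_smul_eq_flip (L := innerₗ ℝ)
      Real.continuous_fourierChar continuous_inner G.integrable h1 |>.trans (by
        simp; rfl)
  rw [e1, SchwartzMap.fourier_coe, e2] at e
  simpa [hG] using e

/-- Plancherel's theorem for the Fourier integral on `L¹ ∩ L²`. -/
lemma eLpNorm_fourier_eq {k : ℝ → ℂ} (h1 : Integrable k) (h2 : MemLp k 2) :
    eLpNorm (𝓕 k) 2 volume = eLpNorm k 2 volume := by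
  rw [eLpNorm_congr_ae (fourier_ae_eq_Lp_fourier h1 h2), ← eLpNorm_congr_ae h2.coeFn_toLp,
    ← Lp.enorm_def, ← Lp.enorm_def, ← ofReal_norm, ← ofReal_norm, Lp.norm_fourier_eq]

/-- Plancherel's theorem for the inverse Fourier integral on `L¹ ∩ L²`. -/
lemma eLpNorm_fourierInv_eq {k : ℝ → ℂ} (h1 : Integrable k) (h2 : MemLp k 2) :
    eLpNorm (𝓕⁻ k) 2 volume = eLpNorm k 2 volume := by
  have hcont : Continuous (𝓕 k) :=
    VectorFourier.fourierIntegral_continuous Real.continuous_fourierChar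
      (by exact (innerSL ℝ).continuous₂) h1
  have e : 𝓕⁻ k = 𝓕 k ∘ fun x => -x := by
    ext x
    rw [Real.fourierInv_eq_fourier_neg]; rfl
  rw [e, eLpNorm_comp_measurePreserving hcont.aestronglyMeasurable
    (Measure.measurePreserving_neg volume), eLpNorm_fourier_eq h1 h2]

lemma eLpNorm_two_eq_lintegral {α E : Type*} [MeasurableSpace α] [NormedAddCommGroup E]
    (μ : Measure α) (f : α → E) :
    eLpNorm f 2 μ = (∫⁻ x, ‖f x‖ₑ ^ (2 : ℝ) ∂μ) ^ (1 / 2 : ℝ) := by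
  rw [eLpNorm_eq_lintegral_rpow_enorm_toReal (by norm_num) (by norm_num)]
  simp

/-- Minkowski's integral inequality in `L²`. -/
lemma lintegral_lintegral_sq_le {α β : Type*} [MeasurableSpace α] [MeasurableSpace β]
    (μ : Measure α) (ν : Measure β) [SFinite μ] [SFinite ν] {a : α → β → ℝ≥0∞}
    (ha : Measurable (Function.uncurry a)) :
    (∫⁻ t, (∫⁻ τ, a τ t ∂μ) ^ (2 : ℝ) ∂ν) ^ (1 / 2 : ℝ)
      ≤ ∫⁻ τ, (∫⁻ t, a τ t ^ (2 : ℝ) ∂ν) ^ (1 / 2 : ℝ) ∂μ := by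
  set N : α → ℝ≥0∞ := fun τ => (∫⁻ t, a τ t ^ (2 : ℝ) ∂ν) ^ (1 / 2 : ℝ) with hN
  have hNm : Measurable N := (Measurable.lintegral_prod_right (ha.pow_const 2)).pow_const _
  have hat : ∀ t, Measurable fun τ => a τ t := fun t => ha.comp (measurable_id.prodMk measurable_const)
  have haτ : ∀ τ, Measurable (a τ) := fun τ => ha.comp measurable_prodMk_left
  have hsq : ∀ x : ℝ≥0∞, x ^ (2 : ℝ) = x * x := fun x => by
    rw [← sq, ← ENNReal.rpow_natCast]; norm_num
  have key : ∫⁻ t, (∫⁻ τ, a τ t ∂μ) ^ (2 : ℝ) ∂ν ≤ (∫⁻ τ, N τ ∂μ) ^ (2 : ℝ) := by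
    calc ∫⁻ t, (∫⁻ τ, a τ t ∂μ) ^ (2 : ℝ) ∂ν
        = ∫⁻ t, ∫⁻ τ, a τ t * ∫⁻ σ, a σ t ∂μ ∂μ ∂ν := by
          refine lintegral_congr fun t => ?_
          rw [hsq, lintegral_mul_const _ (hat t)]
      _ = ∫⁻ τ, ∫⁻ t, a τ t * ∫⁻ σ, a σ t ∂μ ∂ν ∂μ := by
          refine lintegral_lintegral_swap (Measurable.aemeasurable ?_)
          have hs : Measurable fun p : β × α => a p.2 p.1 := ha.comp measurable_swap
          exact hs.mul
            ((Measurable.lintegral_prod_left' (μ := μ) ha).comp measurable_fst)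
      _ = ∫⁻ τ, ∫⁻ σ, ∫⁻ t, a τ t * a σ t ∂ν ∂μ ∂μ := by
          refine lintegral_congr fun τ => ?_
          rw [← lintegral_lintegral_swap]
          · refine lintegral_congr fun t => ?_
            rw [lintegral_const_mul _ (hat t)]
          · have hs : Measurable fun p : β × α => a p.2 p.1 := ha.comp measurable_swap
            exact (((haτ τ).comp measurable_fst).mul hs).aemeasurable
      _ ≤ ∫⁻ τ, ∫⁻ σ, N τ * N σ ∂μ ∂μ := by
          refine lintegral_mono fun τ => lintegral_mono fun σ => ?_
          exact ENNReal.lintegral_mul_le_Lp_mul_Lq ν Real.HolderConjugate.two_two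
            (haτ τ).aemeasurable (haτ σ).aemeasurable
      _ = (∫⁻ τ, N τ ∂μ) ^ (2 : ℝ) := by
          rw [hsq, ← lintegral_mul_const _ hNm]
          exact lintegral_congr fun τ => lintegral_const_mul _ hNm
  refine (ENNReal.rpow_le_rpow key (by norm_num)).trans_eq ?_
  rw [← ENNReal.rpow_mul]; norm_num

/-- The inverse of the rescaled Benjamin–Ono dispersion relation `ξ ↦ ξ|ξ| / (2π)`. -/
def dispersionInv (η : ℝ) : ℝ :=
  if 0 ≤ η then √(2 * π * η) else -√(-(2 * π * η))

lemma measurable_dispersionInv : Measurable dispersionInv :=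
  Measurable.ite measurableSet_Ici (by fun_prop) (by fun_prop)

lemma dispersionInv_apply (ξ : ℝ) : dispersionInv (ξ * |ξ| / (2 * π)) = ξ := by
  have hπ := Real.pi_pos
  have e : 2 * π * (ξ * |ξ| / (2 * π)) = ξ * |ξ| := by field_simp
  unfold dispersionInv
  rw [e]
  rcases le_or_gt 0 ξ with h | h
  · rw [if_pos (by positivity), abs_of_nonneg h, Real.sqrt_mul_self h]
  · have : ξ * |ξ| / (2 * π) < 0 :=
      div_neg_of_neg_of_pos (mul_neg_of_neg_of_pos h (abs_pos.2 h.ne)) (by positivity)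
    rw [if_neg (not_le.2 this), abs_of_neg h]
    rw [show -(ξ * -ξ) = (-ξ) * (-ξ) by ring, Real.sqrt_mul_self (by linarith)]
    ring

lemma apply_dispersionInv (η : ℝ) : dispersionInv η * |dispersionInv η| / (2 * π) = η := by
  have hπ := Real.pi_pos
  unfold dispersionInv
  split_ifs with h
  · rw [abs_of_nonneg (Real.sqrt_nonneg _), Real.mul_self_sqrt (by positivity)]
    field_simp
  · have h0 : 0 ≤ -(2 * π * η) := by nlinarith
    rw [abs_neg, abs_of_nonneg (Real.sqrt_nonneg _), neg_mul, Real.mul_self_sqrt h0]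
    field_simp

lemma hasDerivAt_mul_abs (ξ : ℝ) : HasDerivAt (fun ξ : ℝ => ξ * |ξ|) (2 * |ξ|) ξ := by
  rcases lt_trichotomy ξ 0 with h | h | h
  · have := ((hasDerivAt_id ξ).mul (hasDerivAt_abs_neg h))
    refine this.congr_deriv ?_
    simp [abs_of_neg h]; ring
  · subst h
    rw [hasDerivAt_iff_isLittleO_nhds_zero]
    simp only [zero_add, abs_zero, mul_zero, sub_zero, smul_eq_mul]
    rw [Asymptotics.isLittleO_iff]
    intro c hc
    filter_upwards [Metric.ball_mem_nhds (0 : ℝ) hc] with x hx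
    rw [norm_mul, mul_comm, Real.norm_eq_abs, abs_abs]
    simp at hx
    exact mul_le_mul_of_nonneg_right hx.le (abs_nonneg _)
  · have := ((hasDerivAt_id ξ).mul (hasDerivAt_abs_pos h))
    refine this.congr_deriv ?_
    simp [abs_of_pos h]; ring

lemma hasDerivAt_dispersion (ξ : ℝ) :
    HasDerivAt (fun ξ : ℝ => ξ * |ξ| / (2 * π)) (|ξ| / π) ξ := by
  refine ((hasDerivAt_mul_abs ξ).div_const (2 * π)).congr_deriv ?_
  field_simp

lemma injective_dispersion : Function.Injective (fun ξ : ℝ => ξ * |ξ| / (2 * π)) :=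
  Function.LeftInverse.injective dispersionInv_apply

lemma image_dispersion : (fun ξ : ℝ => ξ * |ξ| / (2 * π)) '' univ = univ := by
  rw [image_univ, Function.Surjective.range_eq]
  exact fun η => ⟨_, apply_dispersionInv η⟩

lemma abs_abs_div_pi (ξ : ℝ) : |(|ξ| / π)| = |ξ| / π :=
  abs_of_nonneg (div_nonneg (abs_nonneg _) Real.pi_pos.le)

lemma integral_comp_dispersion (g : ℝ → ℂ) :
    ∫ η, g η = ∫ ξ : ℝ, (|ξ| / π) • g (ξ * |ξ| / (2 * π)) := by
  have := integral_image_eq_integral_abs_deriv_smul MeasurableSet.univ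
    (fun ξ _ => (hasDerivAt_dispersion ξ).hasDerivWithinAt) injective_dispersion.injOn g
  simpa only [image_dispersion, Measure.restrict_univ, abs_abs_div_pi] using this

lemma lintegral_comp_dispersion (g : ℝ → ℝ≥0∞) :
    ∫⁻ η, g η = ∫⁻ ξ : ℝ, ENNReal.ofReal (|ξ| / π) * g (ξ * |ξ| / (2 * π)) := by
  have := lintegral_image_eq_lintegral_abs_deriv_mul MeasurableSet.univ
    (fun ξ _ => (hasDerivAt_dispersion ξ).hasDerivWithinAt) injective_dispersion.injOn g
  simpa only [image_dispersion, Measure.restrict_univ, abs_abs_div_pi] using this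

lemma integrable_comp_dispersion (g : ℝ → ℂ) :
    Integrable g ↔ Integrable fun ξ : ℝ => (|ξ| / π) • g (ξ * |ξ| / (2 * π)) := by
  have := integrableOn_image_iff_integrableOn_abs_deriv_smul MeasurableSet.univ
    (fun ξ _ => (hasDerivAt_dispersion ξ).hasDerivWithinAt) injective_dispersion.injOn g
  simpa only [image_dispersion, integrableOn_univ, abs_abs_div_pi] using this

lemma abs_rpow_half_eq (ξ : ℝ) : |ξ| / π * (π * |ξ| ^ (-(1 / 2) : ℝ)) = |ξ| ^ (1 / 2 : ℝ) := by
  rcases eq_or_ne ξ 0 with rfl | h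
  · simp
  · have h' : 0 < |ξ| := abs_pos.2 h
    have : |ξ| ^ (1 / 2 : ℝ) = |ξ| ^ (1 : ℝ) * |ξ| ^ (-(1 / 2) : ℝ) := by
      rw [← Real.rpow_add h']; norm_num
    rw [this, Real.rpow_one]
    field_simp

/-- The sharp local smoothing identity for the free Benjamin–Ono group, as an upper bound. -/
lemma eLpNorm_local_smoothing_le {φ : ℝ → ℂ} (hm : Measurable φ) (h2 : MemLp φ 2)
    (h1 : Integrable fun ξ : ℝ => ((|ξ| ^ (1 / 2 : ℝ) : ℝ) : ℂ) * φ ξ) (x : ℝ) :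
    eLpNorm (fun t : ℝ => 𝓕⁻ (fun ξ : ℝ => ((|ξ| ^ (1 / 2 : ℝ) : ℝ) : ℂ) *
      (Complex.exp (Complex.I * (t * ξ * |ξ|)) * φ ξ)) x) 2 volume
      ≤ ENNReal.ofReal π ^ (1 / 2 : ℝ) * eLpNorm φ 2 volume := by
  set k₀ : ℝ → ℂ := fun ξ => ((π * |ξ| ^ (-(1 / 2) : ℝ) : ℝ) : ℂ) *
    (Complex.exp ((2 * π * (ξ * x) : ℝ) * Complex.I) * φ ξ) with hk₀
  set k : ℝ → ℂ := fun η => k₀ (dispersionInv η) with hk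
  have hk₀m : Measurable k₀ := by
    rw [hk₀]; fun_prop
  have hkm : Measurable k := hk₀m.comp measurable_dispersionInv
  have hkw : ∀ ξ : ℝ, k (ξ * |ξ| / (2 * π)) = k₀ ξ := fun ξ => by
    rw [hk]; simp only [dispersionInv_apply]
  have hsm : ∀ ξ : ℝ, (|ξ| / π) • k₀ ξ = ((|ξ| ^ (1 / 2 : ℝ) : ℝ) : ℂ) *
      (Complex.exp ((2 * π * (ξ * x) : ℝ) * Complex.I) * φ ξ) := fun ξ => by
    rw [hk₀, ← abs_rpow_half_eq, Complex.real_smul, Complex.ofReal_mul (|ξ| / π)]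
    ring
  have hk1 : Integrable k := by
    rw [integrable_comp_dispersion]
    simp only [hkw, hsm]
    refine h1.mono (by fun_prop) (Eventually.of_forall fun ξ => ?_)
    rw [norm_mul, norm_mul, norm_mul, Complex.norm_exp_ofReal_mul_I, one_mul]
  have hkl : ∫⁻ η, ‖k η‖ₑ ^ (2 : ℝ) = ENNReal.ofReal π * ∫⁻ ξ, ‖φ ξ‖ₑ ^ (2 : ℝ) := by
    rw [lintegral_comp_dispersion, ← lintegral_const_mul _ (by fun_prop)]
    have hne : ∀ᵐ ξ : ℝ, ξ ≠ 0 := by simp [ae_iff]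
    refine lintegral_congr_ae ?_
    filter_upwards [hne] with ξ hξ
    have h' : 0 < |ξ| := abs_pos.2 hξ
    have hπ := Real.pi_pos
    rw [hkw, hk₀]
    simp only [enorm_mul]
    rw [← ofReal_norm (Complex.exp _), Complex.norm_exp_ofReal_mul_I, ENNReal.ofReal_one, one_mul,
      ENNReal.mul_rpow_of_nonneg _ _ (by norm_num), ← mul_assoc, ← ofReal_norm,
      Complex.norm_real, Real.norm_of_nonneg (by positivity),
      ENNReal.ofReal_rpow_of_nonneg (by positivity) (by norm_num),
      ← ENNReal.ofReal_mul (by positivity)]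
    congr 2
    rw [Real.mul_rpow (by positivity) (by positivity), ← Real.rpow_mul h'.le]
    norm_num
    rw [Real.rpow_neg_one]
    field_simp
  have hkn : eLpNorm k 2 volume = ENNReal.ofReal π ^ (1 / 2 : ℝ) * eLpNorm φ 2 volume := by
    rw [eLpNorm_two_eq_lintegral, eLpNorm_two_eq_lintegral, hkl,
      ENNReal.mul_rpow_of_nonneg _ _ (by norm_num)]
  have hk2 : MemLp k 2 := by
    refine ⟨hkm.aestronglyMeasurable, ?_⟩
    rw [hkn]
    exact ENNReal.mul_lt_top (ENNReal.rpow_lt_top_of_nonneg (by norm_num) ENNReal.ofReal_ne_top)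
      h2.2
  have e : (fun t : ℝ => 𝓕⁻ (fun ξ : ℝ => ((|ξ| ^ (1 / 2 : ℝ) : ℝ) : ℂ) *
      (Complex.exp (Complex.I * (t * ξ * |ξ|)) * φ ξ)) x) = 𝓕⁻ k := by
    ext t
    rw [Real.fourierInv_eq', Real.fourierInv_eq']
    refine Eq.trans ?_ (integral_comp_dispersion _).symm
    refine integral_congr_ae (Eventually.of_forall fun ξ => ?_)
    simp only [hkw, smul_comm (|ξ| / π), hsm]
    simp only [RCLike.inner_apply, conj_trivial, smul_eq_mul]
    have : Complex.I * (t * ξ * (|ξ| : ℝ)) =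
        ((2 * π * (t * (ξ * |ξ| / (2 * π))) : ℝ) : ℂ) * Complex.I := by
      have : 2 * π * (t * (ξ * |ξ| / (2 * π))) = t * ξ * |ξ| := by field_simp
      rw [this]; push_cast; ring
    rw [this, mul_comm x ξ]
    ring
  rw [e, eLpNorm_fourierInv_eq hk1 hk2, hkn]

/-- The slice `y ↦ f (y, τ)` of a Schwartz function of two variables. -/
def schwartzSlice (f : SchwartzMap (ℝ × ℝ) ℂ) (τ : ℝ) : SchwartzMap ℝ ℂ :=
  SchwartzMap.compCLM ℂ (g := fun y : ℝ => (y, τ))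
    (by
      have : (fun y : ℝ => (y, τ)) = fun y => ContinuousLinearMap.inl ℝ ℝ ℝ y + (0, τ) := by
        ext y <;> simp
      rw [this]
      exact (ContinuousLinearMap.hasTemperateGrowth _).add (.const _))
    ⟨1, 1, fun y => by
      have : ‖y‖ ≤ ‖(y, τ)‖ := norm_fst_le (y, τ)
      linarith⟩ f

@[simp]
lemma schwartzSlice_apply (f : SchwartzMap (ℝ × ℝ) ℂ) (τ y : ℝ) : schwartzSlice f τ y = f (y, τ) :=
  rfl

lemma deriv_schwartzSlice (f : SchwartzMap (ℝ × ℝ) ℂ) (τ : ℝ) :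
    deriv (schwartzSlice f τ) =
      schwartzSlice (LineDeriv.lineDerivOp ((1, 0) : ℝ × ℝ) f) τ := by
  ext y
  rw [schwartzSlice_apply, SchwartzMap.lineDerivOp_apply_eq_fderiv]
  have h1 : HasDerivAt (fun y : ℝ => (y, τ)) (1, 0) y :=
    (hasDerivAt_id y).prodMk (hasDerivAt_const y τ)
  exact ((f.hasFDerivAt (y, τ)).comp_hasDerivAt y h1).deriv

lemma exists_norm_schwartzSlice_le (f : SchwartzMap (ℝ × ℝ) ℂ) :
    ∃ C : ℝ, ∀ τ y, ‖schwartzSlice f τ y‖ ≤ C * (1 + y ^ 2)⁻¹ := by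
  obtain ⟨C₀, -, h0⟩ := f.decay 0 0
  obtain ⟨C₂, -, h2⟩ := f.decay 2 0
  refine ⟨C₀ + C₂, fun τ y => ?_⟩
  rw [← div_eq_mul_inv, le_div_iff₀ (by positivity), schwartzSlice_apply]
  have h0' := h0 (y, τ)
  have h2' := h2 (y, τ)
  simp only [norm_iteratedFDeriv_zero, pow_zero, one_mul] at h0' h2'
  have hy : y ^ 2 ≤ ‖(y, τ)‖ ^ 2 := by
    rw [← sq_abs y]
    exact pow_le_pow_left₀ (abs_nonneg _) (norm_fst_le (y, τ)) 2
  nlinarith [mul_le_mul_of_nonneg_right hy (norm_nonneg (f (y, τ)))]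

lemma exists_pow_mul_norm_fourier_schwartzSlice_le (n : ℕ) (f : SchwartzMap (ℝ × ℝ) ℂ) :
    ∃ C : ℝ, ∀ τ ξ, |ξ| ^ n * ‖𝓕 (schwartzSlice f τ : ℝ → ℂ) ξ‖ ≤ C := by
  induction n generalizing f with
  | zero =>
    obtain ⟨C, hC⟩ := exists_norm_schwartzSlice_le f
    refine ⟨∫ y : ℝ, C * (1 + y ^ 2)⁻¹, fun τ ξ => ?_⟩
    rw [pow_zero, one_mul]
    refine (VectorFourier.norm_fourierIntegral_le_integral_norm _ _ _ _ _).trans ?_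
    exact integral_mono (schwartzSlice f τ).integrable.norm
      (integrable_inv_one_add_sq.const_mul C) (hC τ)
  | succ n ih =>
    obtain ⟨C, hC⟩ := ih (LineDeriv.lineDerivOp ((1, 0) : ℝ × ℝ) f)
    refine ⟨C / (2 * π), fun τ ξ => ?_⟩
    have hπ := Real.pi_pos
    have hd := hC τ ξ
    have hi : Integrable (deriv (schwartzSlice f τ)) := by
      rw [deriv_schwartzSlice]; exact SchwartzMap.integrable _
    rw [← deriv_schwartzSlice, Real.fourier_deriv (SchwartzMap.integrable _)
      (SchwartzMap.differentiable _) hi] at hd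
    rw [le_div_iff₀ (by positivity)]
    refine le_trans (le_of_eq ?_) hd
    simp only [smul_eq_mul, norm_mul, Complex.norm_real, Complex.norm_I, Complex.norm_ofNat,
      Real.norm_eq_abs, abs_of_pos hπ]
    ring

/-- The partial Fourier transform of a Schwartz function decays uniformly in the other variable. -/
lemma exists_norm_fourier_schwartzSlice_le (f : SchwartzMap (ℝ × ℝ) ℂ) :
    ∃ C : ℝ, 0 ≤ C ∧ ∀ τ ξ,
      ‖𝓕 (fun y => f (y, τ)) ξ‖ ≤ C * ((1 + ξ ^ 2) ^ 2)⁻¹ := by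
  obtain ⟨C₀, h0⟩ := exists_pow_mul_norm_fourier_schwartzSlice_le 0 f
  obtain ⟨C₂, h2⟩ := exists_pow_mul_norm_fourier_schwartzSlice_le 2 f
  obtain ⟨C₄, h4⟩ := exists_pow_mul_norm_fourier_schwartzSlice_le 4 f
  have key : ∀ τ ξ, ‖𝓕 (fun y => f (y, τ)) ξ‖ ≤ (C₀ + 2 * C₂ + C₄) * ((1 + ξ ^ 2) ^ 2)⁻¹ := by
    intro τ ξ
    rw [← div_eq_mul_inv, le_div_iff₀ (by positivity)]
    have a0 := h0 τ ξ
    have a2 := h2 τ ξ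
    have a4 := h4 τ ξ
    rw [sq_abs] at a2
    rw [show |ξ| ^ 4 = ξ ^ 4 by rw [show 4 = 2 * 2 by norm_num, pow_mul, sq_abs, pow_mul]] at a4
    change _ * ‖𝓕 (fun y => f (y, τ)) ξ‖ ≤ _ at a0
    change _ * ‖𝓕 (fun y => f (y, τ)) ξ‖ ≤ _ at a2
    change _ * ‖𝓕 (fun y => f (y, τ)) ξ‖ ≤ _ at a4
    linear_combination a0 + 2 * a2 + a4
  refine ⟨_, ?_, key⟩
  have := (norm_nonneg _).trans (key 0 0)
  simpa using this

lemma measurable_fourier_slice (f : SchwartzMap (ℝ × ℝ) ℂ) :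
    Measurable (Function.uncurry fun τ ξ : ℝ => 𝓕 (fun y => f (y, τ)) ξ) := by
  have : (Function.uncurry fun τ ξ : ℝ => 𝓕 (fun y => f (y, τ)) ξ) = fun p : ℝ × ℝ =>
      ∫ y : ℝ, Complex.exp ((-2 * π * (p.2 * y) : ℝ) * Complex.I) • f (y, p.1) := by
    ext ⟨τ, ξ⟩
    simp only [Function.uncurry, Real.fourier_eq', RCLike.inner_apply, conj_trivial]
  rw [this]
  have hc : Continuous fun q : (ℝ × ℝ) × ℝ =>
      Complex.exp ((-2 * π * (q.1.2 * q.2) : ℝ) * Complex.I) • f (q.2, q.1.1) := by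
    have := f.continuous
    fun_prop
  exact (hc.stronglyMeasurable.integral_prod_right (ν := volume)).measurable

lemma norm_fourierInv_kernel (x ξ : ℝ) : ‖Complex.exp ((2 * π * (ξ * x) : ℝ) * Complex.I)‖ = 1 :=
  Complex.norm_exp_ofReal_mul_I _

lemma norm_dispersion_kernel (t ξ : ℝ) : ‖Complex.exp (Complex.I * (t * ξ * |ξ|))‖ = 1 := by
  rw [show Complex.I * ((t : ℂ) * ξ * (|ξ| : ℝ)) = ((t * ξ * |ξ| : ℝ) : ℂ) * Complex.I by
    push_cast; ring]
  exact Complex.norm_exp_ofReal_mul_I _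

/-- The inverse Fourier transform commutes with integration in a parameter over a bounded
interval, for uniformly decaying symbols. -/
lemma setIntegral_fourierInv {K : ℝ → ℝ → ℂ} (hK : Measurable (Function.uncurry K)) {C : ℝ}
    (hb : ∀ τ ξ, ‖K τ ξ‖ ≤ C * (1 + ξ ^ 2)⁻¹) (t x : ℝ) :
    ∫ τ in Ioc 0 t, 𝓕⁻ (K τ) x = 𝓕⁻ (fun ξ => ∫ τ in Ioc 0 t, K τ ξ) x := by
  simp only [Real.fourierInv_eq', RCLike.inner_apply, conj_trivial, smul_eq_mul]
  rw [integral_integral_swap]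
  · refine integral_congr_ae (Eventually.of_forall fun ξ => ?_)
    exact integral_const_mul _ _
  · have hi : Integrable (fun p : ℝ × ℝ => C * (1 + p.2 ^ 2)⁻¹)
        ((volume.restrict (Ioc 0 t)).prod volume) := by
      have h1 : Integrable (fun _ : ℝ => C) (volume.restrict (Ioc 0 t)) :=
        integrableOn_const (by simp)
      exact h1.mul_prod integrable_inv_one_add_sq
    refine hi.mono' ?_ (Eventually.of_forall fun p => ?_)
    · have hK' : Measurable fun p : ℝ × ℝ => K p.1 p.2 := hK
      refine Measurable.aestronglyMeasurable ?_
      simp only [Function.uncurry_def]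
      fun_prop
    · rw [Function.uncurry, norm_mul, mul_comm x, norm_fourierInv_kernel, one_mul]
      exact hb _ _

/-- Applying a Fourier multiplier to the inverse Fourier transform of a continuous integrable
function `H` gives the expected function, or zero when `𝓕⁻ H` is not integrable. -/
lemma FMul_fourierInv_eq_or (m : ℝ → ℂ) {H : ℝ → ℂ} (hc : Continuous H) (hi : Integrable H) :
    FMul m (𝓕⁻ H) = 𝓕⁻ (fun ξ => m ξ * H ξ) ∨ FMul m (𝓕⁻ H) = 0 := by
  by_cases h : Integrable (𝓕⁻ H)
  · left
    have h' : Integrable (𝓕 H) := by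
      have e : 𝓕 H = fun x => 𝓕⁻ H (-x) := by
        ext x
        rw [Real.fourierInv_eq_fourier_neg, neg_neg]
      rw [e]
      exact h.comp_neg
    rw [FMul, hc.fourier_fourierInv_eq hi h']
  · right
    have e : 𝓕 (𝓕⁻ H) = 0 := by
      ext ξ
      rw [Real.fourier_eq]
      refine integral_undef fun h0 => h ?_
      exact (Real.fourierIntegral_convergent_iff ξ).1 h0
    ext x
    simp [FMul, e, Real.fourierInv_eq']

section DecayingSymbol

variable {F : ℝ → ℝ → ℂ} {C : ℝ}

lemma abs_rpow_le_one_add_sq {a : ℝ} (ha0 : 0 ≤ a) (ha2 : a ≤ 2) (ξ : ℝ) :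
    |ξ| ^ a ≤ 1 + ξ ^ 2 := by
  rcases le_total |ξ| 1 with h | h
  · exact (Real.rpow_le_one (abs_nonneg _) h ha0).trans (by nlinarith [sq_nonneg ξ])
  · refine (Real.rpow_le_rpow_of_exponent_le h ha2).trans ?_
    rw [Real.rpow_two, sq_abs]
    linarith

lemma norm_abs_rpow_mul_le (hb : ∀ τ ξ, ‖F τ ξ‖ ≤ C * ((1 + ξ ^ 2) ^ 2)⁻¹) {a : ℝ}
    (ha0 : 0 ≤ a) (ha2 : a ≤ 2) (τ ξ : ℝ) :
    ‖((|ξ| ^ a : ℝ) : ℂ) * F τ ξ‖ ≤ C * (1 + ξ ^ 2)⁻¹ := by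
  rw [norm_mul, Complex.norm_real, Real.norm_of_nonneg (by positivity)]
  calc |ξ| ^ a * ‖F τ ξ‖ ≤ (1 + ξ ^ 2) * (C * ((1 + ξ ^ 2) ^ 2)⁻¹) :=
        mul_le_mul (abs_rpow_le_one_add_sq ha0 ha2 ξ) (hb τ ξ) (norm_nonneg _) (by positivity)
    _ = C * (1 + ξ ^ 2)⁻¹ := by field_simp

lemma integrable_of_norm_le_inv_one_add_sq {g : ℝ → ℂ} (hm : Measurable g)
    (hb : ∀ ξ, ‖g ξ‖ ≤ C * (1 + ξ ^ 2)⁻¹) : Integrable g :=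
  (integrable_inv_one_add_sq.const_mul C).mono' hm.aestronglyMeasurable (Eventually.of_forall hb)

lemma memLp_two_of_norm_le_inv_one_add_sq {g : ℝ → ℂ} (hm : Measurable g)
    (hb : ∀ ξ, ‖g ξ‖ ≤ C * (1 + ξ ^ 2)⁻¹) : MemLp g 2 := by
  rw [memLp_two_iff_integrable_sq_norm hm.aestronglyMeasurable]
  refine (integrable_inv_one_add_sq.const_mul (C ^ 2)).mono' (by fun_prop)
    (Eventually.of_forall fun ξ => ?_)
  have h0 := norm_nonneg (g ξ)
  have h1 : (1 + ξ ^ 2)⁻¹ ≤ 1 := inv_le_one_of_one_le₀ (by nlinarith [sq_nonneg ξ])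
  have h2 : 0 ≤ (1 + ξ ^ 2)⁻¹ := by positivity
  rw [Real.norm_of_nonneg (by positivity)]
  calc ‖g ξ‖ ^ 2 ≤ (C * (1 + ξ ^ 2)⁻¹) ^ 2 := pow_le_pow_left₀ h0 (hb ξ) 2
    _ = C ^ 2 * ((1 + ξ ^ 2)⁻¹ * (1 + ξ ^ 2)⁻¹) := by ring
    _ ≤ C ^ 2 * (1 + ξ ^ 2)⁻¹ := by
      refine mul_le_mul_of_nonneg_left ?_ (sq_nonneg C)
      nlinarith

/-- Pointwise bound of a fractional derivative of the Duhamel integral by the time integral of the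
absolute values of the freely evolved sources. -/
lemma enorm_Dop_duhamel_le (hm : Measurable (Function.uncurry F)) (hc : ∀ τ, Continuous (F τ))
    (hC : 0 ≤ C) (hb : ∀ τ ξ, ‖F τ ξ‖ ≤ C * ((1 + ξ ^ 2) ^ 2)⁻¹) {a : ℝ}
    (ha0 : 0 ≤ a) (ha2 : a ≤ 2) (t x : ℝ) :
    ‖Dop a (fun x => ∫ τ in Ioc 0 t,
        𝓕⁻ (fun ξ : ℝ => Complex.exp (Complex.I * ((t - τ : ℝ) * ξ * |ξ|)) * F τ ξ) x) x‖ₑ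
      ≤ ∫⁻ τ in Ioc 0 t, ‖𝓕⁻ (fun ξ : ℝ => ((|ξ| ^ a : ℝ) : ℂ) *
        (Complex.exp (Complex.I * ((t - τ : ℝ) * ξ * |ξ|)) * F τ ξ)) x‖ₑ := by
  set K : ℝ → ℝ → ℂ := fun τ ξ => Complex.exp (Complex.I * ((t - τ : ℝ) * ξ * |ξ|)) * F τ ξ with hK
  have hm' : Measurable fun p : ℝ × ℝ => F p.1 p.2 := hm
  have hKm : Measurable (Function.uncurry K) := by
    simp only [hK, Function.uncurry_def]; fun_prop
  have hKm' : Measurable fun p : ℝ × ℝ => K p.1 p.2 := hKm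
  have hKb2 : ∀ τ ξ, ‖K τ ξ‖ ≤ C * ((1 + ξ ^ 2) ^ 2)⁻¹ := fun τ ξ => by
    rw [hK, norm_mul, norm_dispersion_kernel, one_mul]; exact hb τ ξ
  have hKa : ∀ τ ξ, ‖((|ξ| ^ a : ℝ) : ℂ) * K τ ξ‖ ≤ C * (1 + ξ ^ 2)⁻¹ :=
    norm_abs_rpow_mul_le hKb2 ha0 ha2
  have hKb : ∀ τ ξ, ‖K τ ξ‖ ≤ C * (1 + ξ ^ 2)⁻¹ := fun τ ξ => by
    simpa using norm_abs_rpow_mul_le hKb2 le_rfl zero_le_two τ ξ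
  have hKC : ∀ τ ξ, ‖K τ ξ‖ ≤ C := fun τ ξ => (hKb τ ξ).trans
    (mul_le_of_le_one_right hC (inv_le_one_of_one_le₀ (by nlinarith [sq_nonneg ξ])))
  set H : ℝ → ℂ := fun ξ => ∫ τ in Ioc 0 t, K τ ξ with hH
  have hHm : Measurable H :=
    (StronglyMeasurable.integral_prod_left (μ := volume.restrict (Ioc 0 t))
      hKm.stronglyMeasurable).measurable
  have hHc : Continuous H := by
    refine continuous_of_dominated (bound := fun _ => C) (fun ξ => ?_)
      (fun ξ => Eventually.of_forall fun τ => hKC τ ξ) (integrableOn_const (by simp))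
      (Eventually.of_forall fun τ => ?_)
    · exact (hKm'.comp (measurable_id.prodMk measurable_const)).aestronglyMeasurable
    · have := hc τ
      simp only [hK]
      fun_prop
  have hHi : Integrable H := by
    refine integrable_of_norm_le_inv_one_add_sq (C := C * volume.real (Ioc 0 t)) hHm fun ξ => ?_
    refine (norm_setIntegral_le_of_norm_le_const (by simp) (fun τ _ => hKb τ ξ)).trans_eq ?_
    ring
  have hu : (fun x => ∫ τ in Ioc 0 t, 𝓕⁻ (K τ) x) = 𝓕⁻ H := by
    ext x
    exact setIntegral_fourierInv hKm hKb t x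
  change ‖Dop a (fun x => ∫ τ in Ioc 0 t, 𝓕⁻ (K τ) x) x‖ₑ ≤ _
  rw [hu, Dop]
  rcases FMul_fourierInv_eq_or (fun ξ : ℝ => ((|ξ| ^ a : ℝ) : ℂ)) hHc hHi with e | e
  · rw [e]
    have e2 : (fun ξ : ℝ => ((|ξ| ^ a : ℝ) : ℂ) * H ξ)
        = fun ξ : ℝ => ∫ τ in Ioc 0 t, ((|ξ| ^ a : ℝ) : ℂ) * K τ ξ := by
      ext ξ
      exact (integral_const_mul _ _).symm
    rw [e2, ← setIntegral_fourierInv (K := fun τ ξ => ((|ξ| ^ a : ℝ) : ℂ) * K τ ξ) _ hKa]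
    · exact enorm_integral_le_lintegral_enorm _
    · simp only [Function.uncurry_def]; fun_prop
  · rw [e]; simp

/-- Local smoothing for the Duhamel integral, in terms of the partial Fourier transform of the
source. -/
lemma lintegral_Dop_duhamel_le (hm : Measurable (Function.uncurry F))
    (hc : ∀ τ, Continuous (F τ)) (hC : 0 ≤ C)
    (hb : ∀ τ ξ, ‖F τ ξ‖ ≤ C * ((1 + ξ ^ 2) ^ 2)⁻¹) {s : ℝ} (hs0 : 0 < s) (hs1 : s ≤ 1)
    (T x : ℝ) :
    eLpNorm (fun t => Dop (s + 1 / 2) (fun x => ∫ τ in Ioc 0 t,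
        𝓕⁻ (fun ξ : ℝ => Complex.exp (Complex.I * ((t - τ : ℝ) * ξ * |ξ|)) * F τ ξ) x) x) 2
        (volume.restrict (Ioc 0 T))
      ≤ ENNReal.ofReal π ^ (1 / 2 : ℝ) *
        ∫⁻ τ in Ioc 0 T, eLpNorm (fun ξ : ℝ => ((|ξ| ^ s : ℝ) : ℂ) * F τ ξ) 2 volume := by
  have hm' : Measurable fun p : ℝ × ℝ => F p.1 p.2 := hm
  set φ : ℝ → ℝ → ℂ := fun τ ξ => ((|ξ| ^ s : ℝ) : ℂ) * F τ ξ with hφ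
  have hFτ : ∀ τ, Measurable (F τ) := fun τ => (hc τ).measurable
  have hφm : ∀ τ, Measurable (φ τ) := fun τ => by
    have := hFτ τ
    simp only [hφ]; fun_prop
  have hφb : ∀ τ ξ, ‖φ τ ξ‖ ≤ C * (1 + ξ ^ 2)⁻¹ :=
    norm_abs_rpow_mul_le hb hs0.le (by linarith)
  have hmul : ∀ τ ξ, ∀ z : ℂ, ((|ξ| ^ (s + 1 / 2) : ℝ) : ℂ) * (z * F τ ξ) =
      ((|ξ| ^ (1 / 2 : ℝ) : ℝ) : ℂ) * (z * φ τ ξ) := fun τ ξ z => by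
    rw [hφ, Real.rpow_add_of_nonneg (abs_nonneg ξ) hs0.le (by norm_num), Complex.ofReal_mul]
    ring
  have hφi : ∀ τ, Integrable fun ξ : ℝ => ((|ξ| ^ (1 / 2 : ℝ) : ℝ) : ℂ) * φ τ ξ := fun τ => by
    have e : (fun ξ : ℝ => ((|ξ| ^ (1 / 2 : ℝ) : ℝ) : ℂ) * φ τ ξ) =
        fun ξ : ℝ => ((|ξ| ^ (s + 1 / 2) : ℝ) : ℂ) * F τ ξ := by
      ext ξ
      simpa using (hmul τ ξ 1).symm
    have := hFτ τ
    rw [e]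
    exact integrable_of_norm_le_inv_one_add_sq (by fun_prop)
      (norm_abs_rpow_mul_le hb (by positivity) (by linarith) τ)
  set A : ℝ → ℝ → ℂ := fun τ t => 𝓕⁻ (fun ξ : ℝ => ((|ξ| ^ (1 / 2 : ℝ) : ℝ) : ℂ) *
    (Complex.exp (Complex.I * (t * ξ * |ξ|)) * φ τ ξ)) x with hA
  have hAm : Measurable (Function.uncurry fun τ t => A τ (t - τ)) := by
    have e : (Function.uncurry fun τ t => A τ (t - τ)) = fun p : ℝ × ℝ =>
        ∫ ξ : ℝ, Complex.exp ((2 * π * (ξ * x) : ℝ) * Complex.I) •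
          (((|ξ| ^ (1 / 2 : ℝ) : ℝ) : ℂ) *
            (Complex.exp (Complex.I * ((p.2 - p.1 : ℝ) * ξ * |ξ|)) * φ p.1 ξ)) := by
      ext ⟨τ, t⟩
      simp only [hA, Function.uncurry, Real.fourierInv_eq', RCLike.inner_apply, conj_trivial,
        mul_comm x]
    rw [e]
    refine (StronglyMeasurable.integral_prod_right (ν := volume)
      (f := fun (p : ℝ × ℝ) (ξ : ℝ) => Complex.exp ((2 * π * (ξ * x) : ℝ) * Complex.I) •
          (((|ξ| ^ (1 / 2 : ℝ) : ℝ) : ℂ) *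
            (Complex.exp (Complex.I * ((p.2 - p.1 : ℝ) * ξ * |ξ|)) * φ p.1 ξ))) ?_).measurable
    refine Measurable.stronglyMeasurable ?_
    have hF3 : Measurable fun q : (ℝ × ℝ) × ℝ => F q.1.1 q.2 :=
      hm'.comp ((measurable_fst.comp measurable_fst).prodMk measurable_snd)
    simp only [hφ, Function.uncurry_def]
    fun_prop
  have hpt : ∀ t ∈ Ioc 0 T, ‖Dop (s + 1 / 2) (fun x => ∫ τ in Ioc 0 t,
      𝓕⁻ (fun ξ : ℝ => Complex.exp (Complex.I * ((t - τ : ℝ) * ξ * |ξ|)) * F τ ξ) x) x‖ₑ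
      ≤ ∫⁻ τ in Ioc 0 T, ‖A τ (t - τ)‖ₑ := fun t ht => by
    refine (enorm_Dop_duhamel_le hm hc hC hb (by positivity) (by linarith) t x).trans ?_
    simp only [hmul]
    exact lintegral_mono_set (Ioc_subset_Ioc_right ht.2)
  rw [eLpNorm_two_eq_lintegral]
  calc (∫⁻ t in Ioc 0 T, ‖Dop (s + 1 / 2) (fun x => ∫ τ in Ioc 0 t, 𝓕⁻ (fun ξ : ℝ =>
          Complex.exp (Complex.I * ((t - τ : ℝ) * ξ * |ξ|)) * F τ ξ) x) x‖ₑ ^ (2 : ℝ)) ^ (1 / 2 : ℝ)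
      ≤ (∫⁻ t in Ioc 0 T, (∫⁻ τ in Ioc 0 T, ‖A τ (t - τ)‖ₑ) ^ (2 : ℝ)) ^ (1 / 2 : ℝ) := by
        refine ENNReal.rpow_le_rpow ?_ (by norm_num)
        refine setLIntegral_mono' measurableSet_Ioc fun t ht => ?_
        exact ENNReal.rpow_le_rpow (hpt t ht) (by norm_num)
    _ ≤ ∫⁻ τ in Ioc 0 T, (∫⁻ t in Ioc 0 T, ‖A τ (t - τ)‖ₑ ^ (2 : ℝ)) ^ (1 / 2 : ℝ) :=
        lintegral_lintegral_sq_le _ _ hAm.enorm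
    _ ≤ ∫⁻ τ in Ioc 0 T, ENNReal.ofReal π ^ (1 / 2 : ℝ) * eLpNorm (φ τ) 2 volume := by
        refine lintegral_mono fun τ => ?_
        calc (∫⁻ t in Ioc 0 T, ‖A τ (t - τ)‖ₑ ^ (2 : ℝ)) ^ (1 / 2 : ℝ)
            ≤ (∫⁻ t, ‖A τ (t - τ)‖ₑ ^ (2 : ℝ)) ^ (1 / 2 : ℝ) :=
              ENNReal.rpow_le_rpow (setLIntegral_le_lintegral _ _) (by norm_num)
          _ = (∫⁻ t, ‖A τ t‖ₑ ^ (2 : ℝ)) ^ (1 / 2 : ℝ) := by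
              rw [lintegral_sub_right_eq_self (fun t => ‖A τ t‖ₑ ^ (2 : ℝ)) τ]
          _ = eLpNorm (A τ) 2 volume := (eLpNorm_two_eq_lintegral _ _).symm
          _ ≤ _ := eLpNorm_local_smoothing_le (hφm τ)
              (memLp_two_of_norm_le_inv_one_add_sq (hφm τ) (hφb τ)) (hφi τ) x
    _ = _ := lintegral_const_mul' _ _
        (ENNReal.rpow_ne_top_of_nonneg (by norm_num) ENNReal.ofReal_ne_top)

end DecayingSymbol

lemma LqLp_one_eq_lintegral {p : ℝ≥0∞} {T : ℝ} {f : ℝ → ℝ → ℂ}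
    (hf : ∀ t, eLpNorm (fun x => f x t) p volume ≠ ∞) :
    LqLp 1 p T f = ∫⁻ t in Ioc 0 T, eLpNorm (fun x => f x t) p volume := by
  rw [LqLp, eLpNorm_one_eq_lintegral_enorm]
  refine lintegral_congr fun t => ?_
  rw [Real.enorm_of_nonneg ENNReal.toReal_nonneg, ENNReal.ofReal_toReal (hf t)]

lemma LpLq_top_le {q M : ℝ≥0∞} {T : ℝ} {f : ℝ → ℝ → ℂ}
    (hf : ∀ x, eLpNorm (f x) q (volume.restrict (Ioc 0 T)) ≤ M) : LpLq ∞ q T f ≤ M := by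
  rw [LpLq, eLpNorm_exponent_top]
  refine eLpNormEssSup_le_of_ae_enorm_bound (Eventually.of_forall fun x => ?_)
  rw [Real.enorm_of_nonneg ENNReal.toReal_nonneg]
  exact ENNReal.ofReal_toReal_le.trans (hf x)

/-- For `0 < s < 1/2` and `T > 0`, for all `f ∈ 𝒮(ℝ²)`,
`‖D_x^{s+1/2} ∫₀ᵗ V(t-τ) f(τ) dτ‖_{L^∞_x L^2_T} ≲ ‖D_x^s f‖_{L^1_T L^2_x}`,
with implicit constant independent of `f` and `T`. -/
theorem retarded_Kato_smoothing (s : ℝ) (hs0 : 0 < s) (hs : s < 1/2) :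
    ∃ C : ℝ≥0, 0 < C ∧ ∀ (f : SchwartzMap (ℝ × ℝ) ℂ) (T : ℝ), 0 < T →
      LpLq ∞ 2 T (sliceOp (Dop (s + 1/2)) (duhamel (fun x t => f (x, t))))
        ≤ C * LqLp 1 2 T (sliceOp (Dop s) (fun x t => f (x, t))) := by
  refine ⟨(Real.toNNReal π) ^ (1 / 2 : ℝ),
    NNReal.rpow_pos (Real.toNNReal_pos.2 Real.pi_pos), fun f T _ => ?_⟩
  obtain ⟨C, hC, hb⟩ := exists_norm_fourier_schwartzSlice_le f
  have hm := measurable_fourier_slice f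
  have hc : ∀ τ, Continuous (𝓕 fun y => f (y, τ)) := fun τ =>
    VectorFourier.fourierIntegral_continuous Real.continuous_fourierChar
      (by exact (innerSL ℝ).continuous₂) (schwartzSlice f τ).integrable
  have hφb := norm_abs_rpow_mul_le (F := fun τ => 𝓕 fun y => f (y, τ)) hb hs0.le (by linarith)
  have hφm : ∀ τ, Measurable fun ξ : ℝ => ((|ξ| ^ s : ℝ) : ℂ) * 𝓕 (fun y => f (y, τ)) ξ :=
    fun τ => by
      have := (hc τ).measurable
      fun_prop
  have hφ2 := fun τ => memLp_two_of_norm_le_inv_one_add_sq (hφm τ) (hφb τ)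
  have hP : ∀ τ, eLpNorm (fun x => sliceOp (Dop s) (fun x t => f (x, t)) x τ) 2 volume =
      eLpNorm (fun ξ : ℝ => ((|ξ| ^ s : ℝ) : ℂ) * 𝓕 (fun y => f (y, τ)) ξ) 2 volume := fun τ =>
    eLpNorm_fourierInv_eq (integrable_of_norm_le_inv_one_add_sq (hφm τ) (hφb τ)) (hφ2 τ)
  rw [LqLp_one_eq_lintegral fun τ => by rw [hP]; exact (hφ2 τ).2.ne]
  refine LpLq_top_le fun x => ?_
  simp only [hP]
  rw [ENNReal.coe_rpow_of_nonneg _ (by norm_num)]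
  exact lintegral_Dop_duhamel_le hm hc hC hb hs0 (by linarith) T x

end
end
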